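/- Let Δ be a non-𝕜-orientable 𝕜-homology manifold on n vertices and assume R = 𝕜[Δ] is Cohen–Macaulay. Then R is level of Cohen–Macaulay type n, and tr(ω_R) = 𝔐², where 𝔐 is the graded maximal ideal of R. -/

import Mathlib

/-! # Preliminaries

Self-contained definitions: simplicial complexes, simplicial homology, Stanley–Reisner rings,
canonical modules, canonical traces, and the various Gorenstein-type conditions. -/

open CategoryTheory

/-- An abstract simplicial complex on the vertex set `Fin n` (the empty set is a face). -/
structure SC (n : ℕ) where
  faces : Finset (Finset (Fin n))
  empty_mem : ∅ ∈ faces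
  down_closed : ∀ {σ τ : Finset (Fin n)}, σ ∈ faces → τ ⊆ σ → τ ∈ faces

namespace SC

variable {n : ℕ} (Δ : SC n)

/-- The dimension of a simplicial complex, as an integer (the complex `{∅}` has
dimension `-1`). -/
def dim : ℤ := ((Δ.faces.sup Finset.card : ℕ) : ℤ) - 1

/-- `v` is a vertex of `Δ`. -/
def IsVertex (v : Fin n) : Prop := {v} ∈ Δ.faces

/-- A facet is a face which is maximal by inclusion. -/
def IsFacet (σ : Finset (Fin n)) : Prop :=
  σ ∈ Δ.faces ∧ ∀ τ ∈ Δ.faces, σ ⊆ τ → σ = τ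

/-- A cone point is a vertex contained in every facet. -/
def IsConePoint (v : Fin n) : Prop :=
  Δ.IsVertex v ∧ ∀ σ, Δ.IsFacet σ → v ∈ σ

/-- A simplicial complex is connected if it has a vertex and any two vertices are joined
by a path of edges. -/
def Connected : Prop :=
  (∃ v, Δ.IsVertex v) ∧ ∀ u v, Δ.IsVertex u → Δ.IsVertex v →
    Relation.ReflTransGen (fun a b => ({a, b} : Finset (Fin n)) ∈ Δ.faces) u v

/-- A simplicial complex is strongly connected if any two facets are joined by a chain of
facets in which consecutive facets intersect in a face of dimension `dim Δ - 1`. -/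
def StronglyConnected : Prop :=
  ∀ σ τ, Δ.IsFacet σ → Δ.IsFacet τ →
    Relation.ReflTransGen
      (fun α β => Δ.IsFacet α ∧ Δ.IsFacet β ∧ ((α ∩ β).card : ℤ) - 1 = Δ.dim - 1) σ τ

/-- A pseudomanifold: strongly connected, and every face of dimension `dim Δ - 1` is
contained in exactly two facets. -/
def IsPseudomanifold : Prop :=
  Δ.StronglyConnected ∧
    ∀ τ ∈ Δ.faces, (τ.card : ℤ) - 1 = Δ.dim - 1 →
      {σ : Finset (Fin n) | Δ.IsFacet σ ∧ τ ⊆ σ}.ncard = 2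

/-- The link of a face `σ` of `Δ`. -/
def link (σ : Finset (Fin n)) (hσ : σ ∈ Δ.faces) : SC n where
  faces := Δ.faces.filter fun τ => τ ∩ σ = ∅ ∧ τ ∪ σ ∈ Δ.faces
  empty_mem := by
    simp only [Finset.mem_filter]
    exact ⟨Δ.empty_mem, by simp, by simpa using hσ⟩
  down_closed := by
    intro σ' τ' h hsub
    simp only [Finset.mem_filter] at h ⊢
    refine ⟨Δ.down_closed h.1 hsub, ?_, ?_⟩
    · have := h.2.1
      rw [Finset.eq_empty_iff_forall_notMem] at this ⊢
      intro x hx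
      exact this x (Finset.mem_inter.mpr
        ⟨hsub (Finset.mem_inter.mp hx).1, (Finset.mem_inter.mp hx).2⟩)
    · exact Δ.down_closed h.2.2 (Finset.union_subset_union hsub (le_refl σ))

/-- A complex is normal if the link of every face of dimension `≤ dim Δ - 2` is connected. -/
def Normal : Prop :=
  ∀ σ (hσ : σ ∈ Δ.faces), (σ.card : ℤ) - 1 ≤ Δ.dim - 2 → (Δ.link σ hσ).Connected

/-! ## Simplicial homology -/

/-- Faces of `Δ` of cardinality `c` containing the face `σ`.  These index a basis of the
`c`-th chain group of the pair `(Δ, cost_Δ σ)` (for `σ = ∅` this is the augmented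
(reduced) chain complex of `Δ`, since the empty face is included in chain degree `0`). -/
def RFace (σ : Finset (Fin n)) (c : ℕ) : Type :=
  {τ : Finset (Fin n) // τ ∈ Δ.faces ∧ σ ⊆ τ ∧ τ.card = c}

instance (σ : Finset (Fin n)) (c : ℕ) : Fintype (Δ.RFace σ c) :=
  inferInstanceAs (Fintype {τ : Finset (Fin n) // τ ∈ Δ.faces ∧ σ ⊆ τ ∧ τ.card = c})

instance (σ : Finset (Fin n)) (c : ℕ) : DecidableEq (Δ.RFace σ c) :=
  inferInstanceAs (DecidableEq {τ : Finset (Fin n) // τ ∈ Δ.faces ∧ σ ⊆ τ ∧ τ.card = c})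

variable (R : Type) [CommRing R]

/-- Chains of the pair `(Δ, cost_Δ σ)` with coefficients in `R`. -/
abbrev relChain (σ : Finset (Fin n)) (c : ℕ) : Type := Δ.RFace σ c → R

/-- The matrix of the simplicial boundary map of the pair `(Δ, cost_Δ σ)`: the coefficient of
`ρ` in `∂ τ` is `(-1)^j` if `ρ` is obtained from `τ` by deleting its `(j+1)`-st vertex (the
deleted vertex not belonging to `σ`), and `0` otherwise. -/
def relBMat (σ : Finset (Fin n)) (i : ℕ) :
    Matrix (Δ.RFace σ i) (Δ.RFace σ (i + 1)) R :=
  fun ρ τ => ∑ v ∈ τ.1, if v ∉ σ ∧ τ.1.erase v = ρ.1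
    then (-1 : R) ^ ((τ.1.filter (fun w => w < v)).card) else 0

/-- The boundary map of the chain complex of the pair `(Δ, cost_Δ σ)`. -/
noncomputable def relBoundary (σ : Finset (Fin n)) (i : ℕ) :
    Δ.relChain R σ (i + 1) →ₗ[R] Δ.relChain R σ i :=
  (Δ.relBMat R σ i).mulVecLin

/-- The relative simplicial homology `H_d(Δ, cost_Δ σ; R)` (`d ≥ 0`). -/
noncomputable def relHomology (σ : Finset (Fin n)) (d : ℕ) : Type :=
  LinearMap.ker (Δ.relBoundary R σ d) ⧸
    Submodule.comap (LinearMap.ker (Δ.relBoundary R σ d)).subtype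
      (LinearMap.range (Δ.relBoundary R σ (d + 1)))

noncomputable instance (σ : Finset (Fin n)) (d : ℕ) : AddCommGroup (Δ.relHomology R σ d) :=
  inferInstanceAs (AddCommGroup (LinearMap.ker (Δ.relBoundary R σ d) ⧸
    Submodule.comap (LinearMap.ker (Δ.relBoundary R σ d)).subtype
      (LinearMap.range (Δ.relBoundary R σ (d + 1)))))

noncomputable instance (σ : Finset (Fin n)) (d : ℕ) : Module R (Δ.relHomology R σ d) :=
  inferInstanceAs (Module R (LinearMap.ker (Δ.relBoundary R σ d) ⧸
    Submodule.comap (LinearMap.ker (Δ.relBoundary R σ d)).subtype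
      (LinearMap.range (Δ.relBoundary R σ (d + 1)))))

/-- Reduced simplicial homology `H̃_d(Δ; R)` for `d ≥ 0`: the homology of the augmented chain
complex, i.e. of the pair `(Δ, cost_Δ ∅)`. -/
noncomputable abbrev reducedHomology (d : ℕ) : Type := Δ.relHomology R ∅ d

/-- Reduced simplicial homology in degree `-1`. -/
noncomputable def reducedHomologyNeg : Type :=
  (⊤ : Submodule R (Δ.relChain R ∅ 0)) ⧸
    Submodule.comap (⊤ : Submodule R (Δ.relChain R ∅ 0)).subtype
      (LinearMap.range (Δ.relBoundary R ∅ 0))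

noncomputable instance : AddCommGroup (Δ.reducedHomologyNeg R) :=
  inferInstanceAs (AddCommGroup ((⊤ : Submodule R (Δ.relChain R ∅ 0)) ⧸
    Submodule.comap (⊤ : Submodule R (Δ.relChain R ∅ 0)).subtype
      (LinearMap.range (Δ.relBoundary R ∅ 0))))

noncomputable instance : Module R (Δ.reducedHomologyNeg R) :=
  inferInstanceAs (Module R ((⊤ : Submodule R (Δ.relChain R ∅ 0)) ⧸
    Submodule.comap (⊤ : Submodule R (Δ.relChain R ∅ 0)).subtype
      (LinearMap.range (Δ.relBoundary R ∅ 0))))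

/-- Cycles of the non-augmented chain complex of `Δ` in dimension `d` (for `d = 0` every
`0`-chain is a cycle). -/
noncomputable def cyclesUnred (d : ℕ) : Submodule R (Δ.relChain R ∅ (d + 1)) :=
  if d = 0 then ⊤ else LinearMap.ker (Δ.relBoundary R ∅ d)

/-- (Unreduced) simplicial homology `H_d(Δ; R)`. -/
noncomputable def homologyUnred (d : ℕ) : Type :=
  Δ.cyclesUnred R d ⧸
    Submodule.comap (Δ.cyclesUnred R d).subtype (LinearMap.range (Δ.relBoundary R ∅ (d + 1)))

noncomputable instance (d : ℕ) : AddCommGroup (Δ.homologyUnred R d) :=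
  inferInstanceAs (AddCommGroup (Δ.cyclesUnred R d ⧸
    Submodule.comap (Δ.cyclesUnred R d).subtype (LinearMap.range (Δ.relBoundary R ∅ (d + 1)))))

noncomputable instance (d : ℕ) : Module R (Δ.homologyUnred R d) :=
  inferInstanceAs (Module R (Δ.cyclesUnred R d ⧸
    Submodule.comap (Δ.cyclesUnred R d).subtype (LinearMap.range (Δ.relBoundary R ∅ (d + 1)))))

/-- `Δ` is `R`-orientable if `H_d(Δ; R) ≠ 0`, where `d = dim Δ`. -/
def Orientable : Prop :=
  ∃ d : ℕ, Δ.dim = (d : ℤ) ∧ Nontrivial (Δ.homologyUnred R d)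

/-- A `k`-homology sphere condition for a single complex `Γ`:
`H̃_i(Γ; k) = k` for `i = dim Γ` and `0` otherwise. -/
def HomologySphereCond (Γ : SC n) : Prop :=
  (∀ i : ℕ, ((i : ℤ) = Γ.dim → Nonempty ((Γ.reducedHomology R i) ≃ₗ[R] R)) ∧
    ((i : ℤ) ≠ Γ.dim → Subsingleton (Γ.reducedHomology R i))) ∧
  ((-1 : ℤ) = Γ.dim → Nonempty ((Γ.reducedHomologyNeg R) ≃ₗ[R] R)) ∧
  ((-1 : ℤ) ≠ Γ.dim → Subsingleton (Γ.reducedHomologyNeg R))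

/-- `Δ` is a `k`-homology manifold: it is connected and the link of every nonempty face has
the reduced homology of a sphere of its dimension. -/
def IsHomologyManifold : Prop :=
  Δ.Connected ∧ ∀ σ (hσ : σ ∈ Δ.faces), σ ≠ ∅ → HomologySphereCond R (Δ.link σ hσ)

/-- `Δ` is isomorphic to the disjoint union of `m` vertices. -/
def IsDisjointVertices (m : ℕ) : Prop :=
  ∃ v : Fin m → Fin n, Function.Injective v ∧
    ∀ σ : Finset (Fin n), σ ∈ Δ.faces ↔ (σ = ∅ ∨ ∃ i, σ = {v i})

/-- `Δ` is isomorphic to a path of length `m` (with `m` edges and `m+1` vertices). -/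
def IsPathComplex (m : ℕ) : Prop :=
  ∃ v : Fin (m + 1) → Fin n, Function.Injective v ∧
    ∀ σ : Finset (Fin n), σ ∈ Δ.faces ↔
      (σ = ∅ ∨ (∃ i, σ = {v i}) ∨ ∃ i : Fin m, σ = {v i.castSucc, v i.succ})

end SC

/-! ## Commutative algebra -/

/-- The `i`-th Ext module `Ext^i_R(M, N)` of two `R`-modules, as an object of `ModuleCat R`. -/
noncomputable def extMod (R : Type) [CommRing R] (M N : Type) [AddCommGroup M] [Module R M]
    [AddCommGroup N] [Module R N] (i : ℕ) : ModuleCat R :=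
  ((Ext R (ModuleCat R) i).obj (Opposite.op (ModuleCat.of R M))).obj (ModuleCat.of R N)

/-- The trace ideal of an `R`-module `M`: the sum of the images of all `R`-linear maps
`M → R`. -/
noncomputable def traceIdeal (R : Type) [CommRing R] (M : Type) [AddCommGroup M] [Module R M] :
    Ideal R :=
  ⨆ f : M →ₗ[R] R, LinearMap.range f

/-- A Noetherian ring `R` with a distinguished maximal ideal `𝔪` (a local ring, or a graded
ring with its graded maximal ideal) is Cohen--Macaulay when `depth = dim`, i.e. (by the
Ext-characterisation of depth) `Ext^i_R(R/𝔪, R) = 0` for all `i < dim R`. -/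
def IsCohenMacaulayAt (R : Type) [CommRing R] (𝔪 : Ideal R) : Prop :=
  IsNoetherianRing R ∧
    ∀ i : ℕ, (i : WithBot (WithTop ℕ)) < ringKrullDim R → Subsingleton (extMod R (R ⧸ 𝔪) R i)

/-- A Noetherian ring `R` with a distinguished maximal ideal `𝔪` (a local ring, or a graded
ring with its graded maximal ideal) is Gorenstein when `Ext^i_R(R/𝔪, R)` vanishes for
`i ≠ dim R` and is isomorphic to `R/𝔪` for `i = dim R`. -/
def IsGorensteinAt (R : Type) [CommRing R] (𝔪 : Ideal R) : Prop :=
  IsNoetherianRing R ∧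
    ∀ i : ℕ, ((i : WithBot (WithTop ℕ)) = ringKrullDim R →
        Nonempty ((extMod R (R ⧸ 𝔪) R i) ≃ₗ[R] (R ⧸ 𝔪))) ∧
      ((i : WithBot (WithTop ℕ)) ≠ ringKrullDim R → Subsingleton (extMod R (R ⧸ 𝔪) R i))

/-- A Noetherian local ring is Gorenstein. -/
def IsGorensteinLocalRing (A : Type) [CommRing A] [IsLocalRing A] : Prop :=
  IsGorensteinAt A (IsLocalRing.maximalIdeal A)

section Graded

variable (k : Type) [Field k] {n : ℕ}

/-- An ideal of a polynomial ring is homogeneous (graded) if it contains all homogeneous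
components of its elements. -/
def IsHomogIdeal (I : Ideal (MvPolynomial (Fin n) k)) : Prop :=
  ∀ p ∈ I, ∀ d : ℕ, MvPolynomial.homogeneousComponent d p ∈ I

/-- The graded (irrelevant) maximal ideal of `k[x_1,…,x_n]/I`, generated by the images of the
variables. -/
noncomputable def quotMax (I : Ideal (MvPolynomial (Fin n) k)) :
    Ideal (MvPolynomial (Fin n) k ⧸ I) :=
  Ideal.span (Set.range fun i : Fin n => Ideal.Quotient.mk I (MvPolynomial.X i))

/-- The degree `j` component of the standard graded ring `k[x_1,…,x_n]/I`, as a
`k`-subspace. -/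
noncomputable def quotGrade (I : Ideal (MvPolynomial (Fin n) k)) (j : ℕ) :
    Submodule k (MvPolynomial (Fin n) k ⧸ I) :=
  (MvPolynomial.homogeneousSubmodule (Fin n) k j).map (Ideal.Quotient.mkₐ k I).toLinearMap

/-- The `ℤ^n`-graded component of `k[x_1,…,x_n]/I` of multidegree `a`: the `k`-line spanned by
the image of the monomial `x^a`. -/
noncomputable def quotMonomialGrade (I : Ideal (MvPolynomial (Fin n) k)) (a : Fin n → ℕ) :
    Submodule k (MvPolynomial (Fin n) k ⧸ I) :=
  Submodule.span k
    {Ideal.Quotient.mk I (MvPolynomial.monomial (Finsupp.equivFunOnFinite.symm a) (1 : k))}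

/-- The standard graded ring `R = k[x_1,…,x_n]/I` is Gorenstein on the punctured spectrum if
`R_𝔭` is Gorenstein for every graded prime `𝔭` other than the graded maximal ideal. -/
def GorensteinPunctured (I : Ideal (MvPolynomial (Fin n) k)) : Prop :=
  ∀ (𝔭 : Ideal (MvPolynomial (Fin n) k ⧸ I)) [𝔭.IsPrime],
    IsHomogIdeal k (𝔭.comap (Ideal.Quotient.mk I)) → 𝔭 ≠ quotMax k I →
      IsGorensteinLocalRing (Localization.AtPrime 𝔭)

/-- `ω` is a canonical module of the standard graded ring `R = k[x_1,…,x_n]/I`, `d = dim R`,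
when `ω ≅ Ext^{n-d}_S(R, S)` for `S = k[x_1,…,x_n]` (by graded local duality this is, up to
shift, the Matlis dual of the top local cohomology module `H^d_𝔪(R)`). -/
def IsCanonicalModuleQ (I : Ideal (MvPolynomial (Fin n) k)) (ω : Type) [AddCommGroup ω]
    [Module (MvPolynomial (Fin n) k ⧸ I) ω] : Prop :=
  Module.Finite (MvPolynomial (Fin n) k ⧸ I) ω ∧
    ∃ d : ℕ, ringKrullDim (MvPolynomial (Fin n) k ⧸ I) = (d : WithBot (WithTop ℕ)) ∧
      letI : Module (MvPolynomial (Fin n) k) ω := Module.compHom ω (Ideal.Quotient.mk I)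
      Nonempty (ω ≃ₗ[MvPolynomial (Fin n) k]
        (extMod (MvPolynomial (Fin n) k) (MvPolynomial (Fin n) k ⧸ I)
          (MvPolynomial (Fin n) k) (n - d)))

/-- A `ℤ`-grading on a module `ω` over `R = k[x_1,…,x_n]/I` compatible with the standard
grading of `R`. -/
def IsCompatibleGrading (I : Ideal (MvPolynomial (Fin n) k)) (ω : Type) [AddCommGroup ω]
    [Module (MvPolynomial (Fin n) k ⧸ I) ω] [Module k ω] (gr : ℤ → Submodule k ω) : Prop :=
  DirectSum.IsInternal gr ∧
    ∀ (i : ℕ) (j : ℤ) (r : MvPolynomial (Fin n) k ⧸ I) (m : ω),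
      r ∈ quotGrade k I i → m ∈ gr j → r • m ∈ gr ((i : ℤ) + j)

/-- The minimal number of generators of a module `M` over `R = k[…]/I` with graded maximal
ideal `𝔪`: the `k`-dimension of `M/𝔪M`. -/
noncomputable def muGen (R : Type) [CommRing R] [Algebra k R] (𝔪 : Ideal R) (M : Type)
    [AddCommGroup M] [Module R M] : ℕ :=
  letI : Module k (M ⧸ (𝔪 • (⊤ : Submodule R M))) :=
    Module.compHom (M ⧸ (𝔪 • (⊤ : Submodule R M))) (algebraMap k R)
  Module.finrank k (M ⧸ (𝔪 • (⊤ : Submodule R M)))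

/-- The Hilbert--Samuel function `j ↦ dim_k M/𝔪^j M` of a module. -/
noncomputable def hilbSam (R : Type) [CommRing R] [Algebra k R] (𝔪 : Ideal R) (M : Type)
    [AddCommGroup M] [Module R M] (j : ℕ) : ℕ :=
  letI : Module k (M ⧸ ((𝔪 ^ j) • (⊤ : Submodule R M))) :=
    Module.compHom (M ⧸ ((𝔪 ^ j) • (⊤ : Submodule R M))) (algebraMap k R)
  Module.finrank k (M ⧸ ((𝔪 ^ j) • (⊤ : Submodule R M)))

/-- `M` is an Ulrich module with respect to `𝔪`: its minimal number of generators `μ(M)`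
equals its multiplicity `e(𝔪; M) = lim_j t!·dim_k(M/𝔪^j M)/j^t`, where `t = dim M`. -/
def IsUlrich (R : Type) [CommRing R] [Algebra k R] (𝔪 : Ideal R) (M : Type) [AddCommGroup M]
    [Module R M] : Prop :=
  ∃ t : ℕ, ringKrullDim (R ⧸ Module.annihilator R M) = (t : WithBot (WithTop ℕ)) ∧
    Filter.Tendsto
      (fun j : ℕ => ((t.factorial : ℝ) * (hilbSam k R 𝔪 M j : ℝ)) / (j : ℝ) ^ t)
      Filter.atTop (nhds ((muGen k R 𝔪 M : ℝ)))

end Graded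

section SR

variable (k : Type) [Field k] {n : ℕ}

/-- The Stanley--Reisner ideal of `Δ`: generated by the squarefree monomials supported on
non-faces of `Δ`. -/
noncomputable def srIdeal (Δ : SC n) : Ideal (MvPolynomial (Fin n) k) :=
  Ideal.span {m | ∃ σ : Finset (Fin n), σ ∉ Δ.faces ∧ m = ∏ i ∈ σ, MvPolynomial.X i}

/-- The Stanley--Reisner ring `k[Δ]`. -/
abbrev SRRing (Δ : SC n) : Type := MvPolynomial (Fin n) k ⧸ srIdeal k Δ

/-- The graded maximal ideal of `k[Δ]`. -/
noncomputable abbrev srMax (Δ : SC n) : Ideal (SRRing k Δ) := quotMax k (srIdeal k Δ)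

/-- The value at `j` of the Hilbert function of the (canonically graded) canonical module of
`k[Δ]`, as computed by Gräbe's theorem:
`dim_k [ω]_j = Σ_{a ∈ ℕ^n, |a| = j} dim_k H_{dim Δ}(Δ, cost_Δ(supp a); k)`. -/
noncomputable def canonicalHilbert (Δ : SC n) (j : ℕ) : ℕ :=
  ∑ a ∈ (Fintype.piFinset fun _ : Fin n => Finset.range (j + 1)).filter
      (fun a => ∑ i, a i = j),
    Module.finrank k
      (Δ.relHomology k (Finset.univ.filter fun i => a i ≠ 0) (Δ.faces.sup Finset.card - 1))

/-- A `ℤ`-grading `gr` on a module `ω` over `k[Δ]` is the canonical grading of the canonical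
module if it is a compatible grading, is supported in nonnegative degrees, and its Hilbert
function is the one given by Gräbe's theorem. -/
def IsCanonicallyGraded (Δ : SC n) (ω : Type) [AddCommGroup ω] [Module (SRRing k Δ) ω]
    [Module k ω] (gr : ℤ → Submodule k ω) : Prop :=
  IsCompatibleGrading k (srIdeal k Δ) ω gr ∧ (∀ j : ℤ, j < 0 → gr j = ⊥) ∧
    ∀ j : ℕ, Module.finrank k (gr (j : ℤ)) = canonicalHilbert k Δ j

/-- A `ℤ^n`-grading `grN` on a module `ω` over `k[Δ]` (supported in `ℕ^n`) is the canonical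
multigrading of the canonical module if it is an internal direct sum, is compatible with the
`ℤ^n`-grading of `k[Δ]`, and its multigraded Hilbert function is the one given by Gräbe's
theorem: `dim_k [ω]_a = dim_k H_{dim Δ}(Δ, cost_Δ(supp a); k)`. -/
def IsCanonicallyMultiGraded (Δ : SC n) (ω : Type) [AddCommGroup ω] [Module (SRRing k Δ) ω]
    [Module k ω] (grN : (Fin n → ℕ) → Submodule k ω) : Prop :=
  DirectSum.IsInternal grN ∧
    (∀ (a b : Fin n → ℕ) (r : SRRing k Δ) (m : ω),
      r ∈ quotMonomialGrade k (srIdeal k Δ) a → m ∈ grN b → r • m ∈ grN (a + b)) ∧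
    ∀ a : Fin n → ℕ, Module.finrank k (grN a) =
      Module.finrank k
        (Δ.relHomology k (Finset.univ.filter fun i => a i ≠ 0) (Δ.faces.sup Finset.card - 1))

end SR

/-- The chain map `C_•(Δ, cost_Δ τ) → C_•(Δ, cost_Δ σ)` (for `τ ⊆ σ`) induced by the
inclusion `cost_Δ τ ⊆ cost_Δ σ`: basis faces not containing `σ` are sent to `0`. -/
def SC.relChainMap {n : ℕ} (Δ : SC n) (R : Type) [CommRing R] (τ σ : Finset (Fin n)) (c : ℕ) :
    Δ.relChain R τ c →ₗ[R] Δ.relChain R σ c :=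
  Matrix.mulVecLin (fun (β : Δ.RFace σ c) (α : Δ.RFace τ c) => if α.1 = β.1 then (1 : R) else 0)

set_option synthInstance.maxHeartbeats 1000000 in
/-- `R = k[x_1,…,x_n]/I` is almost Gorenstein with respect to a canonical module `ω` with
(canonical) grading `gr`: writing `a = a_R` for the `a`-invariant (so `-a` is the least degree
of `ω`), there is an injective degree-zero `R`-linear map `φ : R → ω(-a)` whose cokernel is
zero or an Ulrich module. -/
def IsAlmostGorenstein (k : Type) [Field k] {n : ℕ} (I : Ideal (MvPolynomial (Fin n) k))
    (ω : Type) [AddCommGroup ω] [Module (MvPolynomial (Fin n) k ⧸ I) ω] [Module k ω]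
    (gr : ℤ → Submodule k ω) : Prop :=
  ∃ a : ℤ, (gr (-a) ≠ ⊥ ∧ ∀ j : ℤ, j < -a → gr j = ⊥) ∧
    ∃ φ : (MvPolynomial (Fin n) k ⧸ I) →ₗ[MvPolynomial (Fin n) k ⧸ I] ω,
      Function.Injective φ ∧
      (∀ (i : ℕ) (r : MvPolynomial (Fin n) k ⧸ I),
        r ∈ quotGrade k I i → φ r ∈ gr ((i : ℤ) - a)) ∧
      (Subsingleton (ω ⧸ LinearMap.range φ) ∨
        IsUlrich k (MvPolynomial (Fin n) k ⧸ I) (quotMax k I) (ω ⧸ LinearMap.range φ))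

open CategoryTheory

section ExtCompare

universe u

variable {S : Type} [CommRing S]

/-- Vanishing or not, the class map from cocycles of a projective resolution to `Abelian.Ext`. -/
theorem extMk_smul_aux {X Y : ModuleCat.{0} S} (P : ProjectiveResolution X) {i : ℕ}
    (f : P.complex.X i ⟶ Y) (hf : P.complex.d (i + 1) i ≫ f = 0) (s : S) :
    P.extMk (s • f) (i + 1) rfl (by rw [Linear.comp_smul, hf, smul_zero]) =
      s • P.extMk f (i + 1) rfl hf := by
  rw [Abelian.Ext.smul_eq_comp_mk₀, P.extMk_comp_mk₀]
  congr 1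

/-- Cocycles as a submodule. -/
noncomputable def cocyc {X Y : ModuleCat.{0} S} (P : ProjectiveResolution X) (i : ℕ) :
    Submodule S (P.complex.X i ⟶ Y) :=
  LinearMap.ker (Linear.leftComp S Y (P.complex.d (i + 1) i))

noncomputable def clsMap {X Y : ModuleCat.{0} S} (P : ProjectiveResolution X) (i : ℕ) :
    (cocyc (Y := Y) P i) →ₗ[S] Abelian.Ext X Y i where
  toFun f := P.extMk f.1 (i + 1) rfl f.2
  map_add' f g := (P.add_extMk f.1 g.1 (i + 1) rfl f.2 g.2).symm
  map_smul' s f := extMk_smul_aux P f.1 f.2 s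

theorem clsMap_surj {X Y : ModuleCat.{0} S} (P : ProjectiveResolution X) (i : ℕ) :
    Function.Surjective (clsMap (Y := Y) P i) := by
  intro x
  obtain ⟨f, hf, h⟩ := P.extMk_surjective x (i + 1) rfl
  exact ⟨⟨f, hf⟩, h⟩

/-- The class map from cocycles to cohomology, for a cochain complex of modules. -/
noncomputable def cohCls (K : CochainComplex (ModuleCat.{0} S) ℕ) (i : ℕ) :
    LinearMap.ker (K.d i (i + 1)).hom →ₗ[S] K.homology i :=
  (K.homologyπ i).hom ∘ₗ (K.liftCycles
    (ModuleCat.ofHom (LinearMap.ker (K.d i (i + 1)).hom).subtype) (i + 1) (by simp)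
    (by ext x; exact x.2)).hom

theorem iCycles_lift_aux (K : CochainComplex (ModuleCat.{0} S) ℕ) (i : ℕ)
    (x : LinearMap.ker (K.d i (i + 1)).hom) :
    (K.iCycles i).hom ((K.liftCycles
      (ModuleCat.ofHom (LinearMap.ker (K.d i (i + 1)).hom).subtype) (i + 1) (by simp)
      (by ext x; exact x.2)).hom x) = x.1 := by
  have := K.liftCycles_i (ModuleCat.ofHom (LinearMap.ker (K.d i (i + 1)).hom).subtype) (i + 1)
    (by simp) (by ext x; exact x.2)
  exact congrArg (fun g => g.hom x) this

theorem cohCls_surj (K : CochainComplex (ModuleCat.{0} S) ℕ) (i : ℕ) :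
    Function.Surjective (cohCls K i) := by
  intro x
  have h1 : Function.Surjective (K.homologyπ i).hom :=
    (ModuleCat.epi_iff_surjective _).1 inferInstance
  obtain ⟨z, rfl⟩ := h1 x
  have hz : K.iCycles i ≫ K.d i (i+1) = 0 := HomologicalComplex.iCycles_d _ _ _
  have hz' := congrArg (fun g => g.hom z) hz
  refine ⟨⟨(K.iCycles i).hom z, hz'⟩, ?_⟩
  change (K.homologyπ i).hom _ = _
  congr 1
  apply (ModuleCat.mono_iff_injective (K.iCycles i)).1 inferInstance
  exact iCycles_lift_aux K i _

theorem cohCls_eq_zero (K : CochainComplex (ModuleCat.{0} S) ℕ) (i : ℕ)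
    (x : LinearMap.ker (K.d (i + 1) (i + 1 + 1)).hom) :
    cohCls K (i + 1) x = 0 ↔ ∃ g, (K.d i (i + 1)).hom g = x.1 := by
  have hex : (ShortComplex.mk (K.toCycles i (i+1)) (K.homologyπ (i+1)) (by simp)).Exact :=
    ShortComplex.exact_of_g_is_cokernel _ (K.homologyIsCokernel i (i+1) (by simp))
  rw [ShortComplex.moduleCat_exact_iff] at hex
  have hL := iCycles_lift_aux K (i + 1) x
  have htc : ∀ g : K.X i, (K.iCycles (i+1)).hom ((K.toCycles i (i+1)).hom g) =
      (K.d i (i+1)).hom g := by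
    intro g
    exact congrArg (fun h => h.hom g) (K.toCycles_i i (i+1))
  have hinj : Function.Injective (K.iCycles (i+1)).hom :=
    (ModuleCat.mono_iff_injective (K.iCycles (i+1))).1 inferInstance
  constructor
  · intro h
    obtain ⟨g, hg⟩ := hex _ h
    refine ⟨g, ?_⟩
    rw [← hL, ← htc]
    exact congrArg _ hg
  · rintro ⟨g, hg⟩
    have : (K.liftCycles
      (ModuleCat.ofHom (LinearMap.ker (K.d (i+1) (i + 1+1)).hom).subtype) (i + 1+1) (by simp)
      (by ext x; exact x.2)).hom x = (K.toCycles i (i+1)).hom g := by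
      apply hinj
      rw [hL, htc, hg]
    change (K.homologyπ (i+1)).hom _ = 0
    rw [this]
    exact congrArg (fun h => h.hom g)
      (show K.toCycles i (i+1) ≫ K.homologyπ (i+1) = 0 by simp)

noncomputable def clsOld {X Y : ModuleCat.{0} S} (P : ProjectiveResolution X) (i : ℕ) :
    (cocyc (Y := Y) P i) →ₗ[S] ((P.complex.linearYonedaObj S Y).homology i) :=
  cohCls (P.complex.linearYonedaObj S Y) i

theorem clsOld_surj {X Y : ModuleCat.{0} S} (P : ProjectiveResolution X) (i : ℕ) :
    Function.Surjective (clsOld (Y := Y) P i) :=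
  cohCls_surj (P.complex.linearYonedaObj S Y) i

theorem clsMap_ker {X Y : ModuleCat.{0} S} (P : ProjectiveResolution X) (i : ℕ) :
    LinearMap.ker (clsMap (Y := Y) P (i + 1)) = LinearMap.ker (clsOld (Y := Y) P (i + 1)) := by
  ext f
  exact (P.extMk_eq_zero_iff f.1 (i + 1 + 1) rfl f.2 i rfl).trans
    (cohCls_eq_zero (P.complex.linearYonedaObj S Y) i f).symm

theorem extMod_equiv (M N : Type) [AddCommGroup M] [Module S M]
    [AddCommGroup N] [Module S N] (i : ℕ) :
    Nonempty (extMod S M N (i + 1) ≃ₗ[S] Abelian.Ext (ModuleCat.of S M) (ModuleCat.of S N) (i + 1)) := by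
  let P := projectiveResolution (ModuleCat.of S M)
  have e1 := (P.isoExt (R := S) (i + 1) (ModuleCat.of S N)).toLinearEquiv
  have e2 := LinearMap.quotKerEquivOfSurjective _ (clsOld_surj (Y := ModuleCat.of S N) P (i + 1))
  have e3 := LinearMap.quotKerEquivOfSurjective _ (clsMap_surj (Y := ModuleCat.of S N) P (i + 1))
  have e4 := Submodule.quotEquivOfEq _ _ (clsMap_ker (Y := ModuleCat.of S N) P i)
  exact ⟨e1 ≪≫ₗ e2.symm ≪≫ₗ e4.symm ≪≫ₗ e3⟩

end ExtCompare

open CategoryTheory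

set_option linter.unusedVariables false

section XEsec

variable (S : Type) [CommRing S]

/-- `Ext^i_S(M, S)`. -/
noncomputable def XE (M : Type) [AddCommGroup M] [Module S M] (i : ℕ) : Type :=
  Abelian.Ext (ModuleCat.of S M) (ModuleCat.of S S) i

noncomputable instance (M : Type) [AddCommGroup M] [Module S M] (i : ℕ) :
    AddCommGroup (XE S M i) :=
  inferInstanceAs (AddCommGroup (Abelian.Ext (ModuleCat.of S M) (ModuleCat.of S S) i))

noncomputable instance (M : Type) [AddCommGroup M] [Module S M] (i : ℕ) :
    Module S (XE S M i) :=
  inferInstanceAs (Module S (Abelian.Ext (ModuleCat.of S M) (ModuleCat.of S S) i))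

variable {S}
variable {A B C A' B' C' : Type} [AddCommGroup A] [Module S A] [AddCommGroup B] [Module S B]
  [AddCommGroup C] [Module S C] [AddCommGroup A'] [Module S A'] [AddCommGroup B'] [Module S B']
  [AddCommGroup C'] [Module S C']

noncomputable def XE.pull (f : A →ₗ[S] B) (i : ℕ) : XE S B i →ₗ[S] XE S A i where
  toFun x := (Abelian.Ext.mk₀ (ModuleCat.ofHom f)).comp (show Abelian.Ext _ _ i from x) (zero_add i)
  map_add' x y := Abelian.Ext.comp_add _ _ _ _
  map_smul' s x := Abelian.Ext.comp_smul _ _ _ _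

theorem XE.pull_comp (f : A →ₗ[S] B) (g : B →ₗ[S] C) (i : ℕ) (x : XE S C i) :
    XE.pull (g ∘ₗ f) i x = XE.pull f i (XE.pull g i x) := by
  exact (Abelian.Ext.mk₀_comp_mk₀_assoc (ModuleCat.ofHom f) (ModuleCat.ofHom g)
    (show Abelian.Ext _ _ i from x)).symm

theorem XE.pull_id (i : ℕ) (x : XE S A i) : XE.pull (LinearMap.id : A →ₗ[S] A) i x = x :=
  Abelian.Ext.mk₀_id_comp (show Abelian.Ext _ _ i from x)

theorem XE.pull_add (f g : A →ₗ[S] B) (i : ℕ) (x : XE S B i) :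
    XE.pull (f + g) i x = XE.pull f i x + XE.pull g i x := by
  refine Eq.trans ?_ (Abelian.Ext.add_comp (Abelian.Ext.mk₀ (ModuleCat.ofHom f))
    (Abelian.Ext.mk₀ (ModuleCat.ofHom g)) (show Abelian.Ext _ _ i from x) (zero_add i))
  rw [← Abelian.Ext.mk₀_add]
  rfl

theorem XE.pull_smul (s : S) (f : A →ₗ[S] B) (i : ℕ) (x : XE S B i) :
    XE.pull (s • f) i x = s • XE.pull f i x := by
  refine Eq.trans ?_ (Abelian.Ext.smul_comp (Abelian.Ext.mk₀ (ModuleCat.ofHom f))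
    (show Abelian.Ext _ _ i from x) (zero_add i) s)
  rw [← Abelian.Ext.mk₀_smul]
  rfl

theorem XE.pull_zero (i : ℕ) (x : XE S B i) : XE.pull (0 : A →ₗ[S] B) i x = 0 := by
  have := XE.pull_smul (0 : S) (0 : A →ₗ[S] B) i x
  rwa [zero_smul, zero_smul] at this

noncomputable def XE.pullHom (i : ℕ) (x : XE S B i) : (A →ₗ[S] B) →+ XE S A i where
  toFun f := XE.pull f i x
  map_zero' := XE.pull_zero i x
  map_add' f g := XE.pull_add f g i x

theorem XE.pull_sum {ι : Type} (s : Finset ι) (f : ι → (A →ₗ[S] B)) (i : ℕ) (x : XE S B i) :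
    XE.pull (∑ j ∈ s, f j) i x = ∑ j ∈ s, XE.pull (f j) i x :=
  map_sum (XE.pullHom i x) f s

/-- Short exact sequences of modules. -/
structure IsSES (f : A →ₗ[S] B) (g : B →ₗ[S] C) : Prop where
  inj : Function.Injective f
  surj : Function.Surjective g
  exact : Function.Exact f g

noncomputable abbrev sesCplx (f : A →ₗ[S] B) (g : B →ₗ[S] C) (h : g ∘ₗ f = 0) :
    ShortComplex (ModuleCat S) :=
  ShortComplex.mk (ModuleCat.ofHom f) (ModuleCat.ofHom g) (by ext x; exact LinearMap.congr_fun h x)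

theorem IsSES.zero {f : A →ₗ[S] B} {g : B →ₗ[S] C} (h : IsSES f g) : g ∘ₗ f = 0 :=
  LinearMap.ext fun x => h.exact.apply_apply_eq_zero x

theorem IsSES.shortExact {f : A →ₗ[S] B} {g : B →ₗ[S] C} (h : IsSES f g) :
    (sesCplx f g h.zero).ShortExact where
  exact := by
    rw [ShortComplex.moduleCat_exact_iff]
    intro x hx
    exact (h.exact x).1 hx
  mono_f := (ModuleCat.mono_iff_injective _).2 h.inj
  epi_g := (ModuleCat.epi_iff_surjective _).2 h.surj

noncomputable def XE.conn {f : A →ₗ[S] B} {g : B →ₗ[S] C} (h : IsSES f g) (i : ℕ) :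
    XE S A i →ₗ[S] XE S C (i + 1) where
  toFun x := h.shortExact.extClass.comp (show Abelian.Ext _ _ i from x) (add_comm 1 i)
  map_add' x y := Abelian.Ext.comp_add _ _ _ _
  map_smul' s x := Abelian.Ext.comp_smul _ _ _ _

theorem XE.exact1 {f : A →ₗ[S] B} {g : B →ₗ[S] C} (h : IsSES f g) (i : ℕ) (x : XE S A i)
    (hx : XE.conn h i x = 0) : ∃ y : XE S B i, XE.pull f i y = x :=
  Abelian.Ext.contravariant_sequence_exact₁ h.shortExact _ (show Abelian.Ext _ _ i from x) (add_comm 1 i) hx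

theorem XE.exact2 {f : A →ₗ[S] B} {g : B →ₗ[S] C} (h : IsSES f g) (i : ℕ) (x : XE S B i)
    (hx : XE.pull f i x = 0) : ∃ y : XE S C i, XE.pull g i y = x :=
  Abelian.Ext.contravariant_sequence_exact₂ h.shortExact _ (show Abelian.Ext _ _ i from x) hx

theorem XE.exact3 {f : A →ₗ[S] B} {g : B →ₗ[S] C} (h : IsSES f g) (i : ℕ) (x : XE S C (i + 1))
    (hx : XE.pull g (i + 1) x = 0) : ∃ y : XE S A i, XE.conn h i y = x :=
  Abelian.Ext.contravariant_sequence_exact₃ h.shortExact _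
    (show Abelian.Ext _ _ (i + 1) from x) hx (add_comm 1 i)

theorem XE.conn_pull {f : A →ₗ[S] B} {g : B →ₗ[S] C} (h : IsSES f g) (i : ℕ) (x : XE S B i) :
    XE.conn h i (XE.pull f i x) = 0 :=
  h.shortExact.extClass_comp_assoc (show Abelian.Ext _ _ i from x) (h := add_comm 1 i)

theorem XE.pull_conn {f : A →ₗ[S] B} {g : B →ₗ[S] C} (h : IsSES f g) (i : ℕ) (x : XE S A i) :
    XE.pull g (i + 1) (XE.conn h i x) = 0 :=
  h.shortExact.comp_extClass_assoc (show Abelian.Ext _ _ i from x) (add_comm 1 i)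

theorem XE.conn_nat {f : A →ₗ[S] B} {g : B →ₗ[S] C} {f' : A' →ₗ[S] B'} {g' : B' →ₗ[S] C'}
    (h : IsSES f g) (h' : IsSES f' g') (a : A →ₗ[S] A') (b : B →ₗ[S] B') (c : C →ₗ[S] C')
    (hab : b ∘ₗ f = f' ∘ₗ a) (hbc : c ∘ₗ g = g' ∘ₗ b) (i : ℕ) (x : XE S A' i) :
    XE.conn h i (XE.pull a i x) = XE.pull c (i + 1) (XE.conn h' i x) := by
  let φ : sesCplx f g h.zero ⟶ sesCplx f' g' h'.zero :=
    { τ₁ := ModuleCat.ofHom a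
      τ₂ := ModuleCat.ofHom b
      τ₃ := ModuleCat.ofHom c
      comm₁₂ := by ext x; exact (LinearMap.congr_fun hab x).symm
      comm₂₃ := by ext x; exact (LinearMap.congr_fun hbc x).symm }
  have key := ShortComplex.ShortExact.extClass_naturality h.shortExact h'.shortExact φ
  have h1 := Abelian.Ext.comp_assoc h.shortExact.extClass (Abelian.Ext.mk₀ φ.τ₁)
    (show Abelian.Ext (ModuleCat.of S A') (ModuleCat.of S S) i from x) (add_zero 1) (zero_add i)
    (a := i + 1) (by omega)
  have h2 := Abelian.Ext.comp_assoc (Abelian.Ext.mk₀ φ.τ₃) h'.shortExact.extClass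
    (show Abelian.Ext (ModuleCat.of S A') (ModuleCat.of S S) i from x) (zero_add 1)
    (add_comm 1 i) (a := i + 1) (by omega)
  rw [key] at h1
  exact h1.symm.trans h2

theorem XE.pull_inj_zero {g : B →ₗ[S] C} (hg : Function.Surjective g) (x : XE S C 0)
    (hx : XE.pull g 0 x = 0) : x = 0 := by
  have : Epi (ModuleCat.ofHom g) := (ModuleCat.epi_iff_surjective _).2 hg
  exact Abelian.Ext.precomp_mk₀_injective_of_epi (ModuleCat.of S S) (ModuleCat.ofHom g)
    (hx.trans (XE.pull g 0).map_zero.symm)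

theorem XE.eq_zero_of_free [Module.Projective S A] (i : ℕ) (x : XE S A (i + 1)) : x = 0 := by
  have : Projective (ModuleCat.of S A) := inferInstance
  exact Abelian.Ext.eq_zero_of_projective (show Abelian.Ext _ _ (i + 1) from x)

theorem XE.eq_zero_of_subsingleton [Subsingleton A] (i : ℕ) (x : XE S A i) : x = 0 := by
  rw [← XE.pull_id i x, show (LinearMap.id : A →ₗ[S] A) = 0 from Subsingleton.elim _ _,
    XE.pull_zero]

/-- degree zero -/
noncomputable def XE.zeroEquiv (A : Type) [AddCommGroup A] [Module S A] :
    XE S A 0 ≃ₗ[S] (A →ₗ[S] S) :=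
  (Abelian.Ext.linearEquiv₀ (R := S) (X := ModuleCat.of S A) (Y := ModuleCat.of S S)).trans
    ModuleCat.homLinearEquiv

end XEsec

open CategoryTheory

set_option linter.unusedVariables false

section MonIdeals

variable (k : Type) [Field k] {n : ℕ}

/-- The monomial ideal attached to a lower set of supports. -/
def monJ (L : LowerSet (Finset (Fin n))) : Ideal (MvPolynomial (Fin n) k) where
  carrier := {f | ∀ a : Fin n →₀ ℕ, a.support ∈ L → f.coeff a = 0}
  zero_mem' := by intro a _; simp
  add_mem' := by
    intro f g hf hg a ha
    rw [MvPolynomial.coeff_add, hf a ha, hg a ha, add_zero]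
  smul_mem' := by
    classical
    intro s f hf a ha
    rw [smul_eq_mul, MvPolynomial.coeff_mul]
    apply Finset.sum_eq_zero
    intro p hp
    rw [Finset.HasAntidiagonal.mem_antidiagonal] at hp
    rw [hf p.2, mul_zero]
    apply L.lower _ ha
    rw [← hp]
    intro i hi
    simp only [Finsupp.mem_support_iff, Finsupp.coe_add, Pi.add_apply] at hi ⊢
    omega

theorem mem_monJ (L : LowerSet (Finset (Fin n))) (f : MvPolynomial (Fin n) k) :
    f ∈ monJ k L ↔ ∀ a : Fin n →₀ ℕ, a.support ∈ L → f.coeff a = 0 := Iff.rfl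

/-- The quotient by the monomial ideal. -/
abbrev MQ (L : LowerSet (Finset (Fin n))) : Type := MvPolynomial (Fin n) k ⧸ monJ k L

/-- exponent of the squarefree monomial. -/
noncomputable def chi (F : Finset (Fin n)) : Fin n →₀ ℕ := ∑ i ∈ F, Finsupp.single i 1

theorem chi_apply (F : Finset (Fin n)) (i : Fin n) : chi F i = if i ∈ F then 1 else 0 := by
  classical
  simp [chi, Finsupp.finsetSum_apply, Finsupp.single_apply]

theorem chi_le (F : Finset (Fin n)) (a : Fin n →₀ ℕ) : chi F ≤ a ↔ F ⊆ a.support := by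
  constructor
  · intro h i hi
    have := h i
    rw [chi_apply, if_pos hi] at this
    simp; omega
  · intro h i
    rw [chi_apply]
    split_ifs with hi
    · have := h hi
      simp at this; omega
    · omega

theorem chi_insert (F : Finset (Fin n)) (v : Fin n) (hv : v ∉ F) :
    chi (insert v F) = chi F + Finsupp.single v 1 := by
  rw [chi, Finset.sum_insert hv, add_comm]; rfl

theorem single_le (v : Fin n) (a : Fin n →₀ ℕ) : Finsupp.single v 1 ≤ a ↔ v ∈ a.support := by
  rw [Finsupp.single_le_iff]; simp; omega

theorem mulQ_ok {b : Fin n →₀ ℕ} {L L' : LowerSet (Finset (Fin n))}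
    (h : ∀ a : Fin n →₀ ℕ, a.support ∈ L' → b ≤ a → (a - b).support ∈ L) :
    monJ k L ≤ Submodule.comap
      (LinearMap.mulLeft (MvPolynomial (Fin n) k) (MvPolynomial.monomial b (1 : k))) (monJ k L') := by
  intro f hf
  rw [Submodule.mem_comap, LinearMap.mulLeft_apply, mem_monJ]
  intro a ha
  rw [MvPolynomial.coeff_monomial_mul']
  split_ifs with hb
  · rw [hf _ (h a ha hb), mul_zero]
  · rfl

/-- Multiplication by a monomial between monomial quotients. -/
noncomputable def mulQ (b : Fin n →₀ ℕ) (L L' : LowerSet (Finset (Fin n)))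
    (h : ∀ a : Fin n →₀ ℕ, a.support ∈ L' → b ≤ a → (a - b).support ∈ L) :
    MQ k L →ₗ[MvPolynomial (Fin n) k] MQ k L' :=
  Submodule.mapQ (monJ k L) (monJ k L')
    (LinearMap.mulLeft (MvPolynomial (Fin n) k) (MvPolynomial.monomial b (1 : k)))
    (mulQ_ok k h)

theorem mulQ_mk (b : Fin n →₀ ℕ) (L L' : LowerSet (Finset (Fin n))) (h)
    (f : MvPolynomial (Fin n) k) :
    mulQ k b L L' h (Submodule.Quotient.mk f) =
      Submodule.Quotient.mk (MvPolynomial.monomial b (1 : k) * f) := rfl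

theorem sub_ok {b : Fin n →₀ ℕ} {L L' : LowerSet (Finset (Fin n))} (hL : L' ≤ L) :
    ∀ a : Fin n →₀ ℕ, a.support ∈ L' → b ≤ a → (a - b).support ∈ L := by
  intro a ha _
  apply hL
  apply L'.lower _ ha
  intro i hi
  simp at hi ⊢
  omega

/-- The projection. -/
noncomputable def projQ (L L' : LowerSet (Finset (Fin n))) (h : L' ≤ L) :
    MQ k L →ₗ[MvPolynomial (Fin n) k] MQ k L' := mulQ k 0 L L' (sub_ok h)

theorem projQ_mk (L L' : LowerSet (Finset (Fin n))) (h) (f : MvPolynomial (Fin n) k) :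
    projQ k L L' h (Submodule.Quotient.mk f) = Submodule.Quotient.mk f := by
  rw [projQ, mulQ_mk]
  congr 1
  rw [show MvPolynomial.monomial 0 (1 : k) = 1 from rfl, one_mul]

theorem mulQ_comp (b c d : Fin n →₀ ℕ) (L L' L'' : LowerSet (Finset (Fin n))) (h h' h'')
    (hd : d = b + c) :
    (mulQ k c L' L'' h') ∘ₗ (mulQ k b L L' h) = mulQ k d L L'' h'' := by
  subst hd
  apply LinearMap.ext
  intro x
  obtain ⟨f, rfl⟩ := Submodule.Quotient.mk_surjective _ x
  rw [LinearMap.comp_apply, mulQ_mk, mulQ_mk, mulQ_mk, ← mul_assoc, MvPolynomial.monomial_mul,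
    one_mul, add_comm c b]

theorem mulQ_zero_of (b : Fin n →₀ ℕ) (L L' : LowerSet (Finset (Fin n))) (h)
    (hb : ∀ a : Fin n →₀ ℕ, b ≤ a → a.support ∉ L') : mulQ k b L L' h = 0 := by
  apply LinearMap.ext
  intro x
  obtain ⟨f, rfl⟩ := Submodule.Quotient.mk_surjective _ x
  rw [mulQ_mk, LinearMap.zero_apply, Submodule.Quotient.mk_eq_zero]
  intro a ha
  rw [MvPolynomial.coeff_monomial_mul', if_neg]
  intro hba
  exact hb a hba ha

theorem sesMon (b : Fin n →₀ ℕ) (L L' : LowerSet (Finset (Fin n))) (hL : L' ≤ L)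
    (h2 : ∀ a : Fin n →₀ ℕ, a.support ∈ L → (b + a).support ∈ L)
    (h3 : ∀ a : Fin n →₀ ℕ, a.support ∈ L' ↔ a.support ∈ L ∧ ¬ b ≤ a) :
    IsSES (mulQ k b L L (sub_ok le_rfl)) (projQ k L L' hL) where
  inj := by
    rw [injective_iff_map_eq_zero]
    intro x hx
    obtain ⟨f, rfl⟩ := Submodule.Quotient.mk_surjective _ x
    rw [mulQ_mk, Submodule.Quotient.mk_eq_zero] at hx
    rw [Submodule.Quotient.mk_eq_zero]
    intro a ha
    have := hx (b + a) (h2 a ha)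
    rwa [MvPolynomial.coeff_monomial_mul, one_mul] at this
  surj := by
    intro x
    obtain ⟨f, rfl⟩ := Submodule.Quotient.mk_surjective _ x
    exact ⟨Submodule.Quotient.mk f, projQ_mk _ _ _ _ _⟩
  exact := by
    intro x
    obtain ⟨f, rfl⟩ := Submodule.Quotient.mk_surjective _ x
    rw [projQ_mk, Submodule.Quotient.mk_eq_zero]
    constructor
    · intro hf
      refine ⟨Submodule.Quotient.mk (f.divMonomial b), ?_⟩
      rw [mulQ_mk, Submodule.Quotient.eq]
      intro a ha
      rw [MvPolynomial.coeff_sub, MvPolynomial.coeff_monomial_mul']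
      split_ifs with hb
      · rw [MvPolynomial.coeff_divMonomial, one_mul, add_tsub_cancel_of_le hb, sub_self]
      · rw [hf a ((h3 a).2 ⟨ha, hb⟩), sub_zero]
    · rintro ⟨y, hy⟩
      obtain ⟨g, rfl⟩ := Submodule.Quotient.mk_surjective _ y
      rw [mulQ_mk, Submodule.Quotient.eq] at hy
      intro a ha
      obtain ⟨h4, h5⟩ := (h3 a).1 ha
      have := hy a h4
      rw [MvPolynomial.coeff_sub, MvPolynomial.coeff_monomial_mul', if_neg h5, zero_sub,
        neg_eq_zero] at this
      exact this

/-- The sequence `0 → Q(F) → Q(F) → Q(G) → 0` with `F = G + v`. -/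
theorem sesV (G F : Finset (Fin n)) (v : Fin n) (hv : v ∉ G) (hF : F = insert v G) :
    IsSES (mulQ k (Finsupp.single v 1) (LowerSet.Iic F) (LowerSet.Iic F) (sub_ok le_rfl))
      (projQ k (LowerSet.Iic F) (LowerSet.Iic G)
        (LowerSet.Iic_le.2 (by subst hF; exact Finset.subset_insert _ _))) := by
  apply sesMon
  · intro a ha
    rw [LowerSet.mem_Iic_iff] at ha ⊢
    refine Finsupp.support_add.trans (Finset.union_subset ?_ ha)
    refine Finsupp.support_single_subset.trans ?_
    rw [hF]; simp
  · intro a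
    rw [LowerSet.mem_Iic_iff, LowerSet.mem_Iic_iff, single_le, hF]
    constructor
    · intro h
      exact ⟨h.trans (Finset.subset_insert _ _), fun h' => hv (h h')⟩
    · rintro ⟨h, h'⟩ i hi
      rcases Finset.mem_insert.1 (h hi) with rfl | h3
      · exact absurd hi h'
      · exact h3

/-- The sequence `0 → Q(F) → Q(F) → Q(∂F) → 0`. -/
theorem sesT (F : Finset (Fin n)) :
    IsSES (mulQ k (chi F) (LowerSet.Iic F) (LowerSet.Iic F) (sub_ok le_rfl))
      (projQ k (LowerSet.Iic F) (LowerSet.Iio F) (fun G h => show G ≤ F from le_of_lt (show G < F from h))) := by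
  apply sesMon
  · intro a ha
    rw [LowerSet.mem_Iic_iff] at ha ⊢
    refine Finsupp.support_add.trans (Finset.union_subset ?_ ha)
    intro i hi
    rw [Finsupp.mem_support_iff, chi_apply] at hi
    by_contra h
    simp [h] at hi
  · intro a
    rw [LowerSet.mem_Iic_iff, LowerSet.mem_Iio_iff, chi_le]
    exact Iff.rfl

/-- skeleton -/
def skel (L : LowerSet (Finset (Fin n))) (m : ℕ) : LowerSet (Finset (Fin n)) where
  carrier := {F | F ∈ L ∧ F.card < m}
  lower' := fun F G h hF => ⟨L.lower h hF.1, (Finset.card_le_card h).trans_lt hF.2⟩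

theorem mem_skel (L : LowerSet (Finset (Fin n))) (m : ℕ) (F : Finset (Fin n)) :
    F ∈ skel L m ↔ F ∈ L ∧ F.card < m := Iff.rfl

/-- Faces of given cardinality. -/
abbrev Fc (L : LowerSet (Finset (Fin n))) (m : ℕ) : Type :=
  {F : Finset (Fin n) // F ∈ L ∧ F.card = m}

noncomputable instance (L : LowerSet (Finset (Fin n))) (m : ℕ) : Fintype (Fc L m) :=
  haveI : Finite (Fc L m) := inferInstanceAs (Finite {F : Finset (Fin n) // F ∈ L ∧ F.card = m})
  Fintype.ofFinite _

abbrev PQ (L : LowerSet (Finset (Fin n))) (m : ℕ) : Type :=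
  ∀ F : Fc L m, MQ k (LowerSet.Iic F.1)

theorem inc_ok (L : LowerSet (Finset (Fin n))) (m : ℕ) (F : Finset (Fin n)) (hF : F.card = m) :
    ∀ a : Fin n →₀ ℕ, a.support ∈ skel L (m + 1) → chi F ≤ a →
      (a - chi F).support ∈ LowerSet.Iic F := by
  intro a ha hb
  rw [chi_le] at hb
  have := Finset.eq_of_subset_of_card_le hb (by have := ha.2; omega)
  rw [LowerSet.mem_Iic_iff]
  intro i hi
  rw [this]
  simp at hi ⊢
  omega

noncomputable def inc (L : LowerSet (Finset (Fin n))) (m : ℕ) (F : Fc L m) :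
    MQ k (LowerSet.Iic F.1) →ₗ[MvPolynomial (Fin n) k] MQ k (skel L (m + 1)) :=
  mulQ k (chi F.1) _ _ (inc_ok L m F.1 F.2.2)

noncomputable def skMap (L : LowerSet (Finset (Fin n))) (m : ℕ) :
    PQ k L m →ₗ[MvPolynomial (Fin n) k] MQ k (skel L (m + 1)) :=
  ∑ F : Fc L m, inc k L m F ∘ₗ LinearMap.proj F

theorem skel_le (L : LowerSet (Finset (Fin n))) (m : ℕ) : skel L m ≤ skel L (m + 1) :=
  fun _ h => ⟨h.1, h.2.trans (Nat.lt_succ_self _)⟩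

theorem Iic_le_skel (L : LowerSet (Finset (Fin n))) (m : ℕ) (F : Fc L m) :
    LowerSet.Iic F.1 ≤ skel L (m + 1) :=
  fun G h => ⟨L.lower h F.2.1, Nat.lt_succ_of_le ((Finset.card_le_card h).trans F.2.2.le)⟩

theorem Iio_le_skel (L : LowerSet (Finset (Fin n))) (m : ℕ) (F : Fc L m) :
    LowerSet.Iio F.1 ≤ skel L m :=
  fun G h => ⟨L.lower h.le F.2.1, (Finset.card_lt_card h).trans_le F.2.2.le⟩

theorem proj_skMap (L : LowerSet (Finset (Fin n))) (m : ℕ) (F : Fc L m) :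
    projQ k _ _ (Iic_le_skel L m F) ∘ₗ skMap k L m =
      mulQ k (chi F.1) (LowerSet.Iic F.1) (LowerSet.Iic F.1) (sub_ok le_rfl) ∘ₗ
        LinearMap.proj F := by
  rw [skMap, ← LinearMap.compRight_apply (MvPolynomial (Fin n) k), map_sum, Finset.sum_eq_single F]
  · rw [LinearMap.compRight_apply, ← LinearMap.comp_assoc, inc, projQ,
      mulQ_comp k (chi F.1) 0 (chi F.1) _ _ _ _ _ (sub_ok le_rfl) (by simp)]
  · intro G _ hG
    rw [LinearMap.compRight_apply, ← LinearMap.comp_assoc, inc, projQ]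
    have hz : ∀ a : Fin n →₀ ℕ, chi G.1 ≤ a → a.support ∉ LowerSet.Iic F.1 := by
      intro a h1 h2
      rw [chi_le] at h1
      apply hG
      apply Subtype.ext
      exact Finset.eq_of_subset_of_card_le (h1.trans h2) (by rw [F.2.2, G.2.2])
    rw [mulQ_comp k (chi G.1) 0 (chi G.1) _ _ _ _ _ (fun a ha hb => absurd ha (hz a hb)) (by simp),
      mulQ_zero_of k _ _ _ _ hz, LinearMap.zero_comp]
  · simp

theorem sesK (L : LowerSet (Finset (Fin n))) (m : ℕ) :
    IsSES (skMap k L m) (projQ k (skel L (m + 1)) (skel L m) (skel_le L m)) where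
  inj := by
    rw [injective_iff_map_eq_zero]
    intro x hx
    funext F
    have h := LinearMap.congr_fun (proj_skMap k L m F) x
    rw [LinearMap.comp_apply, hx, map_zero, LinearMap.comp_apply] at h
    exact (injective_iff_map_eq_zero _).1 (sesT k F.1).inj _ h.symm
  surj := by
    intro x
    obtain ⟨f, rfl⟩ := Submodule.Quotient.mk_surjective _ x
    exact ⟨Submodule.Quotient.mk f, projQ_mk _ _ _ _ _⟩
  exact := by
    intro x
    obtain ⟨f, rfl⟩ := Submodule.Quotient.mk_surjective _ x
    have key : ∀ g : Fc L m → MvPolynomial (Fin n) k,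
        skMap k L m (fun F => Submodule.Quotient.mk (g F)) =
        Submodule.Quotient.mk (∑ F, MvPolynomial.monomial (chi F.1) (1 : k) * g F) := by
      intro g
      rw [skMap, LinearMap.sum_apply, ← Submodule.mkQ_apply, map_sum]
      rfl
    rw [projQ_mk, Submodule.Quotient.mk_eq_zero]
    constructor
    · intro hf
      refine ⟨fun F => Submodule.Quotient.mk (f.divMonomial (chi F.1)), ?_⟩
      rw [key, Submodule.Quotient.eq]
      intro a ha
      rw [MvPolynomial.coeff_sub, MvPolynomial.coeff_sum]
      simp only [MvPolynomial.coeff_monomial_mul', MvPolynomial.coeff_divMonomial, one_mul]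
      by_cases hm : a.support.card < m
      · rw [hf a ⟨ha.1, hm⟩, sub_zero]
        apply Finset.sum_eq_zero
        intro F _
        rw [if_neg]
        rw [chi_le]
        intro h
        have := Finset.card_le_card h
        rw [F.2.2] at this
        omega
      · have hm' : a.support.card = m := by have := ha.2; omega
        rw [Finset.sum_eq_single (⟨a.support, ha.1, hm'⟩ : Fc L m)]
        · have : chi a.support ≤ a := (chi_le _ _).2 le_rfl
          rw [if_pos this, add_tsub_cancel_of_le this, sub_self]
        · intro F _ hF
          rw [if_neg]
          rw [chi_le]
          intro h
          apply hF
          apply Subtype.ext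
          exact Finset.eq_of_subset_of_card_le h (by rw [F.2.2, hm'])
        · simp
    · rintro ⟨y, hy⟩
      choose g hg using fun F => Submodule.Quotient.mk_surjective _ (y F)
      obtain rfl : (fun F => Submodule.Quotient.mk (g F)) = y := funext hg
      rw [key, Submodule.Quotient.eq] at hy
      intro a ha
      have := hy a (skel_le L m ha)
      rw [MvPolynomial.coeff_sub, MvPolynomial.coeff_sum, Finset.sum_eq_zero, zero_sub,
        neg_eq_zero] at this
      · exact this
      · intro F _
        rw [MvPolynomial.coeff_monomial_mul', if_neg]
        rw [chi_le]
        intro h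
        have h1 := Finset.card_le_card h
        have h2 := ha.2
        rw [F.2.2] at h1
        omega

end MonIdeals

open CategoryTheory

set_option linter.unusedVariables false

section ExtComp

variable (k : Type) [Field k] {n : ℕ}

theorem DD_ok (G F : Finset (Fin n)) (hc : G.card + 1 = F.card) :
    ∀ a : Fin n →₀ ℕ, a.support ∈ LowerSet.Iio F → chi G ≤ a →
      (a - chi G).support ∈ LowerSet.Iic G := by
  intro a ha hb
  rw [chi_le] at hb
  have h1 := Finset.card_lt_card (show a.support ⊂ F from ha)
  have := Finset.eq_of_subset_of_card_le hb (by omega)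
  rw [LowerSet.mem_Iic_iff]
  intro i hi
  rw [this]
  simp at hi ⊢
  omega

noncomputable def DD (G F : Finset (Fin n)) (hc : G.card + 1 = F.card) (i : ℕ) :
    XE (MvPolynomial (Fin n) k) (MQ k (LowerSet.Iic F)) i →ₗ[MvPolynomial (Fin n) k]
      XE (MvPolynomial (Fin n) k) (MQ k (LowerSet.Iic G)) (i + 1) :=
  XE.pull (mulQ k (chi G) (LowerSet.Iic G) (LowerSet.Iio F) (DD_ok G F hc)) (i + 1) ∘ₗ
    XE.conn (sesT k F) i

theorem DD_eq_zero (G F : Finset (Fin n)) (hc : G.card + 1 = F.card) (h : ¬ G ⊆ F) (i : ℕ) (y) :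
    DD k G F hc i y = 0 := by
  rw [DD, LinearMap.comp_apply, mulQ_zero_of, XE.pull_zero]
  intro a h1 h2
  exact h (((chi_le _ _).1 h1).trans (le_of_lt (show a.support < F from h2)))

theorem card_insert_aux {G F : Finset (Fin n)} {v : Fin n} (hv : v ∉ G) (hF : F = insert v G) :
    G.card + 1 = F.card := by rw [hF, Finset.card_insert_of_notMem hv]

theorem DD_eq_conn (G F : Finset (Fin n)) (v : Fin n) (hv : v ∉ G) (hF : F = insert v G)
    (hc : G.card + 1 = F.card) (i : ℕ) (y) :
    DD k G F hc i y = XE.conn (sesV k G F v hv hF) i y := by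
  have := XE.conn_nat (sesV k G F v hv hF) (sesT k F) LinearMap.id
    (mulQ k (chi G) (LowerSet.Iic F) (LowerSet.Iic F) (sub_ok le_rfl))
    (mulQ k (chi G) (LowerSet.Iic G) (LowerSet.Iio F) (DD_ok G F hc)) ?_ ?_ i y
  · rw [XE.pull_id] at this
    rw [this]; rfl
  · rw [LinearMap.comp_id]
    apply mulQ_comp
    rw [hF, chi_insert _ _ hv, add_comm]
  · unfold projQ
    rw [mulQ_comp k _ _ (chi G) _ _ _ _ _ (fun a ha hb => ?_) (by simp),
      mulQ_comp k _ _ (chi G) _ _ _ _ _ _ (by simp)]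
    exact sub_ok (fun G h => show G ≤ F from le_of_lt (show G < F from h)) a ha hb

theorem inc_conn (L : LowerSet (Finset (Fin n))) (m : ℕ) (G : Fc L m) (F : Fc L (m + 1)) (i : ℕ)
    (y : XE (MvPolynomial (Fin n) k) (MQ k (LowerSet.Iic F.1)) i) :
    XE.pull (inc k L m G) (i + 1) (XE.conn (sesK k L (m + 1)) i
      (XE.pull (LinearMap.proj F : PQ k L (m + 1) →ₗ[_] _) i y)) =
      DD k G.1 F.1 (by rw [G.2.2, F.2.2]) i y := by
  rw [XE.conn_nat (sesK k L (m + 1)) (sesT k F.1) (LinearMap.proj F)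
    (projQ k _ _ (Iic_le_skel L (m + 1) F)) (projQ k _ _ (Iio_le_skel L (m + 1) F))
    (proj_skMap k L (m + 1) F) ?_ i y]
  · rw [← XE.pull_comp, inc, projQ, mulQ_comp k _ _ (chi G.1) _ _ _ _ _
      (DD_ok G.1 F.1 (by rw [G.2.2, F.2.2])) (by simp)]
    rfl
  · unfold projQ
    rw [mulQ_comp k _ _ 0 _ _ _ _ _ (sub_ok ((Iio_le_skel L (m + 1) F).trans (skel_le _ _)))
      (by simp), mulQ_comp k _ _ 0 _ _ _ _ _ _ (by simp)]

theorem sum_single_proj (L : LowerSet (Finset (Fin n))) (m : ℕ) :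
    (∑ F : Fc L m, (LinearMap.single (MvPolynomial (Fin n) k)
      (fun F : Fc L m => MQ k (LowerSet.Iic F.1)) F) ∘ₗ LinearMap.proj F) = LinearMap.id := by
  apply LinearMap.ext
  intro x
  rw [LinearMap.sum_apply]
  simp only [LinearMap.comp_apply, LinearMap.proj_apply, LinearMap.single_apply,
    LinearMap.id_apply]
  exact Finset.univ_sum_single x

noncomputable abbrev sng (L : LowerSet (Finset (Fin n))) (m : ℕ) (F : Fc L m) :
    MQ k (LowerSet.Iic F.1) →ₗ[MvPolynomial (Fin n) k] PQ k L m :=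
  LinearMap.single (MvPolynomial (Fin n) k) (fun F : Fc L m => MQ k (LowerSet.Iic F.1)) F

noncomputable abbrev prj (L : LowerSet (Finset (Fin n))) (m : ℕ) (F : Fc L m) :
    PQ k L m →ₗ[MvPolynomial (Fin n) k] MQ k (LowerSet.Iic F.1) :=
  LinearMap.proj F

theorem PQ_decomp (L : LowerSet (Finset (Fin n))) (m : ℕ) (i : ℕ)
    (z : XE (MvPolynomial (Fin n) k) (PQ k L m) i) :
    z = ∑ F : Fc L m, XE.pull (prj k L m F) i (XE.pull (sng k L m F) i z) := by
  conv_lhs => rw [← XE.pull_id i z, ← sum_single_proj k L m, XE.pull_sum]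
  simp only [XE.pull_comp]

theorem PQ_ext (L : LowerSet (Finset (Fin n))) (m : ℕ) (i : ℕ)
    (z : XE (MvPolynomial (Fin n) k) (PQ k L m) i)
    (h : ∀ F, XE.pull (sng k L m F) i z = 0) : z = 0 := by
  rw [PQ_decomp k L m i z]
  simp [h]

theorem PQ_single (L : LowerSet (Finset (Fin n))) (m : ℕ) (i : ℕ)
    (y : ∀ F : Fc L m, XE (MvPolynomial (Fin n) k) (MQ k (LowerSet.Iic F.1)) i) (G : Fc L m) :
    XE.pull (sng k L m G) i (∑ F, XE.pull (prj k L m F) i (y F)) = y G := by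
  rw [map_sum, Finset.sum_eq_single G]
  · rw [← XE.pull_comp]
    have : prj k L m G ∘ₗ sng k L m G = LinearMap.id := by
      apply LinearMap.ext; intro x; simp [prj, sng]
    rw [this, XE.pull_id]
  · intro F _ hF
    rw [← XE.pull_comp]
    have : prj k L m F ∘ₗ sng k L m G = 0 := by
      apply LinearMap.ext; intro x; simp [prj, sng, Pi.single_eq_of_ne hF]
    rw [this, XE.pull_zero]
  · simp

theorem inc_conn_sum (L : LowerSet (Finset (Fin n))) (m : ℕ) (G : Fc L m) (i : ℕ)
    (z : XE (MvPolynomial (Fin n) k) (PQ k L (m + 1)) i) :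
    XE.pull (inc k L m G) (i + 1) (XE.conn (sesK k L (m + 1)) i z) =
      ∑ F : Fc L (m + 1), DD k G.1 F.1 (by rw [G.2.2, F.2.2]) i
        (XE.pull (sng k L (m + 1) F) i z) := by
  conv_lhs => rw [PQ_decomp k L (m + 1) i z, map_sum, map_sum]
  apply Finset.sum_congr rfl
  intro F _
  exact inc_conn k L m G F i _

theorem skMap_single (L : LowerSet (Finset (Fin n))) (m : ℕ) (G : Fc L m) :
    skMap k L m ∘ₗ sng k L m G = inc k L m G := by
  apply LinearMap.ext
  intro x
  rw [skMap, LinearMap.comp_apply, LinearMap.sum_apply, Finset.sum_eq_single G]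
  · simp [sng]
  · intro F _ hF
    simp [sng, Pi.single_eq_of_ne hF]
  · simp

theorem pull_single_skMap (L : LowerSet (Finset (Fin n))) (m : ℕ) (G : Fc L m) (i : ℕ) (w) :
    XE.pull (sng k L m G) i (XE.pull (skMap k L m) i w) = XE.pull (inc k L m G) i w := by
  rw [← XE.pull_comp, skMap_single]

/-- anticommutativity -/
theorem DD_anticomm (H : Finset (Fin n)) (u v : Fin n) (hu : u ∉ H) (hv : v ∉ H) (huv : u ≠ v)
    (Gu Gv F : Finset (Fin n)) (hGu : Gu = insert u H) (hGv : Gv = insert v H)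
    (hF : F = insert v (insert u H)) (h1 h2 h3 h4) (i : ℕ)
    (y : XE (MvPolynomial (Fin n) k) (MQ k (LowerSet.Iic F)) i) :
    DD k H Gu h1 (i + 1) (DD k Gu F h2 i y) = - DD k H Gv h3 (i + 1) (DD k Gv F h4 i y) := by
  rw [eq_neg_iff_add_eq_zero]
  set m := H.card with hm
  let L : LowerSet (Finset (Fin n)) := ⊤
  let H' : Fc L m := ⟨H, trivial, rfl⟩
  let F' : Fc L (m + 1 + 1) := ⟨F, trivial, by omega⟩
  let U : Fc L (m + 1) := ⟨Gu, trivial, by omega⟩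
  let V : Fc L (m + 1) := ⟨Gv, trivial, by omega⟩
  have hUV : U ≠ V := by
    intro h
    have h' : Gu = Gv := congrArg Subtype.val h
    have : u ∈ Gv := by rw [← h', hGu]; simp
    rw [hGv] at this
    rcases Finset.mem_insert.1 this with h | h
    · exact huv h
    · exact hu h
  have key := inc_conn_sum k L m H' (i + 1) (XE.pull (skMap k L (m + 1)) (i + 1)
    (XE.conn (sesK k L (m + 1 + 1)) i (XE.pull (prj k L (m + 1 + 1) F') i y)))
  rw [XE.conn_pull, map_zero] at key
  have h5 : ∀ G : Fc L (m + 1), XE.pull (sng k L (m + 1) G) (i + 1)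
      (XE.pull (skMap k L (m + 1)) (i + 1)
      (XE.conn (sesK k L (m + 1 + 1)) i (XE.pull (prj k L (m + 1 + 1) F') i y))) =
      DD k G.1 F (by rw [G.2.2]; exact F'.2.2.symm) i y := by
    intro G
    rw [pull_single_skMap]
    exact inc_conn k L (m + 1) G F' i y
  simp only [h5] at key
  rw [key, ← Finset.sum_pair hUV (f := fun G : Fc L (m + 1) => DD k H'.1 G.1 (by rw [G.2.2]) (i + 1)
    (DD k G.1 F (by rw [G.2.2]; exact F'.2.2.symm) i y))]
  apply Finset.sum_subset (Finset.subset_univ _)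
  intro G _ hG
  by_cases hHG : H ⊆ G.1
  · rw [DD_eq_zero k G.1 F, map_zero]
    intro hGF
    apply hG
    obtain ⟨w, hw, hwG⟩ : ∃ w, w ∉ H ∧ insert w H = G.1 :=
      (Finset.covBy_iff_exists_insert).1 ((Finset.covBy_iff_card_sdiff_eq_one).2
        ⟨hHG, by rw [Finset.card_sdiff_of_subset hHG, G.2.2, hm]; omega⟩)
    have hwF : w ∈ F := hGF (by rw [← hwG]; simp)
    rw [hF] at hwF
    simp only [Finset.mem_insert] at hwF
    simp only [Finset.mem_insert, Finset.mem_singleton]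
    rcases hwF with h | h | h
    · right; apply Subtype.ext; rw [← hwG, h]; exact hGv.symm
    · left; apply Subtype.ext; rw [← hwG, h]; exact hGu.symm
    · exact absurd h hw
  · exact DD_eq_zero k H G.1 _ hHG _ _

end ExtComp

open CategoryTheory

set_option linter.unusedVariables false

section ExtGen

variable (k : Type) [Field k] {n : ℕ}

structure HasGen (F : Finset (Fin n)) (i : ℕ)
    (e : XE (MvPolynomial (Fin n) k) (MQ k (LowerSet.Iic F)) i) : Prop where
  gen : ∀ x, ∃ s : MvPolynomial (Fin n) k, x = s • e
  ann : ∀ s : MvPolynomial (Fin n) k, s • e = 0 ↔ s ∈ monJ k (LowerSet.Iic F)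

theorem HasGen.unit {F : Finset (Fin n)} {i : ℕ} {e} (h : HasGen k F i e)
    (u : MvPolynomial (Fin n) k) (hu : u * u = 1) : HasGen k F i (u • e) where
  gen x := by
    obtain ⟨s, rfl⟩ := h.gen x
    refine ⟨s * u, ?_⟩
    rw [smul_smul, mul_assoc, hu, mul_one]
  ann s := by
    rw [smul_smul, h.ann]
    constructor
    · intro h'
      have := (monJ k (LowerSet.Iic F)).mul_mem_left u h'
      rwa [mul_comm s u, ← mul_assoc, hu, one_mul] at this
    · intro h'
      exact Ideal.mul_mem_right _ _ h'

theorem monJ_univ : monJ k (LowerSet.Iic (Finset.univ : Finset (Fin n))) = ⊥ := by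
  rw [eq_bot_iff]
  intro f hf
  rw [Ideal.mem_bot]
  ext a
  rw [hf a (by rw [LowerSet.mem_Iic_iff]; exact Finset.subset_univ _), MvPolynomial.coeff_zero]

noncomputable def univEquiv (F : Finset (Fin n)) (hF : F = Finset.univ) :
    MQ k (LowerSet.Iic F) ≃ₗ[MvPolynomial (Fin n) k] MvPolynomial (Fin n) k :=
  Submodule.quotEquivOfEqBot _ (by rw [hF]; exact monJ_univ k)

noncomputable def eBase (F : Finset (Fin n)) (hF : F = Finset.univ) :
    XE (MvPolynomial (Fin n) k) (MQ k (LowerSet.Iic F)) 0 :=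
  (XE.zeroEquiv _).symm (univEquiv k F hF).toLinearMap

theorem eBase_gen (F : Finset (Fin n)) (hF : F = Finset.univ) : HasGen k F 0 (eBase k F hF) where
  gen x := by
    refine ⟨XE.zeroEquiv _ x ((univEquiv k F hF).symm 1), ?_⟩
    apply (XE.zeroEquiv _).injective
    rw [map_smul, eBase, LinearEquiv.apply_symm_apply]
    apply LinearMap.ext
    intro y
    obtain ⟨p, rfl⟩ := (univEquiv k F hF).symm.surjective y
    rw [LinearMap.smul_apply, LinearEquiv.coe_coe, LinearEquiv.apply_symm_apply,
      show p = p • (1 : MvPolynomial (Fin n) k) by simp, map_smul, map_smul, smul_eq_mul,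
      smul_eq_mul, smul_eq_mul]
    ring
  ann s := by
    have h0 : s ∈ monJ k (LowerSet.Iic F) ↔ s = 0 := by
      rw [hF, monJ_univ, Ideal.mem_bot]
    rw [h0, ← (XE.zeroEquiv _).map_eq_zero_iff, map_smul, eBase, LinearEquiv.apply_symm_apply]
    constructor
    · intro h
      have := LinearMap.congr_fun h ((univEquiv k F hF).symm 1)
      rwa [LinearMap.smul_apply, LinearEquiv.coe_coe, LinearEquiv.apply_symm_apply, smul_eq_mul,
        mul_one] at this
    · rintro rfl
      rw [zero_smul]

theorem univ_vanish (F : Finset (Fin n)) (hF : F = Finset.univ) (i : ℕ)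
    (x : XE (MvPolynomial (Fin n) k) (MQ k (LowerSet.Iic F)) (i + 1)) : x = 0 := by
  have : Module.Projective (MvPolynomial (Fin n) k) (MQ k (LowerSet.Iic F)) :=
    Module.Projective.of_equiv (univEquiv k F hF).symm
  exact XE.eq_zero_of_free i x

theorem pull_mulQ_self (b : Fin n →₀ ℕ) (L : LowerSet (Finset (Fin n))) (h) (i : ℕ) (y) :
    XE.pull (mulQ k b L L h) i y = (MvPolynomial.monomial b (1 : k)) • y := by
  have : mulQ k b L L h = (MvPolynomial.monomial b (1 : k)) • LinearMap.id := by
    apply LinearMap.ext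
    intro x
    obtain ⟨f, rfl⟩ := Submodule.Quotient.mk_surjective _ x
    rfl
  rw [this, XE.pull_smul, XE.pull_id]

section step

variable (G F : Finset (Fin n)) (v : Fin n) (hv : v ∉ G) (hF : F = insert v G) (i : ℕ)
  (e : XE (MvPolynomial (Fin n) k) (MQ k (LowerSet.Iic F)) i) (he : HasGen k F i e)
  (hvan : ∀ j, j ≠ i → ∀ x : XE (MvPolynomial (Fin n) k) (MQ k (LowerSet.Iic F)) j, x = 0)

include hv hF he hvan

theorem step_pull (j : ℕ) (x : XE (MvPolynomial (Fin n) k) (MQ k (LowerSet.Iic G)) j) :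
    XE.pull (projQ k (LowerSet.Iic F) (LowerSet.Iic G)
      (LowerSet.Iic_le.2 (by subst hF; exact Finset.subset_insert _ _))) j x = 0 := by
  have hs := sesV k G F v hv hF
  set y := XE.pull (projQ k (LowerSet.Iic F) (LowerSet.Iic G)
      (LowerSet.Iic_le.2 (by subst hF; exact Finset.subset_insert _ _))) j x with hy
  have h1 : (MvPolynomial.monomial (Finsupp.single v 1) (1 : k)) • y = 0 := by
    rw [← pull_mulQ_self k _ _ (sub_ok le_rfl), hy, ← XE.pull_comp, hs.zero, XE.pull_zero]
  by_cases hj : j = i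
  · subst hj
    obtain ⟨s, hsy⟩ := he.gen y
    rw [hsy, smul_smul, he.ann] at h1
    have h2 := hs.inj (a₁ := Submodule.Quotient.mk s) (a₂ := 0) (by
      rw [map_zero, mulQ_mk, Submodule.Quotient.mk_eq_zero]; exact h1)
    rw [Submodule.Quotient.mk_eq_zero] at h2
    rw [hsy]
    exact (he.ann s).2 h2
  · exact hvan j hj y

theorem step_vanish (j : ℕ) (hj : j ≠ i + 1)
    (x : XE (MvPolynomial (Fin n) k) (MQ k (LowerSet.Iic G)) j) : x = 0 := by
  have hs := sesV k G F v hv hF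
  have h0 := step_pull k G F v hv hF i e he hvan j x
  cases j with
  | zero => exact XE.pull_inj_zero hs.surj x h0
  | succ j =>
    obtain ⟨y, rfl⟩ := XE.exact3 hs j x h0
    rw [hvan j (by omega) y, map_zero]

theorem step_gen (hc) : HasGen k G (i + 1) (DD k G F hc i e) where
  gen x := by
    have hs := sesV k G F v hv hF
    have h0 := step_pull k G F v hv hF i e he hvan (i + 1) x
    obtain ⟨y, rfl⟩ := XE.exact3 hs i x h0
    obtain ⟨s, rfl⟩ := he.gen y
    refine ⟨s, ?_⟩
    rw [DD_eq_conn k G F v hv hF, map_smul]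
  ann s := by
    have hs := sesV k G F v hv hF
    rw [DD_eq_conn k G F v hv hF, ← map_smul]
    have hker : s ∈ monJ k (LowerSet.Iic G) ↔
        ∃ g : MvPolynomial (Fin n) k, MvPolynomial.monomial (Finsupp.single v 1) (1 : k) * g - s ∈
          monJ k (LowerSet.Iic F) := by
      rw [← Submodule.Quotient.mk_eq_zero, ← projQ_mk k (LowerSet.Iic F) (LowerSet.Iic G)
        (LowerSet.Iic_le.2 (by subst hF; exact Finset.subset_insert _ _)), hs.exact _]
      constructor
      · rintro ⟨y, hy⟩
        obtain ⟨g, rfl⟩ := Submodule.Quotient.mk_surjective _ y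
        exact ⟨g, (Submodule.Quotient.eq _).1 hy⟩
      · rintro ⟨g, hg⟩
        exact ⟨Submodule.Quotient.mk g, (Submodule.Quotient.eq _).2 hg⟩
    rw [hker]
    constructor
    · intro h
      obtain ⟨y, hy⟩ := XE.exact1 hs i _ h
      obtain ⟨g, rfl⟩ := he.gen y
      refine ⟨g, ?_⟩
      rw [← he.ann, sub_smul, ← hy, pull_mulQ_self, smul_smul, sub_self]
    · rintro ⟨g, hg⟩
      rw [← he.ann, sub_smul, sub_eq_zero] at hg
      rw [← hg, mul_smul, ← pull_mulQ_self k _ _ (sub_ok le_rfl), XE.conn_pull]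

end step

/-- sign -/
noncomputable def sg (v : Fin n) (G : Finset (Fin n)) : MvPolynomial (Fin n) k :=
  (-1) ^ (G.filter (fun w => w < v)).card

theorem sg_mul_self (v : Fin n) (G : Finset (Fin n)) : sg k v G * sg k v G = 1 := by
  rw [sg, ← mul_pow]; simp

theorem compl_ne {i : ℕ} {F : Finset (Fin n)} (h : F.card + (i + 1) = n) : Fᶜ.Nonempty := by
  rw [← Finset.card_pos, Finset.card_compl, Fintype.card_fin]; omega

theorem minc_notMem {F : Finset (Fin n)} (h : Fᶜ.Nonempty) : Fᶜ.min' h ∉ F :=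
  Finset.mem_compl.1 (Finset.min'_mem _ _)

noncomputable def eGen : ∀ (i : ℕ) (F : Finset (Fin n)) (h : F.card + i = n),
    XE (MvPolynomial (Fin n) k) (MQ k (LowerSet.Iic F)) i
  | 0, F, h => eBase k F ((Finset.card_eq_iff_eq_univ F).1 (by rw [Fintype.card_fin]; omega))
  | i + 1, F, h =>
      sg k (Fᶜ.min' (compl_ne h)) F • DD k F (insert (Fᶜ.min' (compl_ne h)) F)
        (card_insert_aux (minc_notMem _) rfl) i
        (eGen i (insert (Fᶜ.min' (compl_ne h)) F)
          (by rw [Finset.card_insert_of_notMem (minc_notMem _)]; omega))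

theorem eGen_spec : ∀ (i : ℕ) (F : Finset (Fin n)) (h : F.card + i = n),
    HasGen k F i (eGen k i F h) ∧
      ∀ j, j ≠ i → ∀ x : XE (MvPolynomial (Fin n) k) (MQ k (LowerSet.Iic F)) j, x = 0
  | 0, F, h => by
      refine ⟨eBase_gen k F _, ?_⟩
      intro j hj x
      cases j with
      | zero => exact absurd rfl hj
      | succ j =>
        exact univ_vanish k F
          ((Finset.card_eq_iff_eq_univ F).1 (by rw [Fintype.card_fin]; omega)) j x
  | i + 1, F, h => by
      obtain ⟨h1, h2⟩ := eGen_spec i (insert (Fᶜ.min' (compl_ne h)) F)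
        (by rw [Finset.card_insert_of_notMem (minc_notMem _)]; omega)
      refine ⟨?_, ?_⟩
      · rw [eGen]
        exact (step_gen k F _ _ (minc_notMem (compl_ne h)) rfl i _ h1 h2 _).unit k _
          (sg_mul_self k _ _)
      · intro j hj x
        exact step_vanish k F _ _ (minc_notMem (compl_ne h)) rfl i _ h1 h2 j hj x

theorem eGen_congr (i : ℕ) (F F' : Finset (Fin n)) (hFF : F = F') (h : F.card + i = n)
    (h' : F'.card + i = n) (G : Finset (Fin n)) (hc : G.card + 1 = F.card)
    (hc' : G.card + 1 = F'.card) :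
    DD k G F hc i (eGen k i F h) = DD k G F' hc' i (eGen k i F' h') := by
  subst hFF; rfl

theorem eGen_succ (i : ℕ) (F : Finset (Fin n)) (h : F.card + (i + 1) = n) (t : Fin n)
    (htmin : Fᶜ.min' (compl_ne h) = t) (htF : t ∉ F) :
    eGen k (i + 1) F h = sg k t F • DD k F (insert t F) (card_insert_aux htF rfl) i
      (eGen k i (insert t F) (by rw [Finset.card_insert_of_notMem htF]; omega)) := by
  subst htmin
  rfl

theorem DD_eGen : ∀ (i : ℕ) (G F : Finset (Fin n)) (v : Fin n) (hv : v ∉ G) (hF : F = insert v G)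
    (hc : G.card + 1 = F.card) (h : F.card + i = n) (h' : G.card + (i + 1) = n),
    DD k G F hc i (eGen k i F h) = sg k v G • eGen k (i + 1) G h' := by
  intro i
  induction i with
  | zero =>
    intro G F v hv hF hc h h'
    have hmin : Gᶜ.min' (compl_ne h') = v := by
      have h1 : Gᶜ.card = 1 := by rw [Finset.card_compl, Fintype.card_fin]; omega
      obtain ⟨w, hw⟩ := Finset.card_eq_one.1 h1
      have h2 : v ∈ Gᶜ := Finset.mem_compl.2 hv
      have h3 := Finset.min'_mem _ (compl_ne h')
      have h4 : ∀ x ∈ Gᶜ, x = w := by rw [hw]; simp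
      rw [h4 _ h3, h4 _ h2]
    rw [eGen_succ k 0 G h' v hmin hv, smul_smul, sg_mul_self, one_smul]
    apply eGen_congr
    exact hF
  | succ i ih =>
    intro G F v hv hF hc h h'
    obtain ⟨t, ht⟩ : ∃ t, Gᶜ.min' (compl_ne h') = t := ⟨_, rfl⟩
    have htG : t ∉ G := by rw [← ht]; exact minc_notMem _
    by_cases hvt : v = t
    · rw [eGen_succ k (i + 1) G h' v (ht.trans hvt.symm) hv, smul_smul, sg_mul_self, one_smul]
      apply eGen_congr
      exact hF
    · have hlt : t < v := lt_of_le_of_ne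
        (ht ▸ Finset.min'_le _ _ (Finset.mem_compl.2 hv)) (fun h => hvt h.symm)
      have htF : Fᶜ.min' (compl_ne h) = t := by
        apply le_antisymm
        · apply Finset.min'_le
          rw [Finset.mem_compl, hF, Finset.mem_insert, not_or]
          exact ⟨fun h => hvt h.symm, htG⟩
        · apply Finset.le_min'
          intro y hy
          rw [← ht]
          apply Finset.min'_le
          rw [Finset.mem_compl] at hy ⊢
          intro h; apply hy; rw [hF]; exact Finset.mem_insert_of_mem h
      have htF' : t ∉ F := by rw [← htF]; exact minc_notMem _
      have e1 := eGen_succ k i F h t htF htF'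
      have e2 := eGen_succ k (i + 1) G h' t ht htG
      have hvt' : v ∉ insert t G := by
        rw [Finset.mem_insert, not_or]; exact ⟨hvt, hv⟩
      have e3 := ih (insert t G) (insert t F) v hvt' (by rw [hF, Finset.insert_comm])
        (by rw [Finset.card_insert_of_notMem htG, Finset.card_insert_of_notMem htF', hc])
        (by rw [Finset.card_insert_of_notMem htF']; omega)
        (by rw [Finset.card_insert_of_notMem htG]; omega)
      rw [e1, map_smul, DD_anticomm k G v t hv htG hvt F (insert t G) (insert t F) hF rfl
        (by rw [hF]) hc _ (card_insert_aux htG rfl)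
        (by rw [Finset.card_insert_of_notMem htG, Finset.card_insert_of_notMem htF', hc]),
        e3, map_smul, e2, smul_smul, smul_neg, smul_smul, ← neg_smul]
      have s1 : sg k t F = sg k t G := by
        rw [sg, sg, hF, Finset.filter_insert, if_neg (not_lt.2 hlt.le)]
      have s2 : sg k v (insert t G) = - sg k v G := by
        rw [sg, sg, Finset.filter_insert, if_pos hlt, Finset.card_insert_of_notMem, pow_succ]
        · ring
        · intro h; exact htG (Finset.mem_filter.1 h).1
      congr 1
      rw [s1, s2]
      ring

end ExtGen

open CategoryTheory

set_option linter.unusedVariables false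

section ResD

variable (k : Type) [Field k] {n : ℕ}

theorem sk_vanish (L : LowerSet (Finset (Fin n))) : ∀ (m i : ℕ), i + m ≤ n →
    ∀ x : XE (MvPolynomial (Fin n) k) (MQ k (skel L m)) i, x = 0 := by
  intro m
  induction m with
  | zero =>
    intro i hi x
    have : Subsingleton (MQ k (skel L 0)) := by
      apply Submodule.Quotient.subsingleton_iff.2
      rw [eq_top_iff]
      intro f _ a ha
      exact absurd ha.2 (Nat.not_lt_zero _)
    exact XE.eq_zero_of_subsingleton i x
  | succ m ih =>
    intro i hi x
    have h0 : XE.pull (skMap k L m) i x = 0 := by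
      apply PQ_ext
      intro F
      refine (eGen_spec k (n - m) F.1 (by rw [F.2.2]; omega)).2 i (by omega) _
    obtain ⟨y, rfl⟩ := XE.exact2 (sesK k L m) i x h0
    rw [ih i (by omega) y, map_zero]

theorem sk_inj (L : LowerSet (Finset (Fin n))) (m i : ℕ) (h : i + m ≤ n)
    (x : XE (MvPolynomial (Fin n) k) (MQ k (skel L (m + 1))) i)
    (hx : XE.pull (skMap k L m) i x = 0) : x = 0 := by
  obtain ⟨y, rfl⟩ := XE.exact2 (sesK k L m) i x hx
  rw [sk_vanish k L m i h y, map_zero]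

theorem sk_range (L : LowerSet (Finset (Fin n))) (m c : ℕ) (h : c + (m + 1) = n)
    (z : XE (MvPolynomial (Fin n) k) (PQ k L (m + 1)) c) :
    (∃ x, XE.pull (skMap k L (m + 1)) c x = z) ↔
      ∀ G : Fc L m, ∑ F : Fc L (m + 1), DD k G.1 F.1 (by rw [G.2.2, F.2.2]) c
        (XE.pull (sng k L (m + 1) F) c z) = 0 := by
  constructor
  · rintro ⟨x, rfl⟩ G
    rw [← inc_conn_sum, XE.conn_pull, map_zero]
  · intro hz
    apply XE.exact1 (sesK k L (m + 1))
    apply sk_inj k L m (c + 1) (by omega)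
    apply PQ_ext
    intro G
    rw [pull_single_skMap, inc_conn_sum, hz G]

/-- setting variables outside `F` to zero -/
noncomputable def rho (F : Finset (Fin n)) :
    MvPolynomial (Fin n) k →ₐ[k] MvPolynomial (Fin n) k :=
  MvPolynomial.aeval (fun i => if i ∈ F then MvPolynomial.X i else 0)

theorem rho_monomial (F : Finset (Fin n)) (b : Fin n →₀ ℕ) (r : k) :
    rho k F (MvPolynomial.monomial b r) =
      if b.support ⊆ F then MvPolynomial.monomial b r else 0 := by
  rw [rho, MvPolynomial.aeval_monomial]
  split_ifs with h
  · rw [MvPolynomial.monomial_eq]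
    congr 1
    apply Finsupp.prod_congr
    intro i hi
    rw [if_pos (h hi)]
  · obtain ⟨i, hi, hiF⟩ := Finset.not_subset.1 h
    rw [Finsupp.prod, Finset.prod_eq_zero hi, mul_zero]
    rw [if_neg hiF, zero_pow (Finsupp.mem_support_iff.1 hi)]

theorem coeff_rho (F : Finset (Fin n)) (s : MvPolynomial (Fin n) k) (a : Fin n →₀ ℕ) :
    (rho k F s).coeff a = if a.support ⊆ F then s.coeff a else 0 := by
  classical
  induction s using MvPolynomial.induction_on' with
  | monomial b r =>
    rw [rho_monomial, MvPolynomial.coeff_monomial]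
    by_cases hab : b = a
    · subst hab
      rw [if_pos rfl]
      split_ifs <;> simp
    · rw [if_neg hab]
      split_ifs <;> simp [MvPolynomial.coeff_monomial, hab]
  | add p q hp hq =>
    rw [map_add, MvPolynomial.coeff_add, hp, hq, MvPolynomial.coeff_add]
    split_ifs <;> simp

/-- the truncation on the quotient -/
noncomputable def rQ (F : Finset (Fin n)) : MQ k (LowerSet.Iic F) →+* MvPolynomial (Fin n) k :=
  Ideal.Quotient.lift (monJ k (LowerSet.Iic F)) (rho k F).toRingHom (by
    intro f hf
    apply MvPolynomial.ext
    intro a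
    refine (coeff_rho k F f a).trans ?_
    split_ifs with h
    · rw [hf a h, MvPolynomial.coeff_zero]
    · rw [MvPolynomial.coeff_zero])

theorem rQ_mk (F : Finset (Fin n)) (s : MvPolynomial (Fin n) k) :
    rQ k F (Submodule.Quotient.mk s) = rho k F s := rfl

theorem rQ_smul (F : Finset (Fin n)) (s : MvPolynomial (Fin n) k) (x : MQ k (LowerSet.Iic F)) :
    rQ k F (s • x) = rho k F s * rQ k F x := by
  obtain ⟨f, rfl⟩ := Submodule.Quotient.mk_surjective _ x
  rw [← Submodule.Quotient.mk_smul, rQ_mk, rQ_mk, smul_eq_mul, map_mul]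

theorem rQ_inj (F : Finset (Fin n)) (x : MQ k (LowerSet.Iic F)) (h : rQ k F x = 0) : x = 0 := by
  obtain ⟨f, rfl⟩ := Submodule.Quotient.mk_surjective _ x
  rw [Submodule.Quotient.mk_eq_zero]
  intro a ha
  rw [rQ_mk] at h
  have := coeff_rho k F f a
  rw [h, if_pos (show a.support ⊆ F from ha), MvPolynomial.coeff_zero] at this
  exact this.symm

theorem rho_self (F : Finset (Fin n)) (f : MvPolynomial (Fin n) k)
    (h : ∀ a : Fin n →₀ ℕ, f.coeff a ≠ 0 → a.support ⊆ F) : rho k F f = f := by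
  apply MvPolynomial.ext
  intro a
  rw [coeff_rho]
  split_ifs with ha
  · rfl
  · by_contra h'
    exact ha (h a (Ne.symm h'))

/-- sign in the field -/
def sgk (v : Fin n) (G : Finset (Fin n)) : k := (-1) ^ (G.filter (fun w => w < v)).card

theorem sg_eq_C (v : Fin n) (G : Finset (Fin n)) : sg k v G = MvPolynomial.C (sgk k v G) := by
  rw [sg, sgk, map_pow, map_neg, map_one]

/-- Top relative cycles. -/
def KK (L : LowerSet (Finset (Fin n))) (d : ℕ) (σ : Finset (Fin n)) :
    Submodule k (Finset (Fin n) → k) where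
  carrier := {z | (∀ F, z F ≠ 0 → F ∈ L ∧ F.card = d ∧ σ ⊆ F) ∧
    ∀ G : Finset (Fin n), σ ⊆ G → G.card + 1 = d → ∑ v ∈ Gᶜ, sgk k v G * z (insert v G) = 0}
  zero_mem' := ⟨fun F h => absurd rfl h, fun G _ _ => by simp⟩
  add_mem' := by
    rintro x y ⟨hx1, hx2⟩ ⟨hy1, hy2⟩
    refine ⟨?_, ?_⟩
    · intro F hF
      by_cases h : x F = 0
      · apply hy1
        intro h'
        apply hF
        rw [Pi.add_apply, h, h', add_zero]
      · exact hx1 F h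
    · intro G h1 h2
      simp only [Pi.add_apply, mul_add]
      rw [Finset.sum_add_distrib, hx2 G h1 h2, hy2 G h1 h2, add_zero]
  smul_mem' := by
    rintro c x ⟨hx1, hx2⟩
    refine ⟨?_, ?_⟩
    · intro F hF
      apply hx1
      intro h; apply hF
      rw [Pi.smul_apply, h, smul_zero]
    · intro G h1 h2
      simp only [Pi.smul_apply, smul_eq_mul, mul_left_comm _ c]
      rw [← Finset.mul_sum, hx2 G h1 h2, mul_zero]

theorem mem_KK (L : LowerSet (Finset (Fin n))) (d : ℕ) (σ : Finset (Fin n))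
    (z : Finset (Fin n) → k) : z ∈ KK k L d σ ↔
    (∀ F, z F ≠ 0 → F ∈ L ∧ F.card = d ∧ σ ⊆ F) ∧
    ∀ G : Finset (Fin n), σ ⊆ G → G.card + 1 = d →
      ∑ v ∈ Gᶜ, sgk k v G * z (insert v G) = 0 := Iff.rfl

/-- the sum over facets containing `G` as sum over vertices -/
theorem sum_Fc_eq (L : LowerSet (Finset (Fin n))) (m : ℕ) {M : Type} [AddCommGroup M]
    (G : Fc L m) (h : Fc L (m + 1) → M) (g : Fin n → M)
    (h1 : ∀ v, v ∉ G.1 → ∀ F : Fc L (m + 1), F.1 = insert v G.1 → h F = g v)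
    (h2 : ∀ v, v ∉ G.1 → insert v G.1 ∉ L → g v = 0)
    (h3 : ∀ F : Fc L (m + 1), ¬ G.1 ⊆ F.1 → h F = 0) :
    ∑ F : Fc L (m + 1), h F = ∑ v ∈ G.1ᶜ, g v := by
  symm
  have hL : ∀ v, v ∉ G.1 → g v ≠ 0 → insert v G.1 ∈ L := fun v hv hg => by
    by_contra h; exact hg (h2 v hv h)
  have hcard : ∀ v, v ∉ G.1 → (insert v G.1).card = m + 1 := fun v hv => by
    rw [Finset.card_insert_of_notMem hv, G.2.2]
  refine Finset.sum_bij_ne_zero (fun v hv hg => (⟨insert v G.1, hL v (Finset.mem_compl.1 hv) hg,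
    hcard v (Finset.mem_compl.1 hv)⟩ : Fc L (m + 1))) ?_ ?_ ?_ ?_
  · intros; exact Finset.mem_univ _
  · intro v hv hg w hw hg' e
    have e' : insert v G.1 = insert w G.1 := congrArg Subtype.val e
    have : v ∈ insert w G.1 := by rw [← e']; exact Finset.mem_insert_self _ _
    rcases Finset.mem_insert.1 this with h | h
    · exact h
    · exact absurd h (Finset.mem_compl.1 hv)
  · intro F _ hF
    have hGF : G.1 ⊆ F.1 := by by_contra h; exact hF (h3 F h)
    obtain ⟨w, hw, hwG⟩ : ∃ w, w ∉ G.1 ∧ insert w G.1 = F.1 :=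
      (Finset.covBy_iff_exists_insert).1 ((Finset.covBy_iff_card_sdiff_eq_one).2
        ⟨hGF, by rw [Finset.card_sdiff_of_subset hGF, G.2.2, F.2.2]; omega⟩)
    refine ⟨w, Finset.mem_compl.2 hw, ?_, ?_⟩
    · rw [← h1 w hw F hwG.symm]; exact hF
    · apply Subtype.ext; exact hwG
  · intro v hv hg
    exact (h1 v (Finset.mem_compl.1 hv) ⟨insert v G.1, hL v (Finset.mem_compl.1 hv) hg,
      hcard v (Finset.mem_compl.1 hv)⟩ rfl).symm

/-- the coordinate equivalence -/
noncomputable def gEq (F : Finset (Fin n)) (c : ℕ) (h : F.card + c = n) :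
    MQ k (LowerSet.Iic F) ≃ₗ[MvPolynomial (Fin n) k]
      XE (MvPolynomial (Fin n) k) (MQ k (LowerSet.Iic F)) c :=
  LinearEquiv.ofBijective
    (Submodule.liftQ (monJ k (LowerSet.Iic F))
      (LinearMap.toSpanSingleton (MvPolynomial (Fin n) k) _ (eGen k c F h))
      (fun s hs => ((eGen_spec k c F h).1.ann s).2 hs))
    (by
      constructor
      · rw [injective_iff_map_eq_zero]
        intro x hx
        obtain ⟨f, rfl⟩ := Submodule.Quotient.mk_surjective _ x
        rw [Submodule.Quotient.mk_eq_zero]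
        exact ((eGen_spec k c F h).1.ann f).1 hx
      · intro y
        obtain ⟨s, rfl⟩ := (eGen_spec k c F h).1.gen y
        exact ⟨Submodule.Quotient.mk s, rfl⟩)

theorem gEq_mk (F : Finset (Fin n)) (c : ℕ) (h : F.card + c = n) (s : MvPolynomial (Fin n) k) :
    gEq k F c h (Submodule.Quotient.mk s) = s • eGen k c F h := rfl

theorem DD_sum_eq (L : LowerSet (Finset (Fin n))) (m c : ℕ) (h : c + (m + 1) = n)
    (f : Finset (Fin n) → MvPolynomial (Fin n) k)
    (hf : ∀ F, ¬ (F ∈ L ∧ F.card = m + 1) → f F = 0)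
    (G : Fc L m) :
    ∑ F : Fc L (m + 1), DD k G.1 F.1 (by rw [G.2.2, F.2.2]) c
        (f F.1 • eGen k c F.1 (by rw [F.2.2]; omega)) = 0 ↔
    ∀ a : Fin n →₀ ℕ, a.support ⊆ G.1 →
      ∑ v ∈ G.1ᶜ, sgk k v G.1 * (f (insert v G.1)).coeff a = 0 := by
  have hG : G.1.card + (c + 1) = n := by rw [G.2.2]; omega
  rw [sum_Fc_eq L m G _ (fun v => (sg k v G.1 * f (insert v G.1)) • eGen k (c + 1) G.1 hG)]
  · rw [← Finset.sum_smul, (eGen_spec k (c + 1) G.1 hG).1.ann, mem_monJ]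
    apply forall_congr'
    intro a
    rw [MvPolynomial.coeff_sum]
    simp only [sg_eq_C, MvPolynomial.coeff_C_mul]
    rfl
  · intro v hv F hF
    rw [map_smul, DD_eGen k c G.1 F.1 v hv hF _ _ hG, smul_smul, hF, mul_comm]
  · intro v hv hL
    rw [hf _ (fun h => hL h.1), mul_zero, zero_smul]
  · intro F hF
    exact DD_eq_zero k _ _ _ hF _ _

/-- Description of the top Ext module. -/
theorem ext_desc (L : LowerSet (Finset (Fin n))) (m c : ℕ) (h : c + (m + 1) = n) :
    ∃ Ψ : XE (MvPolynomial (Fin n) k) (MQ k (skel L (m + 2))) c →+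
        (Finset (Fin n) → MvPolynomial (Fin n) k),
      Function.Injective Ψ ∧
      (∀ s w F, Ψ (s • w) F = rho k F s * Ψ w F) ∧
      ∀ f, (∃ w, Ψ w = f) ↔
        ∀ a : Fin n →₀ ℕ, (fun F => (f F).coeff a) ∈ KK k L (m + 1) a.support := by
  classical
  have hc : ∀ F : Fc L (m + 1), F.1.card + c = n := fun F => by rw [F.2.2]; omega
  let Ψ : XE (MvPolynomial (Fin n) k) (MQ k (skel L (m + 2))) c →+
        (Finset (Fin n) → MvPolynomial (Fin n) k) :=
    { toFun := fun w F => if hF : F ∈ L ∧ F.card = m + 1 then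
        rQ k F ((gEq k F c (hc ⟨F, hF⟩)).symm (XE.pull (inc k L (m + 1) ⟨F, hF⟩) c w)) else 0
      map_zero' := by
        funext F
        split_ifs
        · simp only [map_zero]; rfl
        · rfl
      map_add' := by
        intro x y
        funext F
        rw [Pi.add_apply]
        split_ifs
        · simp only [map_add]
        · rw [add_zero] }
  have hΨ : ∀ w (F : Fc L (m + 1)), Ψ w F.1 =
      rQ k F.1 ((gEq k F.1 c (hc F)).symm (XE.pull (inc k L (m + 1) F) c w)) :=
    fun w F => dif_pos F.2
  have hΨ0 : ∀ w (F : Finset (Fin n)), ¬ (F ∈ L ∧ F.card = m + 1) → Ψ w F = 0 :=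
    fun w F hF => dif_neg hF
  -- reconstruct
  have hrec : ∀ w (F : Fc L (m + 1)), XE.pull (inc k L (m + 1) F) c w =
      Ψ w F.1 • eGen k c F.1 (hc F) := by
    intro w F
    obtain ⟨s, hs⟩ := Submodule.Quotient.mk_surjective _
      ((gEq k F.1 c (hc F)).symm (XE.pull (inc k L (m + 1) F) c w))
    have h1 : Ψ w F.1 = rho k F.1 s := by rw [hΨ, ← hs]; rfl
    have h2 := congrArg (gEq k F.1 c (hc F)) hs
    rw [LinearEquiv.apply_symm_apply, gEq_mk] at h2
    rw [← h2, h1, ← sub_eq_zero, ← sub_smul, (eGen_spec k c F.1 (hc F)).1.ann]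
    intro a ha
    rw [MvPolynomial.coeff_sub, coeff_rho, if_pos (show a.support ⊆ F.1 from ha), sub_self]
  have hsupp : ∀ w (F : Finset (Fin n)) (a : Fin n →₀ ℕ), (Ψ w F).coeff a ≠ 0 →
      F ∈ L ∧ F.card = m + 1 ∧ a.support ⊆ F := by
    intro w F a ha
    by_cases hF : F ∈ L ∧ F.card = m + 1
    · refine ⟨hF.1, hF.2, ?_⟩
      obtain ⟨s, hs⟩ := Submodule.Quotient.mk_surjective _
        ((gEq k F c (hc ⟨F, hF⟩)).symm (XE.pull (inc k L (m + 1) ⟨F, hF⟩) c w))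
      have h1 : Ψ w F = rho k F s := by
        have := hΨ w ⟨F, hF⟩
        rw [← hs] at this; exact this
      rw [h1, coeff_rho] at ha
      by_contra h
      exact ha (if_neg h)
    · rw [hΨ0 w F hF] at ha
      exact absurd (MvPolynomial.coeff_zero a) ha
  refine ⟨Ψ, ?_, ?_, ?_⟩
  · rw [injective_iff_map_eq_zero]
    intro w hw
    apply sk_inj k L (m + 1) c (by omega)
    apply PQ_ext
    intro F
    rw [pull_single_skMap, hrec, hw, Pi.zero_apply, zero_smul]
  · intro s w F
    by_cases hF : F ∈ L ∧ F.card = m + 1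
    · have h1 := hΨ (s • w) ⟨F, hF⟩
      have h2 := hΨ w ⟨F, hF⟩
      rw [(XE.pull (inc k L (m + 1) ⟨F, hF⟩) c).map_smul, LinearEquiv.map_smul, rQ_smul,
        ← h2] at h1
      exact h1
    · rw [hΨ0 _ F hF, hΨ0 _ F hF, mul_zero]
  · intro f
    constructor
    · rintro ⟨w, rfl⟩ a
      refine ⟨fun F hF => hsupp w F a hF, ?_⟩
      intro G hG hGc
      by_cases hGL : G ∈ L
      · have h1 := (sk_range k L m c h (XE.pull (skMap k L (m + 1)) c w)).1 ⟨w, rfl⟩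
          ⟨G, hGL, by omega⟩
        simp only [pull_single_skMap, hrec] at h1
        exact (DD_sum_eq k L m c h (Ψ w) (hΨ0 w) ⟨G, hGL, by omega⟩).1 h1 a hG
      · apply Finset.sum_eq_zero
        intro v hv
        beta_reduce
        rw [hΨ0 w (insert v G), MvPolynomial.coeff_zero, mul_zero]
        intro h'
        exact hGL (L.lower (Finset.subset_insert v G) h'.1)
    · intro hf
      have hf0 : ∀ F, ¬ (F ∈ L ∧ F.card = m + 1) → f F = 0 := by
        intro F hF
        apply MvPolynomial.ext
        intro a
        by_contra h'
        obtain ⟨h1, h2, h3⟩ := (hf a).1 F h'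
        exact hF ⟨h1, h2⟩
      have hfs : ∀ F, rho k F (f F) = f F := fun F => rho_self k F _ (fun a ha => ((hf a).1 F ha).2.2)
      obtain ⟨w, hw⟩ := (sk_range k L m c h (∑ F : Fc L (m + 1), XE.pull (prj k L (m + 1) F) c
        (f F.1 • eGen k c F.1 (hc F)))).2 (by
          intro G
          simp only [PQ_single k L (m + 1) c (fun F => f F.1 • eGen k c F.1 (hc F))]
          rw [DD_sum_eq k L m c h f hf0 G]
          intro a ha
          exact (hf a).2 G.1 ha (by rw [G.2.2]))
      refine ⟨w, ?_⟩
      funext F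
      by_cases hF : F ∈ L ∧ F.card = m + 1
      · have h1 := congrArg (XE.pull (sng k L (m + 1) ⟨F, hF⟩) c) hw
        rw [PQ_single k L (m + 1) c (fun F => f F.1 • eGen k c F.1 (hc F)), pull_single_skMap] at h1
        have h2 := hΨ w ⟨F, hF⟩
        rw [h1, ← gEq_mk, LinearEquiv.symm_apply_apply, rQ_mk] at h2
        exact h2.trans (hfs F)
      · rw [hΨ0 _ F hF, hf0 F hF]

end ResD

open CategoryTheory

set_option linter.unusedVariables false

section SRdim

variable (k : Type) [Field k] {n : ℕ}

/-- The faces as a lower set. -/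
def SC.low (Δ : SC n) : LowerSet (Finset (Fin n)) where
  carrier := {F | F ∈ Δ.faces}
  lower' := fun F G h hF => Δ.down_closed hF h

theorem SC.mem_low (Δ : SC n) (F : Finset (Fin n)) : F ∈ Δ.low ↔ F ∈ Δ.faces := Iff.rfl

theorem prod_X_eq (F : Finset (Fin n)) :
    (∏ i ∈ F, MvPolynomial.X i : MvPolynomial (Fin n) k) = MvPolynomial.monomial (chi F) 1 := by
  rw [chi, MvPolynomial.monomial_sum_one]
  rfl

theorem chi_support (F : Finset (Fin n)) : (chi F).support = F := by
  ext i
  rw [Finsupp.mem_support_iff, chi_apply]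
  split_ifs with h <;> simp [h]

theorem srIdeal_eq (Δ : SC n) : srIdeal k Δ = monJ k Δ.low := by
  classical
  apply le_antisymm
  · rw [srIdeal, Ideal.span_le]
    rintro _ ⟨σ, hσ, rfl⟩ a ha
    rw [prod_X_eq, MvPolynomial.coeff_monomial, if_neg]
    rintro rfl
    rw [chi_support] at ha
    exact hσ ha
  · intro f hf
    rw [← MvPolynomial.support_sum_monomial_coeff f]
    apply Ideal.sum_mem
    intro a ha
    have h1 : a.support ∉ Δ.faces := fun h => MvPolynomial.mem_support_iff.1 ha (hf a h)
    have h2 : chi a.support ≤ a := (chi_le _ _).2 subset_rfl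
    have h3 : MvPolynomial.monomial a (f.coeff a) =
        MvPolynomial.monomial (a - chi a.support) (f.coeff a) *
          ∏ i ∈ a.support, MvPolynomial.X i := by
      rw [prod_X_eq, MvPolynomial.monomial_mul, mul_one, tsub_add_cancel_of_le h2]
    rw [h3]
    exact Ideal.mul_mem_left _ _ (Ideal.subset_span ⟨_, h1, rfl⟩)

/-- restriction to the variables in `F` -/
noncomputable def resF (F : Finset (Fin n)) : MvPolynomial (Fin n) k →ₐ[k] MvPolynomial F k :=
  MvPolynomial.aeval (fun i => if h : i ∈ F then MvPolynomial.X ⟨i, h⟩ else 0)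

theorem rename_resF (F : Finset (Fin n)) (f : MvPolynomial (Fin n) k) :
    MvPolynomial.rename (Subtype.val : F → Fin n) (resF k F f) = rho k F f := by
  have : (MvPolynomial.rename (Subtype.val : F → Fin n)).comp (resF k F) = rho k F := by
    apply MvPolynomial.algHom_ext
    intro i
    rw [AlgHom.comp_apply, resF, rho, MvPolynomial.aeval_X, MvPolynomial.aeval_X]
    split_ifs <;> simp
  exact DFunLike.congr_fun this f

theorem ker_resF (F : Finset (Fin n)) :
    RingHom.ker (resF k F) = monJ k (LowerSet.Iic F) := by
  ext f
  rw [RingHom.mem_ker]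
  have h1 : resF k F f = 0 ↔ rho k F f = 0 := by
    rw [← rename_resF, map_eq_zero_iff _ (MvPolynomial.rename_injective _ Subtype.val_injective)]
  rw [h1, mem_monJ]
  constructor
  · intro h a ha
    have := coeff_rho k F f a
    rw [h, if_pos (show a.support ⊆ F from ha), MvPolynomial.coeff_zero] at this
    exact this.symm
  · intro h
    apply MvPolynomial.ext
    intro a
    rw [coeff_rho]
    split_ifs with ha
    · exact h a ha
    · rfl

theorem resF_surj (F : Finset (Fin n)) : Function.Surjective (resF k F) := by
  intro g
  refine ⟨MvPolynomial.rename Subtype.val g, ?_⟩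
  have : (resF k F).comp (MvPolynomial.rename (Subtype.val : F → Fin n)) = AlgHom.id k _ := by
    apply MvPolynomial.algHom_ext
    intro i
    rw [AlgHom.comp_apply, MvPolynomial.rename_X, resF, MvPolynomial.aeval_X, dif_pos i.2]
    rfl
  exact DFunLike.congr_fun this g

theorem dim_Iic (F : Finset (Fin n)) :
    ringKrullDim (MQ k (LowerSet.Iic F)) = (F.card : ℕ) := by
  have e : (MvPolynomial (Fin n) k ⧸ RingHom.ker (resF k F)) ≃+* MvPolynomial F k :=
    RingHom.quotientKerEquivOfSurjective (resF_surj k F)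
  rw [ker_resF] at e
  rw [ringKrullDim_eq_of_ringEquiv e, MvPolynomial.ringKrullDim_of_isNoetherianRing,
    ringKrullDim_eq_zero_of_field]
  simp

theorem dim_SR (Δ : SC n) :
    ringKrullDim (SRRing k Δ) = ((Δ.faces.sup Finset.card : ℕ) : WithBot ℕ∞) := by
  apply le_antisymm
  · have hI : srIdeal k Δ = Δ.faces.inf (fun F => monJ k (LowerSet.Iic F)) := by
      rw [srIdeal_eq]
      ext f
      rw [Submodule.mem_finsetInf]
      constructor
      · intro h F hF a ha
        exact h a (Δ.down_closed hF ha)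
      · intro h a ha
        exact h a.support ha a (le_refl a.support)
    rw [ringKrullDim_quotient, Order.krullDim]
    apply iSup_le
    intro p
    have h0 : Δ.faces.inf (fun F => monJ k (LowerSet.Iic F)) ≤ (p.head).1.asIdeal := by
      rw [← hI]; exact p.head.2
    obtain ⟨F, hF, hFp⟩ := (Ideal.IsPrime.inf_le' (p.head).1.isPrime).1 h0
    have h1 : ∀ i, (p i).1 ∈ PrimeSpectrum.zeroLocus (monJ k (LowerSet.Iic F) : Set (MvPolynomial (Fin n) k)) := by
      intro i
      exact hFp.trans (p.monotone (Fin.zero_le i))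
    let q : LTSeries (PrimeSpectrum.zeroLocus (monJ k (LowerSet.Iic F) : Set (MvPolynomial (Fin n) k))) :=
      { length := p.length
        toFun := fun i => ⟨(p i).1, h1 i⟩
        step := fun i => p.step i }
    have h2 : (q.length : WithBot ℕ∞) ≤ ringKrullDim (MQ k (LowerSet.Iic F)) := by
      rw [ringKrullDim_quotient]
      exact le_iSup (fun p : LTSeries _ => ((p.length : ℕ) : WithBot ℕ∞)) q
    rw [dim_Iic] at h2
    refine le_trans h2 ?_
    have h3 : F.card ≤ Δ.faces.sup Finset.card := Finset.le_sup (f := Finset.card) hF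
    exact_mod_cast h3
  · obtain ⟨F, hF, hFc⟩ := Finset.exists_mem_eq_sup Δ.faces ⟨∅, Δ.empty_mem⟩ Finset.card
    rw [hFc, ← dim_Iic k F]
    have hle : srIdeal k Δ ≤ monJ k (LowerSet.Iic F) := by
      rw [srIdeal_eq]
      intro f hf a ha
      exact hf a (Δ.down_closed hF ha)
    exact ringKrullDim_le_of_surjective (Ideal.Quotient.factor hle) (Ideal.Quotient.factor_surjective hle)

theorem dim_unique (Δ : SC n) (d : ℕ)
    (h : ringKrullDim (MvPolynomial (Fin n) k ⧸ srIdeal k Δ) = (d : WithBot (WithTop ℕ))) :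
    d = Δ.faces.sup Finset.card := by
  have h1 : ringKrullDim (MvPolynomial (Fin n) k ⧸ srIdeal k Δ) = (d : WithBot ℕ∞) := h
  have h2 := dim_SR k Δ
  rw [h1] at h2
  exact_mod_cast h2

end SRdim

open CategoryTheory

set_option linter.unusedVariables false

section Transport

variable (k : Type) [Field k] {n : ℕ}

theorem omega_desc_aux (L : LowerSet (Finset (Fin n))) (I : Ideal (MvPolynomial (Fin n) k))
    (m c : ℕ) (hI : I = monJ k (skel L (m + 2))) (h : (c + 1) + (m + 1) = n)
    (ω : Type) [AddCommGroup ω] [Module (MvPolynomial (Fin n) k) ω]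
    (e : ω ≃ₗ[MvPolynomial (Fin n) k] (extMod (MvPolynomial (Fin n) k) (MvPolynomial (Fin n) k ⧸ I)
          (MvPolynomial (Fin n) k) (c + 1))) :
    ∃ Ψ : ω →+ (Finset (Fin n) → MvPolynomial (Fin n) k),
      Function.Injective Ψ ∧
      (∀ (s : MvPolynomial (Fin n) k) (w : ω) F, Ψ (s • w) F = rho k F s * Ψ w F) ∧
      ∀ f, (∃ w, Ψ w = f) ↔
        ∀ a : Fin n →₀ ℕ, (fun F => (f F).coeff a) ∈ KK k L (m + 1) a.support := by
  subst hI
  obtain ⟨e2⟩ := extMod_equiv (S := MvPolynomial (Fin n) k) (MvPolynomial (Fin n) k ⧸ monJ k (skel L (m + 2)))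
    (MvPolynomial (Fin n) k) c
  let e3 : ω ≃ₗ[MvPolynomial (Fin n) k]
      XE (MvPolynomial (Fin n) k) (MQ k (skel L (m + 2))) (c + 1) := e.trans e2
  obtain ⟨Ψ, h1, h2, h3⟩ := ext_desc k L m (c + 1) h
  refine ⟨Ψ.comp e3.toLinearMap.toAddMonoidHom, ?_, ?_, ?_⟩
  · exact h1.comp e3.injective
  · intro s w F
    have : e3 (s • w) = s • e3 w := e3.map_smul s w
    have h4 := h2 s (e3 w) F
    rw [← this] at h4
    exact h4
  · intro f
    rw [← h3]
    constructor
    · rintro ⟨w, hw⟩; exact ⟨e3 w, hw⟩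
    · rintro ⟨w, hw⟩
      refine ⟨e3.symm w, ?_⟩
      rw [← hw]
      exact congrArg Ψ (e3.apply_symm_apply w)

theorem omega_desc (Δ : SC n) (ω : Type) [AddCommGroup ω] [Module (SRRing k Δ) ω]
    (hω : IsCanonicalModuleQ k (srIdeal k Δ) ω) (m : ℕ)
    (hm : Δ.faces.sup Finset.card = m + 1) (hn : m + 1 < n) :
    ∃ Ψ : ω →+ (Finset (Fin n) → MvPolynomial (Fin n) k),
      Function.Injective Ψ ∧
      (∀ (s : MvPolynomial (Fin n) k) (w : ω) F,
        Ψ (Ideal.Quotient.mk (srIdeal k Δ) s • w) F = rho k F s * Ψ w F) ∧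
      ∀ f, (∃ w, Ψ w = f) ↔
        ∀ a : Fin n →₀ ℕ, (fun F => (f F).coeff a) ∈ KK k Δ.low (m + 1) a.support := by
  obtain ⟨-, d, hd, ⟨e⟩⟩ := hω
  have hd' := dim_unique k Δ d hd
  obtain ⟨c, hc⟩ : ∃ c, n - d = c + 1 := ⟨n - d - 1, by omega⟩
  rw [hc] at e
  letI : Module (MvPolynomial (Fin n) k) ω := Module.compHom ω (Ideal.Quotient.mk (srIdeal k Δ))
  have hI : srIdeal k Δ = monJ k (skel Δ.low (m + 2)) := by
    rw [srIdeal_eq]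
    congr 1
    ext F
    constructor
    · intro h
      refine ⟨h, ?_⟩
      have : F.card ≤ Δ.faces.sup Finset.card := Finset.le_sup (f := Finset.card) h
      omega
    · intro h; exact h.1
  exact omega_desc_aux k Δ.low (srIdeal k Δ) m c hI (by omega) ω e

end Transport

open CategoryTheory

set_option linter.unusedVariables false

section Bd

variable (k : Type) [Field k] {n : ℕ}

/-- extension of a chain by zero -/
def extz (Δ : SC n) (σ : Finset (Fin n)) (c : ℕ) (y : Δ.relChain k σ c) (F : Finset (Fin n)) : k :=
  if h : F ∈ Δ.faces ∧ σ ⊆ F ∧ F.card = c then y ⟨F, h⟩ else 0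

theorem extz_val (Δ : SC n) (σ : Finset (Fin n)) (c : ℕ) (y : Δ.relChain k σ c) (F : Δ.RFace σ c) :
    extz k Δ σ c y F.1 = y F := dif_pos F.2

theorem erase_iff (τ ρ : Finset (Fin n)) (v : Fin n) :
    (v ∈ τ ∧ τ.erase v = ρ) ↔ (v ∉ ρ ∧ insert v ρ = τ) := by
  constructor
  · rintro ⟨h1, rfl⟩
    exact ⟨Finset.notMem_erase _ _, Finset.insert_erase h1⟩
  · rintro ⟨h1, rfl⟩
    exact ⟨Finset.mem_insert_self _ _, Finset.erase_insert h1⟩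

theorem relBMat_eq (Δ : SC n) (σ : Finset (Fin n)) (i : ℕ) (ρ : Δ.RFace σ i)
    (τ : Δ.RFace σ (i + 1)) :
    Δ.relBMat k σ i ρ τ = ∑ v ∈ ρ.1ᶜ, if insert v ρ.1 = τ.1 then sgk k v ρ.1 else 0 := by
  rw [SC.relBMat, ← Finset.sum_filter, ← Finset.sum_filter]
  have hs : τ.1.filter (fun v => v ∉ σ ∧ τ.1.erase v = ρ.1) =
      (ρ.1ᶜ).filter (fun v => insert v ρ.1 = τ.1) := by
    ext v
    rw [Finset.mem_filter, Finset.mem_filter, Finset.mem_compl, ← erase_iff]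
    constructor
    · rintro ⟨h1, _, h2⟩; exact ⟨h1, h2⟩
    · rintro ⟨h1, h2⟩
      refine ⟨h1, ?_, h2⟩
      intro hv
      have := ρ.2.2.1 hv
      rw [← h2] at this
      exact Finset.notMem_erase _ _ this
  rw [hs]
  apply Finset.sum_congr rfl
  intro v hv
  rw [Finset.mem_filter] at hv
  rw [sgk, ← hv.2, Finset.filter_insert, if_neg (lt_irrefl v)]

theorem bd_apply (Δ : SC n) (σ : Finset (Fin n)) (i : ℕ) (y : Δ.relChain k σ (i + 1))
    (ρ : Δ.RFace σ i) :
    Δ.relBoundary k σ i y ρ = ∑ v ∈ ρ.1ᶜ, sgk k v ρ.1 * extz k Δ σ (i + 1) y (insert v ρ.1) := by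
  rw [SC.relBoundary, Matrix.mulVecLin_apply]
  simp only [Matrix.mulVec, dotProduct, relBMat_eq, Finset.sum_mul]
  rw [Finset.sum_comm]
  apply Finset.sum_congr rfl
  intro v hv
  rw [Finset.mem_compl] at hv
  by_cases h : insert v ρ.1 ∈ Δ.faces
  · have hF : insert v ρ.1 ∈ Δ.faces ∧ σ ⊆ insert v ρ.1 ∧ (insert v ρ.1).card = i + 1 :=
      ⟨h, ρ.2.2.1.trans (Finset.subset_insert _ _), by
        rw [Finset.card_insert_of_notMem hv, ρ.2.2.2]⟩
    refine (Finset.sum_eq_single (⟨insert v ρ.1, hF⟩ : Δ.RFace σ (i + 1)) ?_ ?_).trans ?_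
    · intro τ _ hτ
      rw [if_neg, zero_mul]
      intro h'
      exact hτ (Subtype.ext h'.symm)
    · intro h'; exact absurd (Finset.mem_univ _) h'
    · refine Eq.trans (congrArg (· * _) (if_pos rfl)) ?_
      exact congrArg (sgk k v ρ.1 * ·) (extz_val k Δ σ (i + 1) y ⟨insert v ρ.1, hF⟩).symm
  · rw [extz, dif_neg (fun h' => h h'.1), mul_zero]
    apply Finset.sum_eq_zero
    intro τ _
    rw [if_neg, zero_mul]
    intro h'
    exact h (h' ▸ τ.2.1)

theorem extz_mem_KK (Δ : SC n) (σ : Finset (Fin n)) (m : ℕ) (y : Δ.relChain k σ (m + 1))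
    (hy : Δ.relBoundary k σ m y = 0) : extz k Δ σ (m + 1) y ∈ KK k Δ.low (m + 1) σ := by
  have hs : ∀ F, extz k Δ σ (m + 1) y F ≠ 0 → F ∈ Δ.faces ∧ σ ⊆ F ∧ F.card = m + 1 := by
    intro F hF
    by_contra h
    exact hF (dif_neg h)
  refine ⟨fun F hF => ⟨(hs F hF).1, (hs F hF).2.2, (hs F hF).2.1⟩, ?_⟩
  intro G hG hGc
  by_cases hGf : G ∈ Δ.faces
  · have := bd_apply k Δ σ m y ⟨G, hGf, hG, by omega⟩
    rw [hy] at this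
    exact this.symm
  · apply Finset.sum_eq_zero
    intro v _
    rw [extz, dif_neg, mul_zero]
    intro h
    exact hGf (Δ.down_closed h.1 (Finset.subset_insert _ _))

/-- cycles as functions on all finsets -/
noncomputable def kerEquiv (Δ : SC n) (σ : Finset (Fin n)) (m : ℕ) :
    LinearMap.ker (Δ.relBoundary k σ m) ≃ₗ[k] KK k Δ.low (m + 1) σ where
  toFun y := ⟨extz k Δ σ (m + 1) y.1, extz_mem_KK k Δ σ m y.1 y.2⟩
  map_add' x y := by
    apply Subtype.ext
    funext F
    change extz k Δ σ (m + 1) (x.1 + y.1) F = extz k Δ σ (m + 1) x.1 F + extz k Δ σ (m + 1) y.1 F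
    unfold extz
    split_ifs
    · rfl
    · rw [add_zero]
  map_smul' c y := by
    apply Subtype.ext
    funext F
    change extz k Δ σ (m + 1) (c • y.1) F = c * extz k Δ σ (m + 1) y.1 F
    unfold extz
    split_ifs
    · rfl
    · rw [mul_zero]
  invFun z := ⟨fun F => z.1 F.1, by
    rw [LinearMap.mem_ker]
    funext ρ
    rw [bd_apply, Pi.zero_apply, ← z.2.2 ρ.1 ρ.2.2.1 (by rw [ρ.2.2.2])]
    apply Finset.sum_congr rfl
    intro v _
    congr 1
    unfold extz
    split_ifs with h
    · rfl
    · by_contra h'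
      obtain ⟨h1, h2, h3⟩ := z.2.1 _ (Ne.symm h')
      exact h ⟨h1, h3, h2⟩⟩
  left_inv y := by
    apply Subtype.ext
    funext F
    exact extz_val k Δ σ (m + 1) y.1 F
  right_inv z := by
    apply Subtype.ext
    funext F
    change extz k Δ σ (m + 1) _ F = z.1 F
    unfold extz
    split_ifs with h
    · rfl
    · by_contra h'
      obtain ⟨h1, h2, h3⟩ := z.2.1 _ (Ne.symm h')
      exact h ⟨h1, h3, h2⟩

theorem RFace_empty (Δ : SC n) (σ : Finset (Fin n)) (m : ℕ)
    (hm : Δ.faces.sup Finset.card ≤ m) : IsEmpty (Δ.RFace σ (m + 1)) := by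
  constructor
  intro F
  have h1 : F.1.card ≤ Δ.faces.sup Finset.card := Finset.le_sup (f := Finset.card) F.2.1
  have := F.2.2.2
  omega

theorem range_bot (Δ : SC n) (σ : Finset (Fin n)) (m : ℕ)
    (hm : Δ.faces.sup Finset.card ≤ m) : LinearMap.range (Δ.relBoundary k σ m) = ⊥ := by
  have := RFace_empty Δ σ m hm
  rw [LinearMap.range_eq_bot]
  apply LinearMap.ext
  intro x
  rw [Subsingleton.elim x 0, map_zero, map_zero]

theorem relHom_equiv (Δ : SC n) (σ : Finset (Fin n)) (m : ℕ)
    (hm : Δ.faces.sup Finset.card = m + 1) :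
    Nonempty (Δ.relHomology k σ m ≃ₗ[k] KK k Δ.low (m + 1) σ) := by
  have h : Submodule.comap (LinearMap.ker (Δ.relBoundary k σ m)).subtype
      (LinearMap.range (Δ.relBoundary k σ (m + 1))) = ⊥ := by
    rw [range_bot k Δ σ (m + 1) hm.le]
    rw [eq_bot_iff]
    intro x hx
    exact Subtype.ext hx
  exact ⟨(Submodule.quotEquivOfEqBot _ h).trans (kerEquiv k Δ σ m)⟩

/-- non-orientability -/
theorem KK_empty_eq_zero (Δ : SC n) (m : ℕ) (hm : Δ.faces.sup Finset.card = m + 1) (hm0 : m ≠ 0)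
    (hno : ¬ Δ.Orientable k) (z) (hz : z ∈ KK k Δ.low (m + 1) ∅) : z = 0 := by
  by_contra hz0
  apply hno
  refine ⟨m, by rw [SC.dim, hm]; push_cast; ring, ?_⟩
  have h : Submodule.comap (Δ.cyclesUnred k m).subtype
      (LinearMap.range (Δ.relBoundary k ∅ (m + 1))) = ⊥ := by
    rw [range_bot k Δ ∅ (m + 1) hm.le]
    rw [eq_bot_iff]
    intro x hx
    exact Subtype.ext hx
  have e : Δ.homologyUnred k m ≃ₗ[k] Δ.cyclesUnred k m := Submodule.quotEquivOfEqBot _ h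
  have hc : Δ.cyclesUnred k m = LinearMap.ker (Δ.relBoundary k ∅ m) := by
    rw [SC.cyclesUnred, if_neg hm0]
  rw [hc] at e
  have e2 := e.trans (kerEquiv k Δ ∅ m)
  have : Nontrivial (KK k Δ.low (m + 1) ∅) :=
    ⟨⟨⟨z, hz⟩, 0, fun h => hz0 (congrArg Subtype.val h)⟩⟩
  exact e2.toEquiv.nontrivial

theorem two_le (Δ : SC n) (v : Fin n) (hv : Δ.IsVertex v) (hno : ¬ Δ.Orientable k) :
    ∃ m, m ≠ 0 ∧ Δ.faces.sup Finset.card = m + 1 := by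
  have h1 : ({v} : Finset (Fin n)).card ≤ Δ.faces.sup Finset.card := Finset.le_sup (f := Finset.card) hv
  rw [Finset.card_singleton] at h1
  refine ⟨Δ.faces.sup Finset.card - 1, ?_, by omega⟩
  intro h0
  have h2 : Δ.faces.sup Finset.card = 0 + 1 := by omega
  apply hno
  refine ⟨0, by rw [SC.dim, h2]; norm_num, ?_⟩
  have h : Submodule.comap (Δ.cyclesUnred k 0).subtype
      (LinearMap.range (Δ.relBoundary k ∅ (0 + 1))) = ⊥ := by
    rw [range_bot k Δ ∅ (0 + 1) h2.le]
    rw [eq_bot_iff]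
    intro x hx
    exact Subtype.ext hx
  have e : Δ.homologyUnred k 0 ≃ₗ[k] Δ.cyclesUnred k 0 := Submodule.quotEquivOfEqBot _ h
  have hc : Δ.cyclesUnred k 0 = ⊤ := by
    rw [SC.cyclesUnred, if_pos rfl]
  rw [hc] at e
  have e2 := e.trans Submodule.topEquiv
  have : Nontrivial (Δ.relChain k ∅ (0 + 1)) := by
    have : Nonempty (Δ.RFace ∅ (0 + 1)) := ⟨⟨{v}, hv, by simp, by simp⟩⟩
    infer_instance
  exact e2.toEquiv.nontrivial

end Bd

open CategoryTheory

set_option linter.unusedVariables false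

section Conn

variable (k : Type) [Field k] {n : ℕ}

theorem sgk_sq (v : Fin n) (G : Finset (Fin n)) : sgk k v G * sgk k v G = 1 := by
  rw [sgk, ← pow_add, ← two_mul, pow_mul]; simp

theorem sgk_ne (v : Fin n) (G : Finset (Fin n)) : sgk k v G ≠ 0 := by
  intro h
  have := sgk_sq k v G
  rw [h, zero_mul] at this
  exact zero_ne_one this

theorem ker_le_range (Γ : SC n) (i : ℕ) [Subsingleton (Γ.reducedHomology k i)]
    (y : Γ.relChain k ∅ (i + 1)) (hy : Γ.relBoundary k ∅ i y = 0) :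
    ∃ w, Γ.relBoundary k ∅ (i + 1) w = y := by
  have h1 : (Submodule.Quotient.mk ⟨y, hy⟩ : LinearMap.ker (Γ.relBoundary k ∅ i) ⧸
      Submodule.comap (LinearMap.ker (Γ.relBoundary k ∅ i)).subtype
      (LinearMap.range (Γ.relBoundary k ∅ (i + 1)))) = 0 :=
    Subsingleton.elim (α := Γ.reducedHomology k i) _ _
  have h2 := (Submodule.Quotient.mk_eq_zero _).1 h1
  exact h2

theorem conn_of_H0 (Γ : SC n) [Subsingleton (Γ.reducedHomology k 0)] (P : Fin n → Prop)
    (hP : ∀ a b, a ≠ b → ({a, b} : Finset (Fin n)) ∈ Γ.faces → (P a ↔ P b)) (u v : Fin n)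
    (hu : Γ.IsVertex u) (hv : Γ.IsVertex v) : P u ↔ P v := by
  classical
  by_cases huv : u = v
  · rw [huv]
  let y : Γ.relChain k ∅ (0 + 1) := fun F => if F.1 = {u} then 1 else if F.1 = {v} then -1 else 0
  have hyv : ∀ a : Fin n, extz k Γ ∅ 1 y {a} = (if a = u then (1:k) else 0) - (if a = v then 1 else 0) := by
    intro a
    by_cases h1 : a = u
    · subst h1
      rw [extz, dif_pos ⟨hu, by simp, by simp⟩]
      simp [y, huv]
    · by_cases h2 : a = v
      · subst h2
        rw [extz, dif_pos ⟨hv, by simp, by simp⟩]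
        simp [y, h1]
      · rw [if_neg h1, if_neg h2, sub_zero, extz]
        split_ifs with h
        · simp [y, h1, h2]
        · rfl
  have hy : Γ.relBoundary k ∅ 0 y = 0 := by
    funext ρ
    rw [bd_apply]
    have hρ : ρ.1 = ∅ := Finset.card_eq_zero.1 ρ.2.2.2
    rw [hρ]
    have : ∀ w ∈ (∅ : Finset (Fin n))ᶜ, sgk k w ∅ * extz k Γ ∅ (0 + 1) y (insert w ∅) =
        (if w = u then (1:k) else 0) - (if w = v then 1 else 0) := by
      intro w _
      have h1 : sgk k w (∅ : Finset (Fin n)) = 1 := by simp [sgk]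
      rw [h1, one_mul]
      exact hyv w
    rw [Finset.sum_congr rfl this, Finset.sum_sub_distrib]
    simp
  obtain ⟨w, hw⟩ := ker_le_range k Γ 0 y hy
  have hb : ∀ a : Fin n, extz k Γ ∅ 1 y {a} =
      ∑ b, if a = b then 0 else sgk k b {a} * extz k Γ ∅ 2 w {b, a} := by
    intro a
    by_cases ha : ({a} : Finset (Fin n)) ∈ Γ.faces
    · rw [← hw]
      have := bd_apply k Γ ∅ 1 w ⟨{a}, ha, by simp, by simp⟩
      refine (extz_val k Γ ∅ 1 _ ⟨{a}, ha, by simp, by simp⟩).trans (this.trans ?_)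
      rw [← Finset.sum_filter_add_sum_filter_not Finset.univ (fun b => a = b)]
      rw [Finset.sum_eq_zero (s := Finset.univ.filter (fun b => a = b)), zero_add]
      · refine Finset.sum_congr ?_ ?_
        · ext b; simp [eq_comm]
        · intro b hb
          have : ¬ a = b := (Finset.mem_filter.1 hb).2
          rw [if_neg this]
      · intro b hb
        rw [if_pos (Finset.mem_filter.1 hb).2]
    · rw [extz, dif_neg (fun h => ha h.1), Finset.sum_eq_zero]
      intro b _
      split_ifs
      · rfl
      · rw [extz, dif_neg, mul_zero]
        intro h
        exact ha (Γ.down_closed h.1 (by simp))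
  let χ : Fin n → k := fun a => if P a then 1 else 0
  have hS : ∑ a, χ a * extz k Γ ∅ 1 y {a} = 0 := by
    simp only [hb, Finset.mul_sum]
    rw [← Finset.sum_product']
    apply Finset.sum_involution (fun p _ => (p.2, p.1))
    · rintro ⟨a, b⟩ _
      simp only
      by_cases hab : a = b
      · simp [hab]
      · rw [if_neg hab, if_neg (Ne.symm hab)]
        by_cases hf : ({a, b} : Finset (Fin n)) ∈ Γ.faces
        · have : χ a = χ b := by simp only [χ, hP a b hab hf]
          rw [this, Finset.pair_comm b a, ← mul_add, ← add_mul]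
          have : sgk k b {a} + sgk k a {b} = 0 := by
            unfold sgk
            rcases lt_or_gt_of_ne hab with h | h
            · simp [Finset.filter_singleton, h, not_lt.2 h.le]
            · simp [Finset.filter_singleton, h, not_lt.2 h.le]
          rw [this]; ring
        · have h2 : extz k Γ ∅ 2 w {a, b} = 0 := dif_neg (fun h => hf h.1)
          rw [Finset.pair_comm b a, h2]; ring
    · rintro ⟨a, b⟩ _ h h'
      simp only [Prod.mk.injEq] at h'
      apply h
      rw [if_pos h'.2, mul_zero]
    · intros; simp
    · intros; rfl
  simp only [hyv, mul_sub, Finset.sum_sub_distrib] at hS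
  simp only [mul_ite, mul_one, mul_zero, Finset.sum_ite_eq', Finset.mem_univ, if_true] at hS
  simp only [χ] at hS
  by_cases h1 : P u <;> by_cases h2 : P v <;> simp [h1, h2] at hS ⊢

theorem SC.exists_facet (Δ : SC n) (σ) (hσ : σ ∈ Δ.faces) : ∃ F, Δ.IsFacet F ∧ σ ⊆ F := by
  obtain ⟨F, h1, h2⟩ := Finset.exists_le_maximal Δ.faces hσ
  exact ⟨F, ⟨h2.1, fun τ hτ h => le_antisymm h (h2.2 hτ h)⟩, h1⟩

theorem SC.mem_link (Δ : SC n) (σ) (hσ : σ ∈ Δ.faces) (τ) :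
    τ ∈ (Δ.link σ hσ).faces ↔ τ ∩ σ = ∅ ∧ τ ∪ σ ∈ Δ.faces := by
  unfold SC.link
  simp only [Finset.mem_filter]
  exact ⟨fun h => h.2, fun h => ⟨Δ.down_closed h.2 Finset.subset_union_left, h⟩⟩

theorem SC.sdiff_mem_link (Δ : SC n) (σ) (hσ : σ ∈ Δ.faces) (F) (hF : F ∈ Δ.faces) (h : σ ⊆ F) :
    F \ σ ∈ (Δ.link σ hσ).faces := by
  rw [SC.mem_link]
  refine ⟨by simp, ?_⟩
  rw [Finset.sdiff_union_of_subset h]; exact hF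

theorem SC.link_pair (Δ : SC n) (σ) (hσ : σ ∈ Δ.faces) (a b : Fin n)
    (h : ({a, b} : Finset (Fin n)) ∈ (Δ.link σ hσ).faces) : insert a (insert b σ) ∈ Δ.faces ∧
      a ∉ σ ∧ b ∉ σ := by
  rw [SC.mem_link] at h
  refine ⟨?_, ?_, ?_⟩
  · convert h.2 using 1
    ext; simp
  · intro ha
    have : a ∈ ({a, b} : Finset (Fin n)) ∩ σ := by simp [ha]
    rw [h.1] at this; simp at this
  · intro ha
    have : b ∈ ({a, b} : Finset (Fin n)) ∩ σ := by simp [ha]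
    rw [h.1] at this; simp at this

theorem color_const {α : Type} (Δ : SC n) (hHM : Δ.IsHomologyManifold k) (σ₀ : Finset (Fin n))
    (c : Finset (Fin n) → α)
    (h1 : ∀ σ (hσ : σ ∈ Δ.faces), σ ≠ ∅ → σ₀ ⊆ σ → (Δ.link σ hσ).faces.sup Finset.card = 1 →
      ∀ F F', Δ.IsFacet F → Δ.IsFacet F' → σ ⊆ F → σ ⊆ F' → c F = c F') :
    ∀ N σ, n ≤ N + σ.card → σ ∈ Δ.faces → σ ≠ ∅ → σ₀ ⊆ σ →
      ∀ F F', Δ.IsFacet F → Δ.IsFacet F' → σ ⊆ F → σ ⊆ F' → c F = c F' := by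
  intro N
  induction N with
  | zero =>
    intro σ hn hσ hne h0 F F' hF hF' hs hs'
    have : σ = Finset.univ := by
      rw [← Finset.card_eq_iff_eq_univ, Fintype.card_fin]
      have := Finset.card_le_univ σ
      rw [Fintype.card_fin] at this
      omega
    subst this
    rw [Finset.univ_subset_iff.1 hs, Finset.univ_subset_iff.1 hs']
  | succ N ih =>
    intro σ hn hσ hne h0 F F' hF hF' hs hs'
    by_cases hs1 : (Δ.link σ hσ).faces.sup Finset.card = 1
    · exact h1 σ hσ hne h0 hs1 F F' hF hF' hs hs'
    by_cases hFe : F = σ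
    · subst hFe
      rw [hF.2 F' hF'.1 hs']
    by_cases hFe' : F' = σ
    · subst hFe'
      rw [hF'.2 F hF.1 hs]
    obtain ⟨u, hu, huσ⟩ := Finset.exists_of_ssubset (lt_of_le_of_ne hs (Ne.symm hFe))
    obtain ⟨u', hu', huσ'⟩ := Finset.exists_of_ssubset (lt_of_le_of_ne hs' (Ne.symm hFe'))
    have key : ∀ v, v ∉ σ → insert v σ ∈ Δ.faces → ∀ G G', Δ.IsFacet G → Δ.IsFacet G' →
        insert v σ ⊆ G → insert v σ ⊆ G' → c G = c G' := by
      intro v hv hvf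
      apply ih _ _ hvf (Finset.insert_ne_empty _ _) (h0.trans (Finset.subset_insert _ _))
      rw [Finset.card_insert_of_notMem hv]; omega
    have hul : ∀ w, w ∉ σ → insert w σ ∈ Δ.faces → (Δ.link σ hσ).IsVertex w := by
      intro w hw hwf
      rw [SC.IsVertex, SC.mem_link]
      refine ⟨by simp [hw], by simpa [Finset.singleton_union] using hwf⟩
    have hiu : insert u σ ⊆ F := Finset.insert_subset hu hs
    have hiu' : insert u' σ ⊆ F' := Finset.insert_subset hu' hs'
    have hvu := hul u huσ (Δ.down_closed hF.1 hiu)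
    have hvu' := hul u' huσ' (Δ.down_closed hF'.1 hiu')
    have hge : 1 ≤ (Δ.link σ hσ).faces.sup Finset.card := by
      have := Finset.le_sup (f := Finset.card) hvu
      simpa using this
    have : Subsingleton ((Δ.link σ hσ).reducedHomology k 0) := by
      apply ((hHM.2 σ hσ hne).1 0).2
      rw [SC.dim]
      push_cast
      omega
    let P : Fin n → Prop := fun v => ∀ G, Δ.IsFacet G → insert v σ ⊆ G → c G = c F
    have hstep : ∀ a b, insert a (insert b σ) ∈ Δ.faces → a ∉ σ → b ∉ σ → P a → P b := by
      intro a b hab ha hb hPa G hG hbG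
      obtain ⟨G0, hG0, hG0s⟩ := Δ.exists_facet _ hab
      have h2 : insert b σ ⊆ G0 := (Finset.subset_insert _ _).trans hG0s
      have h3 : insert a σ ⊆ G0 := (Finset.insert_subset_insert a (Finset.subset_insert _ _)).trans hG0s
      rw [key b hb (Δ.down_closed hG.1 hbG) G G0 hG hG0 hbG h2]
      exact hPa G0 hG0 h3
    have hP := conn_of_H0 k (Δ.link σ hσ) P (by
      intro a b _ hab
      obtain ⟨h2, h3, h4⟩ := Δ.link_pair σ hσ a b hab
      exact ⟨hstep a b h2 h3 h4, hstep b a (by rw [Finset.insert_comm]; exact h2) h4 h3⟩) u u' hvu hvu'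
    have hPu : P u := by
      intro G hG hGs
      exact key u huσ (Δ.down_closed hF.1 hiu) G F hG hF hGs hiu
    exact ((hP.1 hPu) F' hF' hiu').symm

theorem color_const_all {α : Type} (Δ : SC n) (hHM : Δ.IsHomologyManifold k)
    (hvert : ∀ v : Fin n, Δ.IsVertex v)
    (c : Finset (Fin n) → α)
    (h1 : ∀ σ (hσ : σ ∈ Δ.faces), σ ≠ ∅ → (Δ.link σ hσ).faces.sup Finset.card = 1 →
      ∀ F F', Δ.IsFacet F → Δ.IsFacet F' → σ ⊆ F → σ ⊆ F' → c F = c F') :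
    ∀ F F', Δ.IsFacet F → Δ.IsFacet F' → c F = c F' := by
  intro F F' hF hF'
  have hne : ∀ G, Δ.IsFacet G → ∃ v, v ∈ G := by
    intro G hG
    obtain ⟨v, hv⟩ := hHM.1.1
    by_contra h
    have : G = ∅ := by
      rw [Finset.eq_empty_iff_forall_notMem]; intro x hx; exact h ⟨x, hx⟩
    have h2 := hG.2 _ hv (by rw [this]; simp)
    rw [this] at h2
    exact absurd h2.symm (Finset.singleton_ne_empty v)
  have key : ∀ v, ∀ G G', Δ.IsFacet G → Δ.IsFacet G' → v ∈ G → v ∈ G' → c G = c G' := by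
    intro v G G' hG hG' hv hv'
    exact color_const k Δ hHM ∅ c (fun σ hσ hn _ => h1 σ hσ hn) n {v} (by omega) (hvert v)
      (Finset.singleton_ne_empty v) (by simp) G G' hG hG' (by simpa using hv) (by simpa using hv')
  obtain ⟨u, hu⟩ := hne F hF
  obtain ⟨u', hu'⟩ := hne F' hF'
  have hc := hHM.1.2 u u' (hvert u) (hvert u')
  have : ∀ G, Δ.IsFacet G → u' ∈ G → c F = c G := by
    clear hu' hF' F'
    induction hc with
    | refl => intro G hG hGu; exact key u F G hF hG hu hGu
    | @tail a b _ hab ih =>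
      intro G hG hbG
      obtain ⟨G0, hG0, hG0s⟩ := Δ.exists_facet _ hab
      rw [ih G0 hG0 (hG0s (by simp))]
      exact key b G0 G hG0 hG (hG0s (by simp)) hbG
  exact this F' hF' hu'

theorem purity (Δ : SC n) (hHM : Δ.IsHomologyManifold k)
    (hvert : ∀ v : Fin n, Δ.IsVertex v) (F) (hF : Δ.IsFacet F) :
    F.card = Δ.faces.sup Finset.card := by
  have hall := color_const_all k Δ hHM hvert Finset.card (by
    have : ∀ σ (hσ : σ ∈ Δ.faces), (Δ.link σ hσ).faces.sup Finset.card = 1 →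
      ∀ F, Δ.IsFacet F → σ ⊆ F → F.card = σ.card + 1 := by
      intro σ hσ h1 F hF hs
      have h2 : (F \ σ).card ≤ _ := Finset.le_sup (f := Finset.card) (Δ.sdiff_mem_link σ hσ F hF.1 hs)
      rw [h1, Finset.card_sdiff_of_subset hs] at h2
      have h3 := Finset.card_le_card hs
      have h4 : F ≠ σ := by
        rintro rfl
        have : (Δ.link F hσ).faces.sup Finset.card = 0 := by
          rw [← Nat.le_zero]
          apply Finset.sup_le
          intro τ hτ
          rw [SC.mem_link] at hτ
          have := hF.2 _ hτ.2 Finset.subset_union_right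
          have h5 : τ ⊆ F := by rw [this]; exact Finset.subset_union_left
          rw [Finset.inter_eq_left.2 h5] at hτ
          rw [hτ.1]; simp
        omega
      have h5 : F.card ≠ σ.card := fun h => h4 (Finset.eq_of_subset_of_card_le hs h.le).symm
      omega
    intro σ hσ _ h1 F F' hF hF' hs hs'
    rw [this σ hσ h1 F hF hs, this σ hσ h1 F' hF' hs'])
  obtain ⟨τ, hτ, hτc⟩ := Finset.exists_mem_eq_sup Δ.faces ⟨∅, Δ.empty_mem⟩ Finset.card
  obtain ⟨G, hG, hGs⟩ := Δ.exists_facet τ hτ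
  rw [hall F G hF hG]
  apply le_antisymm (Finset.le_sup (f := Finset.card) hG.1)
  rw [hτc]; exact Finset.card_le_card hGs

theorem facet_iff (Δ : SC n) (hHM : Δ.IsHomologyManifold k)
    (hvert : ∀ v : Fin n, Δ.IsVertex v) (F) :
    Δ.IsFacet F ↔ F ∈ Δ.faces ∧ F.card = Δ.faces.sup Finset.card := by
  constructor
  · intro h; exact ⟨h.1, purity k Δ hHM hvert F h⟩
  · rintro ⟨h1, h2⟩
    refine ⟨h1, fun τ hτ hs => Finset.eq_of_subset_of_card_le hs ?_⟩
    rw [h2]; exact Finset.le_sup (f := Finset.card) hτ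

theorem link_sup (Δ : SC n) (hHM : Δ.IsHomologyManifold k)
    (hvert : ∀ v : Fin n, Δ.IsVertex v) (σ) (hσ : σ ∈ Δ.faces) :
    (Δ.link σ hσ).faces.sup Finset.card + σ.card = Δ.faces.sup Finset.card := by
  apply le_antisymm
  · obtain ⟨τ, hτ, hτc⟩ := Finset.exists_mem_eq_sup (Δ.link σ hσ).faces ⟨∅, (Δ.link σ hσ).empty_mem⟩ Finset.card
    rw [hτc]
    rw [SC.mem_link] at hτ
    rw [← Finset.card_union_of_disjoint (Finset.disjoint_iff_inter_eq_empty.2 hτ.1)]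
    exact Finset.le_sup (f := Finset.card) hτ.2
  · obtain ⟨F, hF, hs⟩ := Δ.exists_facet σ hσ
    rw [← purity k Δ hHM hvert F hF]
    have h2 : (F \ σ).card ≤ _ := Finset.le_sup (f := Finset.card) (Δ.sdiff_mem_link σ hσ F hF.1 hs)
    rw [Finset.card_sdiff_of_subset hs] at h2
    omega

end Conn

open CategoryTheory

set_option linter.unusedVariables false

section Twist

variable (k : Type) [Field k] {n : ℕ}

/-- sign twist -/
def eta (σ τ : Finset (Fin n)) : k := ∏ v ∈ τ, sgk k v σ

theorem eta_sq (σ τ : Finset (Fin n)) : eta k σ τ * eta k σ τ = 1 := by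
  rw [eta, ← Finset.prod_mul_distrib]
  exact Finset.prod_eq_one (fun v _ => sgk_sq k v σ)

theorem eta_ne (σ τ : Finset (Fin n)) : eta k σ τ ≠ 0 := by
  intro h
  have := eta_sq k σ τ
  rw [h, zero_mul] at this
  exact zero_ne_one this

theorem eta_insert (σ τ : Finset (Fin n)) (v) (hv : v ∉ τ) :
    eta k σ (insert v τ) = sgk k v σ * eta k σ τ := by
  rw [eta, Finset.prod_insert hv]; rfl

theorem sgk_union (σ g : Finset (Fin n)) (v) (h : Disjoint g σ) :
    sgk k v (g ∪ σ) = sgk k v g * sgk k v σ := by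
  rw [sgk, sgk, sgk, ← pow_add, Finset.filter_union, Finset.card_union_of_disjoint]
  exact Finset.disjoint_filter_filter h

/-- from the link to the star -/
def twUp (σ : Finset (Fin n)) (z : Finset (Fin n) → k) (F : Finset (Fin n)) : k :=
  if σ ⊆ F then eta k σ (F \ σ) * z (F \ σ) else 0

/-- from the star to the link -/
def twDown (σ : Finset (Fin n)) (z : Finset (Fin n) → k) (τ : Finset (Fin n)) : k :=
  if τ ∩ σ = ∅ then eta k σ τ * z (τ ∪ σ) else 0

theorem twUp_mem (Δ : SC n) (σ) (hσ : σ ∈ Δ.faces) (i) (z)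
    (hz : z ∈ KK k (Δ.link σ hσ).low i ∅) : twUp k σ z ∈ KK k Δ.low (i + σ.card) σ := by
  obtain ⟨h1, h2⟩ := hz
  refine ⟨?_, ?_⟩
  · intro F hF
    unfold twUp at hF
    split_ifs at hF with hs
    · obtain ⟨h3, h4, _⟩ := h1 _ (right_ne_zero_of_mul hF)
      have h5 := ((Δ.mem_link σ hσ _).1 h3).2
      rw [Finset.sdiff_union_of_subset hs] at h5
      refine ⟨h5, ?_, hs⟩
      rw [Finset.card_sdiff_of_subset hs] at h4
      have := Finset.card_le_card hs
      omega
    · exact absurd rfl hF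
  · intro G hG hGc
    have hd : Disjoint (G \ σ) σ := Finset.sdiff_disjoint
    have h3 := h2 (G \ σ) (by simp) (by
      rw [Finset.card_sdiff_of_subset hG]
      have := Finset.card_le_card hG
      omega)
    have h4 : (G \ σ)ᶜ = Gᶜ ∪ σ := by ext x; simp only [Finset.mem_compl, Finset.mem_sdiff, Finset.mem_union]; tauto
    rw [h4, Finset.sum_union (Finset.disjoint_left.2 (fun x hx hx' => (Finset.mem_compl.1 hx) (hG hx')))] at h3
    rw [Finset.sum_eq_zero (s := σ), add_zero] at h3
    · rw [← mul_zero (eta k σ (G \ σ)), ← h3, Finset.mul_sum]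
      apply Finset.sum_congr rfl
      intro v hv
      rw [Finset.mem_compl] at hv
      have hvσ : v ∉ σ := fun h => hv (hG h)
      rw [twUp, if_pos (hG.trans (Finset.subset_insert _ _)), Finset.insert_sdiff_of_notMem _ hvσ,
        eta_insert k σ _ v (fun h => hv (Finset.mem_sdiff.1 h).1)]
      have h5 : sgk k v G = sgk k v (G \ σ) * sgk k v σ := by
        rw [← sgk_union k σ _ v hd, Finset.sdiff_union_of_subset hG]
      rw [h5]
      linear_combination (sgk k v (G \ σ) * eta k σ (G \ σ) * z (insert v (G \ σ))) * sgk_sq k v σ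
    · intro v hv
      have : z (insert v (G \ σ)) = 0 := by
        by_contra h
        have h5 := ((Δ.mem_link σ hσ _).1 (h1 _ h).1).1
        have h6 : v ∈ insert v (G \ σ) ∩ σ := by simp [hv]
        rw [h5] at h6
        simp at h6
      rw [this, mul_zero]

theorem twDown_mem (Δ : SC n) (σ) (hσ : σ ∈ Δ.faces) (i) (z)
    (hz : z ∈ KK k Δ.low (i + σ.card) σ) : twDown k σ z ∈ KK k (Δ.link σ hσ).low i ∅ := by
  obtain ⟨h1, h2⟩ := hz
  refine ⟨?_, ?_⟩
  · intro τ hτ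
    unfold twDown at hτ
    split_ifs at hτ with hs
    · obtain ⟨h3, h4, _⟩ := h1 _ (right_ne_zero_of_mul hτ)
      refine ⟨(Δ.mem_link σ hσ _).2 ⟨hs, h3⟩, ?_, by simp⟩
      rw [Finset.card_union_of_disjoint (Finset.disjoint_iff_inter_eq_empty.2 hs)] at h4
      omega
    · exact absurd rfl hτ
  · intro g _ hgc
    by_cases hg : g ∩ σ = ∅
    · have hd := Finset.disjoint_iff_inter_eq_empty.2 hg
      have h3 := h2 (g ∪ σ) Finset.subset_union_right (by
        rw [Finset.card_union_of_disjoint hd]; omega)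
      have h4 : gᶜ = (g ∪ σ)ᶜ ∪ σ := by
        ext x
        simp only [Finset.mem_compl, Finset.mem_union]
        have : x ∈ g → x ∉ σ := fun hx => Finset.disjoint_left.1 hd hx
        tauto
      rw [h4, Finset.sum_union (Finset.disjoint_left.2 (fun x hx hx' =>
        (Finset.mem_compl.1 hx) (Finset.mem_union_right _ hx')))]
      rw [Finset.sum_eq_zero (s := σ), add_zero]
      · rw [← mul_zero (eta k σ g), ← h3, Finset.mul_sum]
        apply Finset.sum_congr rfl
        intro v hv
        rw [Finset.mem_compl, Finset.mem_union] at hv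
        push Not at hv
        rw [twDown, if_pos (by rw [Finset.insert_inter_of_notMem hv.2, hg]), eta_insert k σ _ v hv.1,
          sgk_union k σ g v hd, Finset.insert_union]
        ring
      · intro v hv
        rw [twDown, if_neg, mul_zero]
        intro h
        have h6 : v ∈ insert v g ∩ σ := by simp [hv]
        rw [h] at h6
        simp at h6
    · apply Finset.sum_eq_zero
      intro v _
      rw [twDown, if_neg, mul_zero]
      intro h
      apply hg
      rw [← Finset.subset_empty, ← h]
      exact Finset.inter_subset_inter (Finset.subset_insert _ _) le_rfl

/-- the twist equivalence -/
def twEquiv (Δ : SC n) (σ) (hσ : σ ∈ Δ.faces) (i) :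
    KK k (Δ.link σ hσ).low i ∅ ≃ₗ[k] KK k Δ.low (i + σ.card) σ where
  toFun z := ⟨twUp k σ z.1, twUp_mem k Δ σ hσ i z.1 z.2⟩
  invFun z := ⟨twDown k σ z.1, twDown_mem k Δ σ hσ i z.1 z.2⟩
  map_add' x y := by
    apply Subtype.ext
    funext F
    change twUp k σ (x.1 + y.1) F = twUp k σ x.1 F + twUp k σ y.1 F
    unfold twUp
    split_ifs
    · rw [Pi.add_apply]; ring
    · rw [add_zero]
  map_smul' c x := by
    apply Subtype.ext
    funext F
    change twUp k σ (c • x.1) F = c * twUp k σ x.1 F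
    unfold twUp
    split_ifs
    · rw [Pi.smul_apply, smul_eq_mul]; ring
    · rw [mul_zero]
  left_inv z := by
    apply Subtype.ext
    funext τ
    change twDown k σ (twUp k σ z.1) τ = z.1 τ
    unfold twDown
    split_ifs with h
    · have hd := Finset.disjoint_iff_inter_eq_empty.2 h
      rw [twUp, if_pos Finset.subset_union_right, Finset.union_sdiff_cancel_right hd, ← mul_assoc,
        eta_sq, one_mul]
    · by_contra h'
      exact h ((Δ.mem_link σ hσ τ).1 (z.2.1 τ (Ne.symm h')).1).1
  right_inv z := by
    apply Subtype.ext
    funext F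
    change twUp k σ (twDown k σ z.1) F = z.1 F
    unfold twUp
    split_ifs with h
    · rw [twDown, if_pos (by simp), Finset.sdiff_union_of_subset h, ← mul_assoc,
        eta_sq, one_mul]
    · by_contra h'
      exact h (z.2.1 F (Ne.symm h')).2.2

theorem KK_gen (Δ : SC n) (hHM : Δ.IsHomologyManifold k)
    (hvert : ∀ v : Fin n, Δ.IsVertex v) (d) (hd : Δ.faces.sup Finset.card = d) (σ) (hσ : σ ∈ Δ.faces)
    (hne : σ ≠ ∅) : ∃ z0 ∈ KK k Δ.low d σ, z0 ≠ 0 ∧ ∀ z ∈ KK k Δ.low d σ, ∃ c : k, z = c • z0 := by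
  have hls := link_sup k Δ hHM hvert σ hσ
  rw [hd] at hls
  rcases Nat.eq_zero_or_pos ((Δ.link σ hσ).faces.sup Finset.card) with h0 | h0
  · have hc : σ.card = d := by omega
    refine ⟨Pi.single σ 1, ⟨?_, ?_⟩, ?_, ?_⟩
    · intro F hF
      have : F = σ := by
        by_contra h
        exact hF (Pi.single_eq_of_ne h 1)
      subst this
      exact ⟨hσ, hc, le_rfl⟩
    · intro G hG hGc
      have := Finset.card_le_card hG
      omega
    · intro h
      have := congrFun h σ
      simp at this
    · intro z hz
      refine ⟨z σ, ?_⟩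
      funext F
      by_cases h : F = σ
      · subst h; simp
      · rw [Pi.smul_apply, Pi.single_eq_of_ne h, smul_zero]
        by_contra h'
        obtain ⟨h1, h2, h3⟩ := hz.1 F h'
        exact h (Finset.eq_of_subset_of_card_le h3 (by omega)).symm
  · obtain ⟨m', hm'⟩ := Nat.exists_eq_succ_of_ne_zero h0.ne'
    have hm'' : (Δ.link σ hσ).faces.sup Finset.card = m' + 1 := hm'
    obtain ⟨e1⟩ := ((hHM.2 σ hσ hne).1 m').1 (by rw [SC.dim, hm'']; push_cast; ring)
    obtain ⟨e2⟩ := relHom_equiv k (Δ.link σ hσ) ∅ m' hm''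
    have e3 := e1.symm.trans (e2.trans (twEquiv k Δ σ hσ (m' + 1)))
    have hdd : m' + 1 + σ.card = d := by omega
    rw [hdd] at e3
    refine ⟨(e3 1).1, (e3 1).2, ?_, ?_⟩
    · intro h
      have : e3 1 = 0 := Subtype.ext h
      rw [LinearEquiv.map_eq_zero_iff] at this
      exact one_ne_zero this
    · intro z hz
      refine ⟨e3.symm ⟨z, hz⟩, ?_⟩
      have : (e3.symm ⟨z, hz⟩) • e3 1 = ⟨z, hz⟩ := by
        rw [← map_smul, smul_eq_mul, mul_one, LinearEquiv.apply_symm_apply]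
      exact (congrArg Subtype.val this).symm

theorem KK_restrict (L : LowerSet (Finset (Fin n))) (d) (σ₀ σ) (h : σ₀ ⊆ σ) (z) (hz : z ∈ KK k L d σ₀) :
    (fun F => if σ ⊆ F then z F else 0) ∈ KK k L d σ := by
  refine ⟨?_, ?_⟩
  · intro F hF
    simp only at hF
    split_ifs at hF with hs
    · exact ⟨(hz.1 F hF).1, (hz.1 F hF).2.1, hs⟩
    · exact absurd rfl hF
  · intro G hG hGc
    refine Eq.trans ?_ (hz.2 G (h.trans hG) hGc)
    apply Finset.sum_congr rfl
    intro v _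
    congr 1
    exact if_pos (hG.trans (Finset.subset_insert _ _))

theorem ridge_nz (Δ : SC n) (hHM : Δ.IsHomologyManifold k)
    (hvert : ∀ v : Fin n, Δ.IsVertex v) (d) (hd : Δ.faces.sup Finset.card = d) (σ) (hσ : σ ∈ Δ.faces)
    (hne : σ ≠ ∅) (hc : σ.card + 1 = d) (F F') (hF : F ∈ Δ.faces) (hF' : F' ∈ Δ.faces) (hs : σ ⊆ F)
    (hs' : σ ⊆ F') (hFc : F.card = d) (hFc' : F'.card = d) (z) (hz : z ∈ KK k Δ.low d σ) :
    z F = 0 ↔ z F' = 0 := by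
  obtain ⟨v, hv, rfl⟩ := (Finset.covBy_iff_exists_insert (s := σ) (t := F)).1 (by
    rw [Finset.covBy_iff_card_sdiff_eq_one]
    refine ⟨hs, ?_⟩
    rw [Finset.card_sdiff_of_subset hs]; omega)
  obtain ⟨v', hv', rfl⟩ := (Finset.covBy_iff_exists_insert (s := σ) (t := F')).1 (by
    rw [Finset.covBy_iff_card_sdiff_eq_one]
    refine ⟨hs', ?_⟩
    rw [Finset.card_sdiff_of_subset hs']; omega)
  by_cases hvv : v = v'
  · rw [hvv]
  have hne2 : insert v σ ≠ insert v' σ := by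
    intro h
    have : v ∈ insert v' σ := by rw [← h]; simp
    rcases Finset.mem_insert.1 this with h | h
    · exact hvv h
    · exact hv h
  obtain ⟨z0, h1, h2, h3⟩ := KK_gen k Δ hHM hvert d hd σ hσ hne
  let s : Finset (Fin n) → k := Pi.single (insert v σ) (sgk k v σ) - Pi.single (insert v' σ) (sgk k v' σ)
  have hsm : s ∈ KK k Δ.low d σ := by
    refine ⟨?_, ?_⟩
    · intro G hG
      by_cases e1 : G = insert v σ
      · subst e1; exact ⟨hF, hFc, hs⟩
      by_cases e2 : G = insert v' σ
      · subst e2; exact ⟨hF', hFc', hs'⟩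
      · exfalso; apply hG
        simp only [s, Pi.sub_apply]
        rw [Pi.single_eq_of_ne e1, Pi.single_eq_of_ne e2, sub_zero]
    · intro G hG hGc
      have : σ = G := Finset.eq_of_subset_of_card_le hG (by omega)
      subst this
      have hin : ∀ w w', w' ∉ σ → w ∉ σ → (insert w' σ = insert w σ ↔ w' = w) := by
        intro w w' hw' hw
        constructor
        · intro h
          have : w' ∈ insert w σ := by rw [← h]; simp
          rcases Finset.mem_insert.1 this with h | h
          · exact h
          · exact absurd h hw'
        · rintro rfl; rfl
      have : ∀ w ∈ σᶜ, sgk k w σ * s (insert w σ) = (if w = v then 1 else 0) - (if w = v' then 1 else 0) := by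
        intro w hw
        rw [Finset.mem_compl] at hw
        simp only [s, Pi.sub_apply, Pi.single_apply, hin v w hw hv, hin v' w hw hv', mul_sub, mul_ite, mul_zero]
        congr 1
        · split_ifs with h
          · rw [h, sgk_sq]
          · rfl
        · split_ifs with h
          · rw [h, sgk_sq]
          · rfl
      rw [Finset.sum_congr rfl this, Finset.sum_sub_distrib]
      simp [hv, hv']
  obtain ⟨c, hc⟩ := h3 s hsm
  obtain ⟨c', hc'⟩ := h3 z hz
  have e1 := congrFun hc (insert v σ)
  have e2 := congrFun hc (insert v' σ)
  simp only [s, Pi.sub_apply, Pi.smul_apply, smul_eq_mul, Pi.single_eq_same] at e1 e2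
  rw [Pi.single_eq_of_ne hne2] at e1
  rw [Pi.single_eq_of_ne (Ne.symm hne2)] at e2
  have n1 : z0 (insert v σ) ≠ 0 := by
    intro h; rw [h, mul_zero, sub_zero] at e1; exact sgk_ne k v σ e1
  have n2 : z0 (insert v' σ) ≠ 0 := by
    intro h; rw [h, mul_zero, zero_sub, neg_eq_zero] at e2; exact sgk_ne k v' σ e2
  rw [hc', Pi.smul_apply, Pi.smul_apply, smul_eq_mul, smul_eq_mul, mul_eq_zero, mul_eq_zero]
  simp [n1, n2]

theorem KK_nowhere_zero (Δ : SC n) (hHM : Δ.IsHomologyManifold k)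
    (hvert : ∀ v : Fin n, Δ.IsVertex v) (d) (hd : Δ.faces.sup Finset.card = d) (σ) (hσ : σ ∈ Δ.faces)
    (hne : σ ≠ ∅) (z) (hz : z ∈ KK k Δ.low d σ) (hz0 : z ≠ 0) (F) (hF : F ∈ Δ.faces) (hs : σ ⊆ F)
    (hFc : F.card = d) : z F ≠ 0 := by
  obtain ⟨F', hF'⟩ := Function.ne_iff.1 hz0
  obtain ⟨h1, h2, h3⟩ := hz.1 F' hF'
  have hfac : ∀ G, Δ.IsFacet G ↔ G ∈ Δ.faces ∧ G.card = d := by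
    rw [← hd]; exact facet_iff k Δ hHM hvert
  have := color_const k Δ hHM σ (fun F => z F = 0) (by
    intro τ hτ hτne hστ hl G G' hG hG' hs hs'
    have hls := link_sup k Δ hHM hvert τ hτ
    rw [hd, hl] at hls
    have := ridge_nz k Δ hHM hvert d hd τ hτ hτne (by omega) G G' hG.1 hG'.1 hs hs' ((hfac G).1 hG).2
      ((hfac G').1 hG').2 _ (KK_restrict k Δ.low d σ τ hστ z hz)
    simp only [hs, hs', if_true] at this
    exact propext this) n σ (by omega) hσ hne le_rfl F F' ((hfac F).2 ⟨hF, hFc⟩) ((hfac F').2 ⟨h1, h2⟩) hs h3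
  intro h
  exact hF' (this.mp h)

theorem card_lt (Δ : SC n) (hHM : Δ.IsHomologyManifold k)
    (hvert : ∀ v : Fin n, Δ.IsVertex v) (m) (hm : m ≠ 0) (hd : Δ.faces.sup Finset.card = m + 1) :
    m + 1 < n := by
  obtain ⟨F, hF, hFc⟩ := Finset.exists_mem_eq_sup Δ.faces ⟨∅, Δ.empty_mem⟩ Finset.card
  rw [hd] at hFc
  have h1 := Finset.card_le_univ F
  rw [Fintype.card_fin] at h1
  by_contra h2
  have hmn : m + 1 = n := by omega
  have hu : ∀ G : Finset (Fin n), G.card = m + 1 → G = Finset.univ := by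
    intro G hG
    rw [← Finset.card_eq_iff_eq_univ, Fintype.card_fin, hG, hmn]
  have hFu := hu F hFc.symm
  obtain ⟨w, hw⟩ : F.Nonempty := by
    rw [← Finset.card_pos]; omega
  have hec := Finset.card_erase_of_mem hw
  have hσ : F.erase w ∈ Δ.faces := Δ.down_closed hF (Finset.erase_subset _ _)
  obtain ⟨z0, hz0, hz1, -⟩ := KK_gen k Δ hHM hvert (m + 1) hd (F.erase w) hσ (by
    rw [← Finset.card_pos.trans Finset.nonempty_iff_ne_empty]; omega)
  have h3 := hz0.2 (F.erase w) le_rfl (by omega)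
  have h4 : (F.erase w)ᶜ = {w} := by
    rw [hFu]; ext x; simp
  rw [h4, Finset.sum_singleton, Finset.insert_erase hw] at h3
  apply hz1
  funext G
  by_contra h5
  have h6 := hu G (hz0.1 G h5).2.1
  rw [h6, ← hFu] at h5
  exact h5 ((mul_eq_zero.1 h3).resolve_left (sgk_ne k _ _))

theorem comb_package (Δ : SC n) (hHM : Δ.IsHomologyManifold k)
    (hvert : ∀ v : Fin n, Δ.IsVertex v) (d) (hd : Δ.faces.sup Finset.card = d) :
    ∃ e : Fin n → Finset (Fin n) → k, (∀ v, e v ∈ KK k Δ.low d {v}) ∧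
      (∀ v F, F ∈ Δ.faces → F.card = d → v ∈ F → e v F ≠ 0) ∧
      (∀ σ ∈ Δ.faces, ∀ v ∈ σ, ∀ z ∈ KK k Δ.low d σ, ∃ c : k, ∀ F, σ ⊆ F → z F = c * e v F) ∧
      (∀ v, ∀ z ∈ KK k Δ.low d {v}, ∃ c : k, z = c • e v) := by
  choose e he1 he2 he3 using fun v => KK_gen k Δ hHM hvert d hd {v} (hvert v) (Finset.singleton_ne_empty v)
  have hnz : ∀ v F, F ∈ Δ.faces → F.card = d → v ∈ F → e v F ≠ 0 := fun v F hF hFc hv =>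
    KK_nowhere_zero k Δ hHM hvert d hd {v} (hvert v) (Finset.singleton_ne_empty v) (e v) (he1 v) (he2 v)
      F hF (by simpa using hv) hFc
  refine ⟨e, he1, hnz, ?_, he3⟩
  intro σ hσ v hv z hz
  have hne : σ ≠ ∅ := by rintro rfl; simp at hv
  obtain ⟨z0, hz0, hz1, hz2⟩ := KK_gen k Δ hHM hvert d hd σ hσ hne
  obtain ⟨c, hc⟩ := hz2 z hz
  obtain ⟨c', hc'⟩ := hz2 _ (KK_restrict k Δ.low d {v} σ (by simpa using hv) (e v) (he1 v))
  obtain ⟨F0, hF0, hF0s⟩ := Δ.exists_facet σ hσ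
  have hF0c : F0.card = d := by rw [← hd]; exact purity k Δ hHM hvert F0 hF0
  have hc0 : c' ≠ 0 := by
    rintro rfl
    have := congrFun hc' F0
    simp only [hF0s, if_true, zero_smul, Pi.zero_apply] at this
    exact hnz v F0 hF0.1 hF0c (hF0s hv) this
  refine ⟨c / c', fun F hF => ?_⟩
  have h1 := congrFun hc' F
  simp only [hF, if_true, Pi.smul_apply, smul_eq_mul] at h1
  rw [hc, Pi.smul_apply, smul_eq_mul, h1]
  field_simp

end Twist

open CategoryTheory

set_option linter.unusedVariables false

section Pkg

variable (k : Type) [Field k] {n : ℕ}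

/-- the combinatorial description of the canonical module -/
structure Pkg (Δ : SC n) (ω : Type) [AddCommGroup ω] [Module (SRRing k Δ) ω] where
  d : ℕ
  two_le : 2 ≤ d
  lt : d < n
  vert : ∀ v : Fin n, Δ.IsVertex v
  conn : Δ.Connected
  pure : ∀ σ ∈ Δ.faces, ∃ F ∈ Δ.faces, F.card = d ∧ σ ⊆ F
  K1 : ∀ z ∈ KK k Δ.low d ∅, z = 0
  e : Fin n → Finset (Fin n) → k
  e_mem : ∀ v, e v ∈ KK k Δ.low d {v}
  e_ne : ∀ v F, F ∈ Δ.faces → F.card = d → v ∈ F → e v F ≠ 0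
  e_gen : ∀ σ ∈ Δ.faces, ∀ v ∈ σ, ∀ z ∈ KK k Δ.low d σ, ∃ c : k, ∀ F, σ ⊆ F → z F = c * e v F
  Ψ : ω →+ (Finset (Fin n) → MvPolynomial (Fin n) k)
  inj : Function.Injective Ψ
  smul : ∀ (s : MvPolynomial (Fin n) k) (w : ω) F,
        Ψ (Ideal.Quotient.mk (srIdeal k Δ) s • w) F = rho k F s * Ψ w F
  img : ∀ f, (∃ w, Ψ w = f) ↔
        ∀ a : Fin n →₀ ℕ, (fun F => (f F).coeff a) ∈ KK k Δ.low d a.support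

variable {k}
variable {Δ : SC n} {ω : Type} [AddCommGroup ω] [Module (SRRing k Δ) ω] (p : Pkg k Δ ω)

namespace Pkg

theorem e_zero (v : Fin n) (F) (h : v ∉ F) : p.e v F = 0 := by
  by_contra h'
  exact h (Finset.singleton_subset_iff.1 ((p.e_mem v).1 F h').2.2)

theorem Psi_mem (w : ω) (a : Fin n →₀ ℕ) :
    (fun F => (p.Ψ w F).coeff a) ∈ KK k Δ.low p.d a.support := (p.img _).1 ⟨w, rfl⟩ a

theorem Psi_coeff_zero (w : ω) (F) : (p.Ψ w F).coeff 0 = 0 := by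
  have h := p.Psi_mem w 0
  exact congrFun (p.K1 _ (by simpa using h)) F

/-- monomial elements -/
theorem exists_mono (a : Fin n →₀ ℕ) (z : Finset (Fin n) → k) (hz : z ∈ KK k Δ.low p.d a.support) :
    ∃ w, p.Ψ w = fun F => MvPolynomial.monomial a (z F) := by
  classical
  rw [p.img]
  intro b
  simp only [MvPolynomial.coeff_monomial]
  by_cases h : a = b
  · subst h; simpa using hz
  · simp only [h, if_false]
    exact Submodule.zero_mem _

theorem exists_E (v : Fin n) : ∃ w, p.Ψ w = fun F => MvPolynomial.monomial (Finsupp.single v 1) (p.e v F) :=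
  p.exists_mono _ _ (by
    rw [Finsupp.support_single_ne_zero v one_ne_zero]; exact p.e_mem v)

/-- generators -/
noncomputable def E (v : Fin n) : ω := (p.exists_E v).choose

theorem Psi_E (v : Fin n) (F) : p.Ψ (p.E v) F = MvPolynomial.monomial (Finsupp.single v 1) (p.e v F) :=
  congrFun (p.exists_E v).choose_spec F

theorem mono_mem_span (a : Fin n →₀ ℕ) (z : Finset (Fin n) → k) (hz : z ∈ KK k Δ.low p.d a.support)
    (w : ω) (hw : p.Ψ w = fun F => MvPolynomial.monomial a (z F)) :
    w ∈ Submodule.span (SRRing k Δ) (Set.range p.E) := by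
  have h0 : z = 0 → w ∈ Submodule.span (SRRing k Δ) (Set.range p.E) := by
    rintro rfl
    have : w = 0 := by
      apply p.inj
      rw [hw, map_zero]
      funext F
      simp
    rw [this]; exact Submodule.zero_mem _
  by_cases ha : a.support = ∅
  · rw [ha] at hz
    exact h0 (p.K1 z hz)
  by_cases hf : a.support ∈ Δ.faces
  · obtain ⟨v, hv⟩ := Finset.nonempty_iff_ne_empty.2 ha
    obtain ⟨c, hc⟩ := p.e_gen _ hf v hv z hz
    have hav : a - Finsupp.single v 1 + Finsupp.single v 1 = a :=
      tsub_add_cancel_of_le ((single_le v a).2 hv)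
    have : w = Ideal.Quotient.mk (srIdeal k Δ) (MvPolynomial.monomial (a - Finsupp.single v 1) c) • p.E v := by
      apply p.inj
      funext F
      rw [p.smul, p.Psi_E, hw, rho_monomial]
      by_cases hF : a.support ⊆ F
      · rw [if_pos, MvPolynomial.monomial_mul, hav]
        · simp only; rw [hc F hF]
        · refine subset_trans ?_ hF
          intro i hi
          rw [Finsupp.mem_support_iff] at hi ⊢
          intro h; apply hi
          rw [Finsupp.tsub_apply, h, Nat.zero_sub]
      · have hz0 : z F = 0 := by
          by_contra h
          exact hF (hz.1 F h).2.2
        simp only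
        rw [hz0, map_zero]
        symm
        split_ifs with h1
        · have : v ∉ F := by
            intro hvF
            apply hF
            intro i hi
            by_cases hiv : i = v
            · subst hiv; exact hvF
            · apply h1
              rw [Finsupp.mem_support_iff] at hi ⊢
              rw [Finsupp.tsub_apply, Finsupp.single_eq_of_ne hiv, Nat.sub_zero]
              exact hi
          rw [p.e_zero v F this, map_zero, mul_zero]
        · rw [zero_mul]
    rw [this]
    exact Submodule.smul_mem _ _ (Submodule.subset_span ⟨v, rfl⟩)
  · apply h0
    funext F
    by_contra h
    exact hf (Δ.down_closed (hz.1 F h).1 (hz.1 F h).2.2)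

theorem span_E : Submodule.span (SRRing k Δ) (Set.range p.E) = ⊤ := by
  classical
  rw [eq_top_iff]
  intro w _
  choose g hg using fun a => p.exists_mono a _ (p.Psi_mem w a)
  have : w = ∑ a ∈ (Finset.univ : Finset (Finset (Fin n))).biUnion (fun F => (p.Ψ w F).support), g a := by
    apply p.inj
    rw [map_sum]
    funext F
    rw [Finset.sum_apply]
    simp only [hg]
    rw [← Finset.sum_subset (Finset.subset_biUnion_of_mem (fun F => (p.Ψ w F).support) (Finset.mem_univ F))]
    · exact (p.Ψ w F).as_sum
    · intro a _ ha
      rw [MvPolynomial.notMem_support_iff.1 ha, map_zero]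
  rw [this]
  exact Submodule.sum_mem _ (fun a _ => p.mono_mem_span a _ (p.Psi_mem w a) _ (hg a))

theorem mk_mem_max (Δ : SC n) (s : MvPolynomial (Fin n) k) (h : s.coeff 0 = 0) :
    Ideal.Quotient.mk (srIdeal k Δ) s ∈ srMax k Δ := by
  rw [s.as_sum, map_sum]
  refine Ideal.sum_mem _ (fun a ha => ?_)
  have ha0 : a ≠ 0 := by
    rintro rfl
    exact (MvPolynomial.mem_support_iff.1 ha) h
  obtain ⟨u, hu⟩ := Finsupp.ne_iff.1 ha0
  have hle : Finsupp.single u 1 ≤ a := by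
    rw [single_le, Finsupp.mem_support_iff]; exact hu
  have : MvPolynomial.monomial a (s.coeff a) = MvPolynomial.monomial (a - Finsupp.single u 1) (s.coeff a) *
      MvPolynomial.X u := by
    rw [MvPolynomial.X, MvPolynomial.monomial_mul, tsub_add_cancel_of_le hle, mul_one]
  rw [this, map_mul]
  exact Ideal.mul_mem_left _ _ (Ideal.subset_span ⟨u, rfl⟩)

theorem exists_of_mem_max (Δ : SC n) (r) (h : r ∈ srMax k Δ) :
    ∃ s : MvPolynomial (Fin n) k, s.coeff 0 = 0 ∧ Ideal.Quotient.mk (srIdeal k Δ) s = r := by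
  obtain ⟨c, rfl⟩ := Ideal.mem_span_range_iff_exists_fun.1 h
  choose t ht using fun i => Ideal.Quotient.mk_surjective (I := srIdeal k Δ) (c i)
  refine ⟨∑ i, t i * MvPolynomial.X i, ?_, ?_⟩
  · rw [← MvPolynomial.constantCoeff_eq, map_sum]
    apply Finset.sum_eq_zero
    intro i _
    rw [map_mul, MvPolynomial.constantCoeff_X, mul_zero]
  · rw [map_sum]
    simp only [map_mul, ht]

theorem mk_mem_sq (Δ : SC n) (s : MvPolynomial (Fin n) k) (h : s.coeff 0 = 0)
    (h1 : ∀ v, s.coeff (Finsupp.single v 1) = 0) :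
    Ideal.Quotient.mk (srIdeal k Δ) s ∈ srMax k Δ ^ 2 := by
  rw [s.as_sum, map_sum]
  refine Ideal.sum_mem _ (fun a ha => ?_)
  have ha0 : a ≠ 0 := by
    rintro rfl
    exact (MvPolynomial.mem_support_iff.1 ha) h
  obtain ⟨u, hu⟩ := Finsupp.ne_iff.1 ha0
  have hle : Finsupp.single u 1 ≤ a := by
    rw [single_le, Finsupp.mem_support_iff]; exact hu
  have : MvPolynomial.monomial a (s.coeff a) = MvPolynomial.monomial (a - Finsupp.single u 1) (s.coeff a) *
      MvPolynomial.X u := by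
    rw [MvPolynomial.X, MvPolynomial.monomial_mul, tsub_add_cancel_of_le hle, mul_one]
  rw [this, map_mul, pow_two]
  refine Ideal.mul_mem_mul (mk_mem_max Δ _ ?_) (Ideal.subset_span ⟨u, rfl⟩)
  classical
  rw [MvPolynomial.coeff_monomial, if_neg]
  intro h2
  have h3 : a = Finsupp.single u 1 := le_antisymm (tsub_eq_zero_iff_le.1 h2) hle
  rw [MvPolynomial.mem_support_iff, h3] at ha
  exact ha (h1 u)

/-- coefficients of a product in degree one -/
theorem coeff_single_mul (f g : MvPolynomial (Fin n) k) (v : Fin n) (hf : f.coeff 0 = 0) (hg : g.coeff 0 = 0) :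
    (f * g).coeff (Finsupp.single v 1) = 0 := by
  classical
  rw [MvPolynomial.coeff_mul, Finset.sum_eq_zero]
  rintro ⟨a, b⟩ hab
  rw [Finset.HasAntidiagonal.mem_antidiagonal] at hab
  simp only at hab ⊢
  by_cases ha : a = 0
  · rw [ha, hf, zero_mul]
  by_cases hb : b = 0
  · rw [hb, hg, mul_zero]
  exfalso
  have h1 := congrArg Finsupp.degree hab
  rw [map_add, Finsupp.degree_single] at h1
  have h2 : Finsupp.degree a ≠ 0 := fun h => ha ((Finsupp.degree_eq_zero_iff a).1 h)
  have h3 : Finsupp.degree b ≠ 0 := fun h => hb ((Finsupp.degree_eq_zero_iff b).1 h)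
  omega

theorem coeff_of_mem (w : ω) (hw : w ∈ srMax k Δ • (⊤ : Submodule (SRRing k Δ) ω)) (v : Fin n) (F) :
    (p.Ψ w F).coeff (Finsupp.single v 1) = 0 := by
  refine Submodule.smul_induction_on (p := fun w => (p.Ψ w F).coeff (Finsupp.single v 1) = 0) hw ?_ ?_
  · intro r hr w _
    obtain ⟨s, hs, rfl⟩ := exists_of_mem_max Δ r hr
    rw [p.smul]
    apply coeff_single_mul _ _ _ _ (p.Psi_coeff_zero w F)
    rw [coeff_rho, hs, ite_self]
  · intro x y hx hy
    rw [map_add, Pi.add_apply, MvPolynomial.coeff_add, hx, hy, add_zero]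

theorem decomp (w : ω) : ∃ c : Fin n → k,
    w - ∑ v, Ideal.Quotient.mk (srIdeal k Δ) (MvPolynomial.C (c v)) • p.E v ∈
      srMax k Δ • (⊤ : Submodule (SRRing k Δ) ω) := by
  have hw : w ∈ Submodule.span (SRRing k Δ) (Set.range p.E) := by rw [p.span_E]; trivial
  rw [Submodule.mem_span_range_iff_exists_fun] at hw
  obtain ⟨r, rfl⟩ := hw
  choose t ht using fun i => Ideal.Quotient.mk_surjective (I := srIdeal k Δ) (r i)
  refine ⟨fun v => (t v).coeff 0, ?_⟩
  rw [← Finset.sum_sub_distrib]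
  refine Submodule.sum_mem _ (fun v _ => ?_)
  rw [← sub_smul, ← ht, ← map_sub]
  refine Submodule.smul_mem_smul (mk_mem_max Δ _ ?_) trivial
  rw [MvPolynomial.coeff_sub, MvPolynomial.coeff_C, if_pos rfl, sub_self]

/-- a facet through each vertex -/
theorem exists_fac (v : Fin n) : ∃ F ∈ Δ.faces, F.card = p.d ∧ v ∈ F := by
  obtain ⟨F, h1, h2, h3⟩ := p.pure {v} (p.vert v)
  exact ⟨F, h1, h2, h3 (by simp)⟩

/-- the degree one functional -/
noncomputable def lam (w : ω) (v : Fin n) : k :=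
  (p.Ψ w (p.exists_fac v).choose).coeff (Finsupp.single v 1) / p.e v (p.exists_fac v).choose

theorem e_fac_ne (v : Fin n) : p.e v (p.exists_fac v).choose ≠ 0 := by
  obtain ⟨h1, h2, h3⟩ := (p.exists_fac v).choose_spec
  exact p.e_ne v _ h1 h2 h3

theorem lam_add (x y : ω) : p.lam (x + y) = p.lam x + p.lam y := by
  funext v
  simp only [lam, map_add, Pi.add_apply, MvPolynomial.coeff_add, add_div]

theorem lam_smul (c : k) (x : ω) :
    p.lam (Ideal.Quotient.mk (srIdeal k Δ) (MvPolynomial.C c) • x) = c • p.lam x := by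
  funext v
  simp only [lam, p.smul, Pi.smul_apply, smul_eq_mul]
  rw [← MvPolynomial.algebraMap_eq, AlgHom.commutes, MvPolynomial.algebraMap_eq, MvPolynomial.coeff_C_mul, mul_div_assoc]

theorem lam_E (u : Fin n) : p.lam (p.E u) = Pi.single u 1 := by
  classical
  funext v
  rw [lam, p.Psi_E, MvPolynomial.coeff_monomial]
  by_cases h : u = v
  · subst h
    rw [if_pos rfl, Pi.single_eq_same, div_self (p.e_fac_ne u)]
  · rw [if_neg, Pi.single_eq_of_ne (Ne.symm h), zero_div]
    intro h'
    exact h ((Finsupp.single_left_inj one_ne_zero).1 h')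

/-- as an additive map -/
noncomputable def lamHom : ω →+ (Fin n → k) := AddMonoidHom.mk' p.lam p.lam_add

theorem lam_sum (c : Fin n → k) :
    p.lam (∑ v, Ideal.Quotient.mk (srIdeal k Δ) (MvPolynomial.C (c v)) • p.E v) = c := by
  have : p.lamHom (∑ v, Ideal.Quotient.mk (srIdeal k Δ) (MvPolynomial.C (c v)) • p.E v) = c := by
    rw [map_sum]
    have : ∀ v, p.lamHom (Ideal.Quotient.mk (srIdeal k Δ) (MvPolynomial.C (c v)) • p.E v) =
        c v • Pi.single v 1 := by
      intro v
      exact (p.lam_smul _ _).trans (by rw [p.lam_E])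
    simp only [this]
    funext u
    simp [Finset.sum_apply, Pi.single_apply]
  exact this

theorem lam_eq_zero_of_mem (w : ω) (hw : w ∈ srMax k Δ • (⊤ : Submodule (SRRing k Δ) ω)) : p.lam w = 0 := by
  funext v
  rw [lam, p.coeff_of_mem w hw, zero_div, Pi.zero_apply]

theorem mem_of_lam (w : ω) (hw : p.lam w = 0) : w ∈ srMax k Δ • (⊤ : Submodule (SRRing k Δ) ω) := by
  obtain ⟨c, hc⟩ := p.decomp w
  have h1 : p.lamHom (w - ∑ v, Ideal.Quotient.mk (srIdeal k Δ) (MvPolynomial.C (c v)) • p.E v) = 0 :=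
    p.lam_eq_zero_of_mem _ hc
  rw [map_sub] at h1
  have h2 : p.lamHom (∑ v, Ideal.Quotient.mk (srIdeal k Δ) (MvPolynomial.C (c v)) • p.E v) = c := p.lam_sum c
  have h3 : p.lamHom w = 0 := hw
  rw [h2, h3, zero_sub, neg_eq_zero] at h1
  rw [Finset.sum_eq_zero, sub_zero] at hc
  · exact hc
  · intro v _
    rw [h1, Pi.zero_apply, map_zero, map_zero]
    exact zero_smul (SRRing k Δ) (p.E v)

theorem muGen_eq (p : Pkg k Δ ω) : muGen k (SRRing k Δ) (srMax k Δ) ω = n := by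
  unfold muGen
  letI : Module k (ω ⧸ (srMax k Δ • (⊤ : Submodule (SRRing k Δ) ω))) :=
    Module.compHom (ω ⧸ (srMax k Δ • (⊤ : Submodule (SRRing k Δ) ω))) (algebraMap k (SRRing k Δ))
  let g : (Fin n → k) →ₗ[k] (ω ⧸ (srMax k Δ • (⊤ : Submodule (SRRing k Δ) ω))) :=
    { toFun := fun c => Submodule.Quotient.mk (∑ v, Ideal.Quotient.mk (srIdeal k Δ) (MvPolynomial.C (c v)) • p.E v)
      map_add' := by
        intro x y
        rw [← Submodule.Quotient.mk_add, ← Finset.sum_add_distrib]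
        simp only [Pi.add_apply, map_add, add_smul]
      map_smul' := by
        intro c x
        change _ = (Ideal.Quotient.mk (srIdeal k Δ) (MvPolynomial.C c) : SRRing k Δ) •
          (Submodule.Quotient.mk (∑ v, Ideal.Quotient.mk (srIdeal k Δ) (MvPolynomial.C (x v)) • p.E v) :
            ω ⧸ (srMax k Δ • (⊤ : Submodule (SRRing k Δ) ω)))
        rw [← Submodule.Quotient.mk_smul, Finset.smul_sum]
        simp only [Pi.smul_apply, smul_eq_mul, map_mul, mul_smul] }
  have hg : Function.Bijective g := by
    constructor
    · rw [injective_iff_map_eq_zero]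
      intro c hc
      have := p.lam_eq_zero_of_mem _ ((Submodule.Quotient.mk_eq_zero _).1 hc)
      rw [p.lam_sum] at this
      exact this
    · intro y
      obtain ⟨w, rfl⟩ := Submodule.Quotient.mk_surjective _ y
      obtain ⟨c, hc⟩ := p.decomp w
      exact ⟨c, ((Submodule.Quotient.eq _).2 hc).symm⟩
  have := (LinearEquiv.ofBijective g hg).finrank_eq
  rw [Module.finrank_fin_fun] at this
  exact this.symm

end Pkg
end Pkg

open CategoryTheory

set_option linter.unusedVariables false

section Trace

variable {k : Type} [Field k] {n : ℕ}
variable {Δ : SC n} {ω : Type} [AddCommGroup ω] [Module (SRRing k Δ) ω] (p : Pkg k Δ ω)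

namespace Pkg

theorem mk_eq_iff (Δ : SC n) (s t : MvPolynomial (Fin n) k) :
    Ideal.Quotient.mk (srIdeal k Δ) s = Ideal.Quotient.mk (srIdeal k Δ) t ↔
      ∀ a : Fin n →₀ ℕ, a.support ∈ Δ.faces → s.coeff a = t.coeff a := by
  rw [Ideal.Quotient.eq, srIdeal_eq, mem_monJ]
  simp only [MvPolynomial.coeff_sub, sub_eq_zero]
  rfl

theorem mk_eq_of_rho (p : Pkg k Δ ω) (s t : MvPolynomial (Fin n) k)
    (h : ∀ F ∈ Δ.faces, F.card = p.d → rho k F s = rho k F t) :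
    Ideal.Quotient.mk (srIdeal k Δ) s = Ideal.Quotient.mk (srIdeal k Δ) t := by
  rw [mk_eq_iff]
  intro a ha
  obtain ⟨F, hF, hFc, hs⟩ := p.pure _ ha
  have := congrArg (MvPolynomial.coeff a) (h F hF hFc)
  rwa [coeff_rho, coeff_rho, if_pos hs, if_pos hs] at this

theorem glue (Δ : SC n) (d : ℕ) (g : Finset (Fin n) → MvPolynomial (Fin n) k)
    (h : ∀ a : Fin n →₀ ℕ, ∃ c : k, ∀ F ∈ Δ.faces, F.card = d →
      (g F).coeff a = if a.support ⊆ F then c else 0) :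
    ∃ s, ∀ F ∈ Δ.faces, F.card = d → rho k F s = g F := by
  classical
  choose c hc using h
  refine ⟨∑ a ∈ (Finset.univ : Finset (Finset (Fin n))).biUnion (fun F => (g F).support),
    MvPolynomial.monomial a (c a), ?_⟩
  intro F hF hFc
  apply MvPolynomial.ext
  intro a
  rw [coeff_rho, MvPolynomial.coeff_sum, hc a F hF hFc]
  split_ifs with hs
  · simp only [MvPolynomial.coeff_monomial, Finset.sum_ite_eq']
    split_ifs with ha
    · rfl
    · have := hc a F hF hFc
      rw [if_pos hs] at this
      rw [← this]
      by_contra h'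
      apply ha
      rw [Finset.mem_biUnion]
      exact ⟨F, Finset.mem_univ F, MvPolynomial.mem_support_iff.2 (Ne.symm h')⟩
  · rfl

theorem exists_hom (p : Pkg k Δ ω) (G : ω → Finset (Fin n) → MvPolynomial (Fin n) k)
    (hadd : ∀ x y F, G (x + y) F = G x F + G y F)
    (hsm : ∀ s x F, G (Ideal.Quotient.mk (srIdeal k Δ) s • x) F = rho k F s * G x F)
    (hgl : ∀ x, ∀ a : Fin n →₀ ℕ, ∃ c : k, ∀ F ∈ Δ.faces, F.card = p.d →
      (G x F).coeff a = if a.support ⊆ F then c else 0) :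
    ∃ φ : ω →ₗ[SRRing k Δ] SRRing k Δ, ∀ x s, (∀ F ∈ Δ.faces, F.card = p.d → rho k F s = G x F) →
      φ x = Ideal.Quotient.mk (srIdeal k Δ) s := by
  choose s hs using fun x => glue Δ p.d (G x) (hgl x)
  refine ⟨{ toFun := fun x => Ideal.Quotient.mk (srIdeal k Δ) (s x), map_add' := ?_, map_smul' := ?_ }, ?_⟩
  · intro x y
    rw [← map_add]
    apply p.mk_eq_of_rho
    intro F hF hFc
    rw [map_add, hs _ F hF hFc, hs _ F hF hFc, hs _ F hF hFc, hadd]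
  · intro r x
    obtain ⟨t, rfl⟩ := Ideal.Quotient.mk_surjective r
    rw [RingHom.id_apply, smul_eq_mul, ← map_mul]
    apply p.mk_eq_of_rho
    intro F hF hFc
    rw [map_mul, hs _ F hF hFc, hs _ F hF hFc, hsm]
  · intro x t ht
    apply p.mk_eq_of_rho
    intro F hF hFc
    rw [hs _ F hF hFc, ht F hF hFc]

theorem pair_gen (u w : Fin n) (h : ({u, w} : Finset (Fin n)) ∈ Δ.faces) :
    ∃ c : k, c ≠ 0 ∧ ∀ F, u ∈ F → w ∈ F → p.e u F = c * p.e w F := by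
  obtain ⟨c, hc⟩ := p.e_gen _ h w (by simp) _
    (KK_restrict k Δ.low p.d {u} {u, w} (by simp) (p.e u) (p.e_mem u))
  have hc' : ∀ F, u ∈ F → w ∈ F → p.e u F = c * p.e w F := by
    intro F hu hw
    have hs : ({u, w} : Finset (Fin n)) ⊆ F := by
      intro x hx
      simp only [Finset.mem_insert, Finset.mem_singleton] at hx
      rcases hx with rfl | rfl <;> assumption
    have := hc F hs
    rwa [if_pos hs] at this
  refine ⟨c, ?_, hc'⟩
  rintro rfl
  obtain ⟨F, hF, hFc, hs⟩ := p.pure _ h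
  have hu : u ∈ F := hs (by simp)
  have hw : w ∈ F := hs (by simp)
  have := hc' F hu hw
  rw [zero_mul] at this
  exact p.e_ne u F hF hFc hu this

/-- the test maps -/
theorem exists_psi (w : Fin n) : ∃ φ : ω →ₗ[SRRing k Δ] SRRing k Δ, ∀ x s,
    (∀ F ∈ Δ.faces, F.card = p.d → rho k F s = if w ∈ F then
      MvPolynomial.X w * (MvPolynomial.C (p.e w F)⁻¹ * p.Ψ x F) else 0) →
      φ x = Ideal.Quotient.mk (srIdeal k Δ) s := by
  classical
  apply p.exists_hom (fun x F => if w ∈ F then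
      MvPolynomial.X w * (MvPolynomial.C (p.e w F)⁻¹ * p.Ψ x F) else 0)
  · intro x y F
    simp only [map_add, Pi.add_apply]
    split_ifs
    · ring
    · ring
  · intro s x F
    simp only [p.smul]
    split_ifs
    · ring
    · ring
  · intro x a
    by_cases hw : w ∈ a.support
    · by_cases hf : a.support ∈ Δ.faces
      · have hsub : (a - Finsupp.single w 1).support ⊆ a.support := by
          intro i hi
          rw [Finsupp.mem_support_iff] at hi ⊢
          intro h; apply hi
          rw [Finsupp.tsub_apply, h, Nat.zero_sub]
        obtain ⟨c, hc⟩ := p.e_gen _ hf w hw _ (KK_restrict k Δ.low p.d _ _ hsub _ (p.Psi_mem x (a - Finsupp.single w 1)))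
        refine ⟨c, fun F hF hFc => ?_⟩
        by_cases hwF : w ∈ F
        · simp only [hwF, if_true]
          rw [mul_comm, MvPolynomial.coeff_mul_X', if_pos hw, MvPolynomial.coeff_C_mul]
          split_ifs with hs
          · have := hc F hs
            rw [if_pos hs] at this
            rw [this]
            have := p.e_ne w F hF hFc hwF
            field_simp
          · have : (p.Ψ x F).coeff (a - Finsupp.single w 1) = 0 := by
              by_contra h
              have h1 := ((p.Psi_mem x (a - Finsupp.single w 1)).1 F h).2.2
              apply hs
              intro i hi
              by_cases hiw : i = w
              · rw [hiw]; exact hwF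
              · apply h1
                rw [Finsupp.mem_support_iff] at hi ⊢
                rw [Finsupp.tsub_apply, Finsupp.single_eq_of_ne hiw, Nat.sub_zero]
                exact hi
            rw [this, mul_zero]
        · simp only [hwF, if_false]
          rw [if_neg (fun h => hwF (h hw)), MvPolynomial.coeff_zero]
      · refine ⟨0, fun F hF hFc => ?_⟩
        rw [ite_self]
        split_ifs with hwF
        · rw [mul_comm, MvPolynomial.coeff_mul_X', if_pos hw, MvPolynomial.coeff_C_mul]
          have : (p.Ψ x F).coeff (a - Finsupp.single w 1) = 0 := by
            by_contra h
            have h1 := ((p.Psi_mem x (a - Finsupp.single w 1)).1 F h).2.2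
            apply hf
            refine Δ.down_closed hF ?_
            intro i hi
            by_cases hiw : i = w
            · rw [hiw]; exact hwF
            · apply h1
              rw [Finsupp.mem_support_iff] at hi ⊢
              rw [Finsupp.tsub_apply, Finsupp.single_eq_of_ne hiw, Nat.sub_zero]
              exact hi
          rw [this, mul_zero]
        · rw [MvPolynomial.coeff_zero]
    · refine ⟨0, fun F hF hFc => ?_⟩
      rw [ite_self]
      split_ifs with hwF
      · rw [mul_comm, MvPolynomial.coeff_mul_X', if_neg hw]
      · rw [MvPolynomial.coeff_zero]

theorem rho_X (F : Finset (Fin n)) (u : Fin n) :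
    rho k F (MvPolynomial.X u) = if u ∈ F then MvPolynomial.X u else 0 := by
  rw [rho, MvPolynomial.aeval_X]

theorem rho_C (F : Finset (Fin n)) (c : k) :
    rho k F (MvPolynomial.C c) = MvPolynomial.C c := by
  rw [← MvPolynomial.algebraMap_eq, AlgHom.commutes]

theorem X_mul_X_mem (p : Pkg k Δ ω) (u w : Fin n) :
    Ideal.Quotient.mk (srIdeal k Δ) (MvPolynomial.X u * MvPolynomial.X w) ∈ traceIdeal (SRRing k Δ) ω := by
  classical
  by_cases h : ({u, w} : Finset (Fin n)) ∈ Δ.faces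
  · obtain ⟨c, hc0, hc⟩ := p.pair_gen u w h
    obtain ⟨φ, hφ⟩ := p.exists_psi w
    have h1 := hφ (p.E u) (MvPolynomial.C c * (MvPolynomial.X u * MvPolynomial.X w)) (by
      intro F hF hFc
      rw [map_mul, map_mul, rho_X, rho_X, rho_C, p.Psi_E]
      by_cases hw : w ∈ F
      · rw [if_pos hw, if_pos hw]
        by_cases hu : u ∈ F
        · rw [if_pos hu, hc F hu hw]
          have h2 := p.e_ne w F hF hFc hw
          rw [MvPolynomial.C_mul_monomial, mul_comm c, inv_mul_cancel_left₀ h2]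
          rw [← mul_one c, ← MvPolynomial.C_mul_monomial, mul_one c]
          change _ = MvPolynomial.X w * (MvPolynomial.C c * MvPolynomial.X u)
          ring
        · rw [if_neg hu, p.e_zero u F hu, map_zero, mul_zero, zero_mul, mul_zero, mul_zero]
      · rw [if_neg hw, if_neg hw, mul_zero, mul_zero])
    have h2 : φ (p.E u) ∈ traceIdeal (SRRing k Δ) ω :=
      (le_iSup (fun f : ω →ₗ[SRRing k Δ] SRRing k Δ => LinearMap.range f) φ) ⟨p.E u, rfl⟩
    rw [h1] at h2
    have h3 := Ideal.mul_mem_left _ (Ideal.Quotient.mk (srIdeal k Δ) (MvPolynomial.C c⁻¹)) h2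
    rw [← map_mul, ← mul_assoc, ← MvPolynomial.C_mul, inv_mul_cancel₀ hc0, MvPolynomial.C_1, one_mul] at h3
    exact h3
  · have : Ideal.Quotient.mk (srIdeal k Δ) (MvPolynomial.X u * MvPolynomial.X w) = 0 := by
      rw [← map_zero (Ideal.Quotient.mk (srIdeal k Δ))]
      apply p.mk_eq_of_rho
      intro F hF hFc
      rw [map_zero, map_mul, rho_X, rho_X]
      by_cases hu : u ∈ F
      · by_cases hw : w ∈ F
        · exfalso
          apply h
          apply Δ.down_closed hF
          intro x hx
          simp only [Finset.mem_insert, Finset.mem_singleton] at hx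
          rcases hx with rfl | rfl <;> assumption
        · rw [if_neg hw, mul_zero]
      · rw [if_neg hu, zero_mul]
    rw [this]
    exact Ideal.zero_mem _

theorem sq_le_trace (p : Pkg k Δ ω) : srMax k Δ ^ 2 ≤ traceIdeal (SRRing k Δ) ω := by
  rw [pow_two]
  change Ideal.span _ * Ideal.span _ ≤ _
  rw [Ideal.span_mul_span', Ideal.span_le]
  rintro _ ⟨_, ⟨u, rfl⟩, _, ⟨w, rfl⟩, rfl⟩
  have := p.X_mul_X_mem u w
  rw [map_mul] at this
  exact this

/-- relations -/
theorem rel_edge (u v : Fin n) (h : ({u, v} : Finset (Fin n)) ∈ Δ.faces) (c : k)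
    (hc : ∀ F, u ∈ F → v ∈ F → p.e u F = c * p.e v F) :
    Ideal.Quotient.mk (srIdeal k Δ) (MvPolynomial.X v) • p.E u =
      Ideal.Quotient.mk (srIdeal k Δ) (MvPolynomial.C c * MvPolynomial.X u) • p.E v := by
  apply p.inj
  funext F
  rw [p.smul, p.smul, p.Psi_E, p.Psi_E, map_mul, rho_X, rho_X, rho_C]
  by_cases hu : u ∈ F
  · by_cases hv : v ∈ F
    · rw [if_pos hu, if_pos hv, hc F hu hv, MvPolynomial.X, MvPolynomial.X, MvPolynomial.monomial_mul,
        MvPolynomial.C_mul_monomial, MvPolynomial.monomial_mul, add_comm]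
      congr 1; ring
    · rw [if_neg hv, p.e_zero v F hv, map_zero, zero_mul, mul_zero]
  · rw [if_neg hu, p.e_zero u F hu, map_zero, mul_zero, mul_zero, zero_mul]

theorem rel_nonedge (u v : Fin n) (h : ({u, v} : Finset (Fin n)) ∉ Δ.faces) :
    Ideal.Quotient.mk (srIdeal k Δ) (MvPolynomial.X v) • p.E u = 0 := by
  apply p.inj
  funext F
  rw [p.smul, p.Psi_E, rho_X, map_zero, Pi.zero_apply]
  by_cases hv : v ∈ F
  · by_cases he : p.e u F = 0
    · rw [he, map_zero, mul_zero]
    · exfalso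
      have h1 := (p.e_mem u).1 F he
      apply h
      apply Δ.down_closed h1.1
      intro x hx
      simp only [Finset.mem_insert, Finset.mem_singleton] at hx
      rcases hx with rfl | rfl
      · exact h1.2.2 (by simp)
      · exact hv
  · rw [if_neg hv, zero_mul]

theorem trace_le (p : Pkg k Δ ω) : traceIdeal (SRRing k Δ) ω ≤ srMax k Δ ^ 2 := by
  classical
  apply iSup_le
  intro φ
  rw [LinearMap.range_eq_map, ← p.span_E, Submodule.map_span, Submodule.span_le]
  choose s hs using fun u => Ideal.Quotient.mk_surjective (I := srIdeal k Δ) (φ (p.E u))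
  have hone : ∀ (v : Fin n) (j : ℕ), (Finsupp.single v j).support ∈ Δ.faces := fun v j =>
    Δ.down_closed (p.vert v) Finsupp.support_single_subset
  -- edge and nonedge relations in the ring
  have R1 : ∀ u v, ({u, v} : Finset (Fin n)) ∈ Δ.faces → ∀ c : k,
      (∀ F, u ∈ F → v ∈ F → p.e u F = c * p.e v F) → ∀ a : Fin n →₀ ℕ, a.support ∈ Δ.faces →
      (MvPolynomial.X v * s u).coeff a = c * (MvPolynomial.X u * s v).coeff a := by
    intro u v h c hc
    have h1 := congrArg φ (p.rel_edge u v h c hc)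
    rw [map_smul, map_smul, smul_eq_mul, smul_eq_mul, ← hs, ← hs, ← map_mul, ← map_mul, mk_eq_iff] at h1
    intro a ha
    rw [h1 a ha, mul_assoc, MvPolynomial.coeff_C_mul]
  have R2 : ∀ u v, ({u, v} : Finset (Fin n)) ∉ Δ.faces → ∀ a : Fin n →₀ ℕ, a.support ∈ Δ.faces →
      (MvPolynomial.X v * s u).coeff a = 0 := by
    intro u v h
    have h1 := congrArg φ (p.rel_nonedge u v h)
    rw [map_smul, smul_eq_mul, ← hs, ← map_mul, map_zero,
      ← map_zero (Ideal.Quotient.mk (srIdeal k Δ)), mk_eq_iff] at h1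
    intro a ha
    rw [h1 a ha, MvPolynomial.coeff_zero]
  have R3 : ∀ u v, u ≠ v → ∀ j, (MvPolynomial.X v * s u).coeff (Finsupp.single v j) = 0 := by
    intro u v huv j
    by_cases h : ({u, v} : Finset (Fin n)) ∈ Δ.faces
    · obtain ⟨c, -, hc⟩ := p.pair_gen u v h
      rw [R1 u v h c hc _ (hone v j), mul_comm (MvPolynomial.X u), MvPolynomial.coeff_mul_X', if_neg, mul_zero]
      intro h'
      have := Finsupp.support_single_subset h'
      rw [Finset.mem_singleton] at this
      exact huv this
    · exact R2 u v h _ (hone v j)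
  have C0 : ∀ u, (s u).coeff 0 = 0 := by
    intro u
    have : ∃ v, u ≠ v := by
      have h1 := p.lt
      have h2 := p.two_le
      have : Nontrivial (Fin n) := Fin.nontrivial_iff_two_le.2 (by omega)
      obtain ⟨v, hv⟩ := exists_ne u
      exact ⟨v, hv.symm⟩
    obtain ⟨v, huv⟩ := this
    have := R3 u v huv 1
    rw [mul_comm] at this
    have h2 := MvPolynomial.coeff_mul_X 0 v (s u)
    rw [zero_add] at h2
    rw [← h2, this]
  have C1 : ∀ u w, u ≠ w → (s u).coeff (Finsupp.single w 1) = 0 := by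
    intro u w huw
    have := R3 u w huw 2
    rw [mul_comm] at this
    have h2 := MvPolynomial.coeff_mul_X (Finsupp.single w 1) w (s u)
    rw [← Finsupp.single_add] at h2
    rw [← h2, this]
  have C2 : ∀ u, (s u).coeff (Finsupp.single u 1) = 0 := by
    by_contra hcon
    push Not at hcon
    obtain ⟨u0, hu0⟩ := hcon
    let μ : Fin n → k := fun u => (s u).coeff (Finsupp.single u 1)
    have hμ : ∀ u v, ∀ F ∈ Δ.faces, u ∈ F → v ∈ F → μ v * p.e u F = μ u * p.e v F := by
      intro u v F hF hu hv
      by_cases huv : u = v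
      · rw [huv]
      have h : ({u, v} : Finset (Fin n)) ∈ Δ.faces := by
        apply Δ.down_closed hF
        intro x hx
        simp only [Finset.mem_insert, Finset.mem_singleton] at hx
        rcases hx with rfl | rfl <;> assumption
      obtain ⟨c, -, hc⟩ := p.pair_gen u v h
      have h1 := R1 u v h c hc (Finsupp.single u 1 + Finsupp.single v 1) (by
        apply Δ.down_closed h
        refine Finsupp.support_add.trans ?_
        apply Finset.union_subset
        · exact Finsupp.support_single_subset.trans (by simp)
        · exact Finsupp.support_single_subset.trans (by simp))
      rw [mul_comm, MvPolynomial.coeff_mul_X, mul_comm (MvPolynomial.X u), add_comm, MvPolynomial.coeff_mul_X] at h1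
      change μ u = c * μ v at h1
      rw [h1, hc F hu hv]; ring
    have hall : ∀ v, μ v ≠ 0 := by
      intro v
      have hc := p.conn.2 u0 v (p.vert u0) (p.vert v)
      induction hc with
      | refl => exact hu0
      | @tail a b _ hab ih =>
        obtain ⟨F, hF, hFc, hsub⟩ := p.pure _ hab
        have ha : a ∈ F := hsub (by simp)
        have hb : b ∈ F := hsub (by simp)
        intro h
        have := hμ a b F hF ha hb
        rw [h, zero_mul] at this
        exact (mul_ne_zero ih (p.e_ne b F hF hFc hb)) this.symm
    let z : Finset (Fin n) → k := fun F => if h : F.Nonempty then p.e h.choose F / μ h.choose else 0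
    have hz : ∀ F u, u ∈ F → z F = p.e u F / μ u := by
      intro F u hu
      have hne : F.Nonempty := ⟨u, hu⟩
      have h1 : z F = p.e hne.choose F / μ hne.choose := dif_pos hne
      rw [h1]
      by_cases hF : F ∈ Δ.faces
      · rw [div_eq_div_iff (hall _) (hall _)]
        have := hμ u hne.choose F hF hu hne.choose_spec
        linear_combination -this
      · have h0 : ∀ v, p.e v F = 0 := by
          intro v
          by_contra h
          exact hF ((p.e_mem v).1 F h).1
        rw [h0, h0, zero_div, zero_div]
    have hzK : z ∈ KK k Δ.low p.d ∅ := by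
      refine ⟨?_, ?_⟩
      · intro F hF
        have hne : F.Nonempty := by
          by_contra h
          exact hF (dif_neg h)
        obtain ⟨u, hu⟩ := hne
        rw [hz F u hu] at hF
        have : p.e u F ≠ 0 := fun h => hF (by rw [h, zero_div])
        have h1 := (p.e_mem u).1 F this
        exact ⟨h1.1, h1.2.1, by simp⟩
      · intro G _ hGc
        have h2 := p.two_le
        obtain ⟨u, hu⟩ : G.Nonempty := by
          rw [← Finset.card_pos]; omega
        have h1 := (p.e_mem u).2 G (by simpa using hu) hGc
        rw [← zero_div (μ u), ← h1, Finset.sum_div]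
        apply Finset.sum_congr rfl
        intro v _
        rw [hz (insert v G) u (Finset.mem_insert_of_mem hu), mul_div_assoc]
    have hz0 := p.K1 z hzK
    obtain ⟨F, hF, hFc, hu⟩ := p.exists_fac u0
    have h1 := hz F u0 hu
    rw [hz0, Pi.zero_apply] at h1
    exact div_ne_zero (p.e_ne u0 F hF hFc hu) (hall u0) h1.symm
  rintro _ ⟨_, ⟨u, rfl⟩, rfl⟩
  rw [← hs]
  refine mk_mem_sq Δ (s u) (C0 u) ?_
  intro v
  by_cases h : u = v
  · subst h; exact C2 u
  · exact C1 u v h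

end Pkg
end Trace

open CategoryTheory

set_option linter.unusedVariables false

section Level

variable {k : Type} [Field k] {n : ℕ} {Δ : SC n} {ω : Type} [AddCommGroup ω]
  [Module (SRRing k Δ) ω] [Module k ω]

theorem exists_proj (gr : ℤ → Submodule k ω) (h : DirectSum.IsInternal gr) :
    ∃ P : ℤ → ω →+ ω, (∀ j w, P j w ∈ gr j) ∧ (∀ j, ∀ w ∈ gr j, P j w = w) ∧
      (∀ i j, i ≠ j → ∀ w ∈ gr i, P j w = 0) ∧
      (∀ Q : ω → Prop, (∀ j, ∀ w ∈ gr j, Q w) → (∀ x y, Q x → Q y → Q (x + y)) → ∀ w, Q w) := by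
  classical
  letI := h.chooseDecomposition
  refine ⟨fun j => AddMonoidHom.mk' (fun w => (DirectSum.decompose gr w j : ω)) ?_, ?_, ?_, ?_, ?_⟩
  · intro x y
    rw [DirectSum.decompose_add]
    rfl
  · intro j w
    exact (DirectSum.decompose gr w j).2
  · intro j w hw
    exact DirectSum.decompose_of_mem_same gr hw
  · intro i j hij w hw
    exact DirectSum.decompose_of_mem_ne gr hw hij
  · intro Q h1 h2 w
    exact DirectSum.Decomposition.inductionOn gr (motive := Q) (h1 0 0 (Submodule.zero_mem _))
      (fun {i} m => h1 i m m.2) h2 w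

theorem X_mem_grade (i : Fin n) :
    Ideal.Quotient.mk (srIdeal k Δ) (MvPolynomial.X i) ∈ quotGrade k (srIdeal k Δ) 1 :=
  Submodule.mem_map.2 ⟨MvPolynomial.X i, MvPolynomial.isHomogeneous_X k i, rfl⟩

theorem mem_max_smul (w : ω) (hw : w ∈ srMax k Δ • (⊤ : Submodule (SRRing k Δ) ω)) :
    ∃ u : Fin n → ω, w = ∑ i, Ideal.Quotient.mk (srIdeal k Δ) (MvPolynomial.X i) • u i := by
  refine Submodule.smul_induction_on (p := fun w => ∃ u : Fin n → ω,
    w = ∑ i, Ideal.Quotient.mk (srIdeal k Δ) (MvPolynomial.X i) • u i) hw ?_ ?_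
  · intro r hr w _
    obtain ⟨c, rfl⟩ := Ideal.mem_span_range_iff_exists_fun.1 hr
    refine ⟨fun i => c i • w, ?_⟩
    rw [Finset.sum_smul]
    refine Finset.sum_congr rfl (fun i _ => ?_)
    rw [mul_comm, mul_smul]
  · rintro x y ⟨u, rfl⟩ ⟨v, rfl⟩
    refine ⟨fun i => u i + v i, ?_⟩
    rw [← Finset.sum_add_distrib]
    simp only [smul_add]

theorem level_aux (gr : ℤ → Submodule k ω) (hc : IsCompatibleGrading k (srIdeal k Δ) ω gr)
    (hneg : ∀ j : ℤ, j < 0 → gr j = ⊥) (h0 : Module.finrank k (gr 0) = 0)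
    (h1 : Module.finrank k (gr 1) = n) (L : ω →ₗ[k] (Fin n → k))
    (hL : ∀ w, L w = 0 ↔ w ∈ srMax k Δ • (⊤ : Submodule (SRRing k Δ) ω)) :
    Submodule.span (SRRing k Δ) (gr 1 : Set ω) = ⊤ := by
  obtain ⟨P, Pm, Ps, Pn, Pind⟩ := exists_proj gr hc.1
  have PX : ∀ (i : Fin n) (j : ℤ) (w : ω),
      P (1 + j) (Ideal.Quotient.mk (srIdeal k Δ) (MvPolynomial.X i) • w) =
        Ideal.Quotient.mk (srIdeal k Δ) (MvPolynomial.X i) • P j w := by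
    intro i j
    apply Pind
    · intro l w hw
      have hm := hc.2 1 l _ w (X_mem_grade i) hw
      by_cases hl : l = j
      · subst hl
        rw [Ps l w hw]
        exact Ps _ _ hm
      · rw [Pn l j hl w hw, smul_zero]
        refine Pn _ _ ?_ _ hm
        push_cast
        omega
    · intro x y hx hy
      rw [smul_add, map_add, map_add, hx, hy, smul_add]
  have key : ∀ (j : ℤ) (w : ω), w ∈ srMax k Δ • (⊤ : Submodule (SRRing k Δ) ω) →
      ∃ u : Fin n → ω, (∀ i, u i ∈ gr j) ∧
        P (1 + j) w = ∑ i, Ideal.Quotient.mk (srIdeal k Δ) (MvPolynomial.X i) • u i := by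
    intro j w hw
    obtain ⟨u, rfl⟩ := mem_max_smul w hw
    refine ⟨fun i => P j (u i), fun i => Pm _ _, ?_⟩
    rw [map_sum]
    exact Finset.sum_congr rfl (fun i _ => PX i j (u i))
  have inj : ∀ j : ℤ, gr j = ⊥ → Function.Injective (L.domRestrict (gr (1 + j))) := by
    intro j hj
    rw [injective_iff_map_eq_zero]
    rintro ⟨w, hw⟩ h
    obtain ⟨u, hu, h2⟩ := key j w ((hL w).1 h)
    rw [Ps _ w hw] at h2
    apply Subtype.ext
    change w = 0
    rw [h2]
    refine Finset.sum_eq_zero (fun i _ => ?_)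
    have h3 := hu i
    rw [hj, Submodule.mem_bot] at h3
    rw [h3, smul_zero]
  have i0 := inj (-1) (hneg _ (by norm_num))
  rw [show (1 + -1 : ℤ) = 0 by norm_num] at i0
  haveI := Module.Finite.of_injective _ i0
  have g0 : gr 0 = ⊥ := Submodule.finrank_eq_zero.1 h0
  have i1 := inj 0 g0
  rw [show (1 + 0 : ℤ) = 1 by norm_num] at i1
  haveI := Module.Finite.of_injective _ i1
  have s1 : Function.Surjective (L.domRestrict (gr 1)) :=
    (LinearMap.injective_iff_surjective_of_finrank_eq_finrank
      (by rw [h1, Module.finrank_fin_fun])).1 i1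
  have main : ∀ j : ℕ, ∀ w ∈ gr (j : ℤ), w ∈ Submodule.span (SRRing k Δ) (gr 1 : Set ω) := by
    intro j
    induction j with
    | zero =>
      intro w hw
      rw [Nat.cast_zero, g0, Submodule.mem_bot] at hw
      rw [hw]
      exact Submodule.zero_mem _
    | succ j ih =>
      intro w hw
      by_cases hj : j = 0
      · subst hj
        rw [zero_add, Nat.cast_one] at hw
        exact Submodule.subset_span hw
      obtain ⟨⟨g, hg⟩, hgw⟩ := s1 (L w)
      have hgw' : L g = L w := hgw
      have hm : w - g ∈ srMax k Δ • (⊤ : Submodule (SRRing k Δ) ω) := by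
        rw [← hL, map_sub, hgw', sub_self]
      obtain ⟨u, hu, h2⟩ := key j _ hm
      have e1 : ((j + 1 : ℕ) : ℤ) = 1 + (j : ℤ) := by push_cast; ring
      rw [e1] at hw
      rw [map_sub, Ps _ w hw, Pn 1 _ (by omega) g hg, sub_zero] at h2
      rw [h2]
      exact Submodule.sum_mem _ (fun i _ => Submodule.smul_mem _ _ (ih _ (hu i)))
  rw [eq_top_iff]
  intro w _
  refine Pind (fun w => w ∈ Submodule.span (SRRing k Δ) (gr 1 : Set ω)) ?_ ?_ w
  · intro j w hw
    rcases lt_or_ge j 0 with h | h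
    · rw [hneg j h, Submodule.mem_bot] at hw
      rw [hw]
      exact Submodule.zero_mem _
    · obtain ⟨m, rfl⟩ := Int.eq_ofNat_of_zero_le h
      exact main m w hw
  · intro x y hx hy
    exact Submodule.add_mem _ hx hy

/-- the degree one functional, linear version -/
noncomputable def Pkg.lamLin [IsScalarTower k (SRRing k Δ) ω] (p : Pkg k Δ ω) :
    ω →ₗ[k] (Fin n → k) :=
  { toFun := p.lam
    map_add' := p.lam_add
    map_smul' := by
      intro c x
      have : c • x = Ideal.Quotient.mk (srIdeal k Δ) (MvPolynomial.C c) • x := by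
        have h : c • x = (c • (1 : SRRing k Δ)) • x := by rw [smul_assoc, one_smul]
        rw [h, ← Algebra.algebraMap_eq_smul_one]
        rfl
      rw [this]
      exact p.lam_smul c x }

theorem hilb_zero (m : ℕ) (hm : Δ.faces.sup Finset.card = m + 1)
    (hK : ∀ z ∈ KK k Δ.low (m + 1) ∅, z = 0) : canonicalHilbert k Δ 0 = 0 := by
  unfold canonicalHilbert
  apply Finset.sum_eq_zero
  intro a ha
  rw [Finset.mem_filter] at ha
  have : (Finset.univ.filter fun i => a i ≠ 0) = ∅ := by
    rw [Finset.filter_eq_empty_iff]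
    intro i _
    have := (Finset.sum_eq_zero_iff.1 ha.2) i (Finset.mem_univ i)
    simpa using this
  rw [this, hm, Nat.add_sub_cancel]
  obtain ⟨f⟩ := relHom_equiv k Δ ∅ m hm
  rw [f.finrank_eq]
  haveI : Subsingleton (KK k Δ.low (m + 1) ∅) :=
    ⟨fun x y => Subtype.ext ((hK x x.2).trans (hK y y.2).symm)⟩
  exact Module.finrank_zero_of_subsingleton

theorem hilb_one (m : ℕ) (hm : Δ.faces.sup Finset.card = m + 1)
    (hK : ∀ v, Module.finrank k (KK k Δ.low (m + 1) {v}) = 1) : canonicalHilbert k Δ 1 = n := by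
  unfold canonicalHilbert
  have hrel : ∀ (v : Fin n) (σ : Finset (Fin n)), σ = {v} →
      Module.finrank k (Δ.relHomology k σ (Δ.faces.sup Finset.card - 1)) = 1 := by
    rintro v σ rfl
    rw [hm, Nat.add_sub_cancel]
    obtain ⟨f⟩ := relHom_equiv k Δ {v} m hm
    rw [f.finrank_eq, hK]
  have hset : (Fintype.piFinset fun _ : Fin n => Finset.range (1 + 1)).filter
      (fun a => ∑ i, a i = 1) = Finset.univ.image (fun v : Fin n => (Pi.single v 1 : Fin n → ℕ)) := by
    ext a
    rw [Finset.mem_filter, Fintype.mem_piFinset, Finset.mem_image]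
    constructor
    · rintro ⟨_, h⟩
      have hne : ∃ v, a v ≠ 0 := by
        by_contra hcon
        push Not at hcon
        rw [Finset.sum_eq_zero (fun i _ => hcon i)] at h
        omega
      obtain ⟨v, hv⟩ := hne
      refine ⟨v, Finset.mem_univ v, ?_⟩
      rw [← Finset.add_sum_erase _ _ (Finset.mem_univ v)] at h
      have hs : ∑ i ∈ Finset.univ.erase v, a i = 0 := by omega
      funext u
      by_cases hu : u = v
      · subst hu
        rw [Pi.single_eq_same]
        omega
      · rw [Pi.single_eq_of_ne hu]
        exact ((Finset.sum_eq_zero_iff.1 hs) u (Finset.mem_erase.2 ⟨hu, Finset.mem_univ u⟩)).symm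
    · rintro ⟨v, _, rfl⟩
      refine ⟨fun u => ?_, ?_⟩
      · rw [Finset.mem_range, Pi.single_apply]
        split_ifs <;> omega
      · rw [Finset.sum_pi_single']
        simp
  rw [hset, Finset.sum_image]
  · refine Eq.trans (Finset.sum_congr rfl (fun v _ => (?_ : _ = 1))) (by simp)
    exact hrel v _ (by
      ext i
      simp [Pi.single_apply])
  · intro u _ v _ huv
    by_contra hne
    have := congrFun huv u
    simp only [Pi.single_eq_same, Pi.single_eq_of_ne hne] at this
    omega

end Level

set_option maxHeartbeats 1000000 in
set_option synthInstance.maxHeartbeats 1000000 in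
/-- Let `Δ` be a non-`k`-orientable `k`-homology manifold on `n` vertices
with `R = k[Δ]` Cohen--Macaulay.  Then `R` is level of Cohen--Macaulay type `n`, and
`tr(ω_R) = 𝔐²`. -/
theorem level_of_type_n_and_trace_eq_sq
    (k : Type) [Field k] {n : ℕ} (Δ : SC n) (hvert : ∀ v : Fin n, Δ.IsVertex v)
    (hHM : Δ.IsHomologyManifold k) (hnonor : ¬ Δ.Orientable k)
    (hCM : IsCohenMacaulayAt (SRRing k Δ) (srMax k Δ))
    (ω : Type) [AddCommGroup ω] [Module (SRRing k Δ) ω] [Module k ω]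
    [IsScalarTower k (SRRing k Δ) ω]
    (hω : IsCanonicalModuleQ k (srIdeal k Δ) ω)
    (gr : ℤ → Submodule k ω) (hgr : IsCanonicallyGraded k Δ ω gr) :
    (∃ j : ℤ, Submodule.span (SRRing k Δ) (gr j : Set ω) = ⊤) ∧
      muGen k (SRRing k Δ) (srMax k Δ) ω = n ∧
      traceIdeal (SRRing k Δ) ω = srMax k Δ ^ 2 := by
  obtain ⟨v0, hv0⟩ := hHM.1.1
  obtain ⟨m, hm0, hm⟩ := two_le k Δ v0 hv0 hnonor
  have hlt := card_lt k Δ hHM hvert m hm0 hm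
  have hK := KK_empty_eq_zero k Δ m hm hm0 hnonor
  obtain ⟨e, e_mem, e_ne, e_gen, e_span⟩ := comb_package k Δ hHM hvert (m + 1) hm
  obtain ⟨Ψ, inj, smul, img⟩ := omega_desc k Δ ω hω m hm hlt
  have hpure : ∀ σ ∈ Δ.faces, ∃ F ∈ Δ.faces, F.card = m + 1 ∧ σ ⊆ F := by
    intro σ hσ
    obtain ⟨F, hF, hs⟩ := Δ.exists_facet σ hσ
    exact ⟨F, hF.1, (purity k Δ hHM hvert F hF).trans hm, hs⟩
  let p : Pkg k Δ ω :=
    { d := m + 1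
      two_le := by omega
      lt := hlt
      vert := hvert
      conn := hHM.1
      pure := hpure
      K1 := hK
      e := e
      e_mem := e_mem
      e_ne := e_ne
      e_gen := e_gen
      Ψ := Ψ
      inj := inj
      smul := smul
      img := img }
  refine ⟨⟨1, ?_⟩, p.muGen_eq, le_antisymm p.trace_le p.sq_le_trace⟩
  obtain ⟨hc, hneg, hH⟩ := hgr
  refine level_aux gr hc hneg ?_ ?_ p.lamLin ?_
  · exact (hH 0).trans (hilb_zero m hm hK)
  · refine (hH 1).trans (hilb_one m hm (fun v => ?_))
    refine (finrank_eq_one_iff_of_nonzero' (⟨e v, e_mem v⟩ : KK k Δ.low (m + 1) {v}) ?_).2 ?_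
    · intro h
      obtain ⟨F, h1, h2, h3⟩ := hpure {v} (hvert v)
      exact e_ne v F h1 h2 (h3 (by simp)) (congrFun (congrArg Subtype.val h) F)
    · rintro ⟨z, hz⟩
      obtain ⟨c, rfl⟩ := e_span v z hz
      exact ⟨c, rfl⟩
  · intro w
    exact ⟨p.mem_of_lam w, p.lam_eq_zero_of_mem w⟩
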